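/- Every subshift on a finite number of symbols that satisfies almost weak specification is fully universal: for every invertible ergodic measure-preserving transformation T of a non-atomic Lebesgue probability space (X, μ) with h_μ(T) strictly less than the topological entropy of the subshift, there exists an embedding of (X, μ, T) into the subshift whose push-forward measure is fully supported. -/

import Mathlib

open MeasureTheory Filter Set
open scoped ENNReal

/-- Shannon entropy of the finite-valued observable `P` with respect to `μ`. -/
noncomputable def infoEntropy {X : Type*} [MeasurableSpace X] (μ : Measure X)
    {α : Type*} [Fintype α] (P : X → α) : ℝ :=
  ∑ a : α, Real.negMulLog (μ (P ⁻¹' {a})).toReal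

/-- Entropy of the transformation `T` with respect to the observable (finite partition) `P`. -/
noncomputable def entropyWrt {X : Type*} [MeasurableSpace X] (μ : Measure X) (T : X → X)
    {α : Type*} [Fintype α] (P : X → α) : ℝ :=
  Filter.atTop.liminf fun n : ℕ =>
    infoEntropy μ (fun x => fun i : Fin n => P (T^[(i : ℕ)] x)) / n

/-- Kolmogorov–Sinai (measure-theoretic) entropy of `T` with respect to `μ`. -/
noncomputable def ksEntropy {X : Type*} [MeasurableSpace X] (μ : Measure X) (T : X → X) : ℝ≥0∞ :=
  ⨆ (k : ℕ) (P : X → Fin k) (_ : Measurable P), ENNReal.ofReal (entropyWrt μ T P)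

/-- Topological entropy (Bowen–Dinaburg, via dynamical covers). -/
noncomputable def topEntropy {Y : Type*} [UniformSpace Y] (S : Y → Y) : EReal :=
  Dynamics.coverEntropy S Set.univ

/-- `Ψ` is an embedding of the measure-preserving system `(X, μ, T)` into `(Y, S)`. -/
def IsMeasEmbedding {X Y : Type*} [MeasurableSpace X] [MeasurableSpace Y]
    (μ : Measure X) (T : X → X) (S : Y → Y) (Ψ : X → Y) : Prop :=
  Measurable Ψ ∧ ∃ X' : Set X, MeasurableSet X' ∧ μ X'ᶜ = 0 ∧ Set.InjOn Ψ X' ∧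
    ∀ x ∈ X', Ψ (T x) = S (Ψ x)

/-- A measure on a topological space has full support. -/
def FullSupport {Y : Type*} [TopologicalSpace Y] [MeasurableSpace Y] (ν : Measure Y) : Prop :=
  ∀ U : Set Y, IsOpen U → U.Nonempty → 0 < ν U

/-- `(Y, S)` is fully universal. -/
def FullyUniversal {Y : Type*} [UniformSpace Y] [MeasurableSpace Y] (S : Y → Y) : Prop :=
  ∀ (X : Type) [MeasurableSpace X] (μ : Measure X) (T : X ≃ᵐ X),
    StandardBorelSpace X → IsProbabilityMeasure μ → NoAtoms μ → Ergodic (⇑T) μ →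
    (ksEntropy μ (⇑T) : EReal) < topEntropy S →
    ∃ Ψ : X → Y, IsMeasEmbedding μ (⇑T) S Ψ ∧ FullSupport (μ.map Ψ)

/-- `L` is a gap function for the invertible system `S` at scale `ε`. -/
def IsGapFunction {Y : Type*} [MetricSpace Y] (S : Y ≃ Y) (ε : ℝ) (L : ℕ → ℕ) : Prop :=
  Monotone L ∧ (∀ m, 0 < L m) ∧
    ∀ (n : ℕ) (y : Fin n → Y) (a b : Fin n → ℤ),
      (∀ i, a i ≤ b i) →
      (∀ i j : Fin n, (i : ℕ) + 1 = (j : ℕ) → (L (b j - a j).toNat : ℤ) ≤ a j - b i) →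
      ∃ z : Y, ∀ (i : Fin n) (k : ℤ), a i ≤ k → k ≤ b i →
        dist ((S ^ k) z) ((S ^ k) (y i)) ≤ ε

/-- Almost weak specification: for every `ε > 0` there is a sublinear gap function. -/
def AlmostWeakSpec {Y : Type*} [MetricSpace Y] (S : Y ≃ Y) : Prop :=
  ∀ ε : ℝ, 0 < ε → ∃ L : ℕ → ℕ, IsGapFunction S ε L ∧
    Filter.Tendsto (fun m : ℕ => (L m : ℝ) / m) Filter.atTop (nhds 0)

/-- The shift map on bi-infinite sequences. -/
def fullShift {A : Type*} : (ℤ → A) → (ℤ → A) := fun x n => x (n + 1)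

noncomputable instance (k : ℕ) : MetricSpace (Fin k) :=
  MetricSpace.induced (fun i : Fin k => (i : ℝ))
    (fun a b h => Fin.val_injective (Nat.cast_injective h)) inferInstance

/-- The standard metric on the full shift over a finite alphabet. -/
noncomputable instance (k : ℕ) : MetricSpace (ℤ → Fin k) := PiCountable.metricSpace

instance (k : ℕ) : MeasurableSpace (ℤ → Fin k) := borel _
instance (k : ℕ) : BorelSpace (ℤ → Fin k) := ⟨rfl⟩

section Iterates

variable {X : Type*} [MeasurableSpace X]

/-- Integer iterates of a measurable automorphism. -/
def itZ (T : X ≃ᵐ X) (i : ℤ) (x : X) : X := ((T.toEquiv : Equiv.Perm X) ^ i) x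

lemma itZ_zero (T : X ≃ᵐ X) (x : X) : itZ T 0 x = x := by simp [itZ]

lemma itZ_add (T : X ≃ᵐ X) (i j : ℤ) (x : X) : itZ T (i + j) x = itZ T i (itZ T j x) := by
  simp [itZ, zpow_add]

lemma itZ_one (T : X ≃ᵐ X) (x : X) : itZ T 1 x = T x := by simp [itZ]

lemma itZ_neg_one (T : X ≃ᵐ X) (x : X) : itZ T (-1) x = T.symm x := by
  simp only [itZ, zpow_neg, zpow_one]; rfl

lemma itZ_add_one (T : X ≃ᵐ X) (i : ℤ) (x : X) : itZ T (i + 1) x = T (itZ T i x) := by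
  rw [add_comm, itZ_add, itZ_one]

lemma itZ_natCast (T : X ≃ᵐ X) (n : ℕ) (x : X) : itZ T n x = T^[n] x := by
  induction n with
  | zero => simp [itZ_zero]
  | succ n ih => rw [Nat.cast_succ, itZ_add_one, ih, Function.iterate_succ_apply']

lemma measurable_itZ (T : X ≃ᵐ X) (i : ℤ) : Measurable (itZ T i) := by
  induction i using Int.induction_on with
  | zero =>
    have : itZ T 0 = id := by ext x; simp [itZ_zero]
    rw [this]; exact measurable_id
  | succ n ih =>
    have : itZ T (n + 1) = T ∘ itZ T n := by ext x; simp [itZ_add_one]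
    rw [this]; exact T.measurable.comp ih
  | pred n ih =>
    have : itZ T (-n - 1) = T.symm ∘ itZ T (-n) := by
      ext x; rw [sub_eq_add_neg, add_comm, itZ_add, itZ_neg_one]; rfl
    rw [this]; exact T.symm.measurable.comp ih

/-- Integer iterates as measurable equivalences. -/
def itE (T : X ≃ᵐ X) (i : ℤ) : X ≃ᵐ X where
  toFun := itZ T i
  invFun := itZ T (-i)
  left_inv x := by rw [← itZ_add]; simp [itZ_zero]
  right_inv x := by rw [← itZ_add]; simp [itZ_zero]
  measurable_toFun := measurable_itZ T i
  measurable_invFun := measurable_itZ T (-i)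

lemma measurePreserving_itZ {μ : Measure X} {T : X ≃ᵐ X} (hT : MeasurePreserving T μ μ) (i : ℤ) :
    MeasurePreserving (itZ T i) μ μ := by
  have hs : MeasurePreserving T.symm μ μ := hT.symm
  induction i using Int.induction_on with
  | zero => 
    have : itZ T 0 = id := by ext x; simp [itZ_zero]
    rw [this]; exact MeasurePreserving.id μ
  | succ n ih =>
    have : itZ T (n + 1) = T ∘ itZ T n := by ext x; simp [itZ_add_one]
    rw [this]; exact hT.comp ih
  | pred n ih =>
    have : itZ T (-n - 1) = T.symm ∘ itZ T (-n) := by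
      ext x; rw [sub_eq_add_neg, add_comm, itZ_add, itZ_neg_one]; rfl
    rw [this]; exact hs.comp ih

lemma measure_preimage_itZ {μ : Measure X} {T : X ≃ᵐ X} (hT : MeasurePreserving T μ μ) (i : ℤ)
    (s : Set X) : μ (itZ T i ⁻¹' s) = μ s :=
  MeasurePreserving.measure_preimage_equiv (f := itE T i) (measurePreserving_itZ hT i) s

lemma ae_itZ {μ : Measure X} {T : X ≃ᵐ X} (hT : MeasurePreserving T μ μ) {p : X → Prop}
    (h : ∀ᵐ x ∂μ, p x) : ∀ᵐ x ∂μ, ∀ i : ℤ, p (itZ T i x) := by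
  rw [ae_all_iff]
  exact fun i => (measurePreserving_itZ hT i).quasiMeasurePreserving.ae h

end Iterates

section WeakErgodic

variable {X : Type*} [MeasurableSpace X] {μ : Measure X} [IsProbabilityMeasure μ]

/-- Weak law of large numbers for ergodic systems, for bounded observables. -/
lemma Ergodic.tendsto_measure_birkhoffSum_gt {T : X → X} (hT : Ergodic T μ) {φ : X → ℝ}
    (hφ : Measurable φ) {C : ℝ} (hC : ∀ x, |φ x| ≤ C) {δ : ℝ} (hδ : 0 < δ) :
    Tendsto (fun N : ℕ => μ {x | N * (∫ y, φ y ∂μ + δ) < ∑ i ∈ Finset.range N, φ (T^[i] x)})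
      atTop (nhds 0) := by
  have : Fact ((1 : ℝ≥0∞) ≤ 2) := ⟨by norm_num⟩
  have h_integral : Integrable φ μ :=
    Integrable.of_bound hφ.aestronglyMeasurable C (ae_of_all _ fun x => by simpa using hC x)
  set m := ∫ y, φ y ∂μ with hm
  set ψ : X → ℝ := fun x => φ x - m with hψ
  have hψm : Measurable ψ := hφ.sub_const m
  have hψL : MemLp ψ 2 μ := by
    refine MemLp.of_bound hψm.aestronglyMeasurable (C + |m|) (ae_of_all _ fun x => ?_)
    simp only [hψ, Real.norm_eq_abs]
    exact (abs_sub _ _).trans (by linarith [hC x])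
  have hψ0 : ∫ x, ψ x ∂μ = 0 := by
    simp only [hψ]
    rw [integral_sub h_integral (integrable_const _)]; simp [hm]
  set f : Lp ℝ 2 μ := hψL.toLp ψ with hf
  set U : Lp ℝ 2 μ →ₗᵢ[ℝ] Lp ℝ 2 μ :=
    Lp.compMeasurePreservingₗᵢ ℝ T hT.toMeasurePreserving with hU
  have hUn : ‖U.toContinuousLinearMap‖ ≤ 1 := U.norm_toContinuousLinearMap_le
  have key := ContinuousLinearMap.tendsto_birkhoffAverage_orthogonalProjection
    U.toContinuousLinearMap hUn f
  have hproj : ((U.toContinuousLinearMap.eqLocus (1 :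
      Lp ℝ 2 μ →L[ℝ] Lp ℝ 2 μ)).orthogonalProjectionOnto f) = 0 := by
    rw [Submodule.orthogonalProjectionOnto_eq_zero_iff, Submodule.mem_orthogonal]
    intro g hg
    have hg' : Lp.compMeasurePreserving T hT.toMeasurePreserving g = g := by
      exact hg
    obtain ⟨c, hc⟩ := hT.ae_eq_const_of_ae_eq_comp_ae (g := g) (Lp.aestronglyMeasurable g) (by
      have h1 := Lp.coeFn_compMeasurePreserving g hT.toMeasurePreserving
      rw [hg'] at h1
      exact h1.symm)
    rw [L2.inner_def]
    have : ∫ a, inner ℝ (g a) (f a) ∂μ = ∫ a, c * ψ a ∂μ := by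
      refine integral_congr_ae ?_
      filter_upwards [hc, hψL.coeFn_toLp] with a h1 h2
      rw [h1, hf, h2]
      simp [mul_comm]
    rw [this, integral_const_mul, hψ0, mul_zero]
  rw [hproj] at key
  have hiter : ∀ n : ℕ, (U.toContinuousLinearMap)^[n] f =
      Lp.compMeasurePreserving (T^[n]) (hT.toMeasurePreserving.iterate n) f := by
    intro n
    exact congrFun (Lp.compMeasurePreserving_iterate hT.toMeasurePreserving n) f
  have hcoe : ∀ N : ℕ, ((birkhoffAverage ℝ U.toContinuousLinearMap _root_.id N f : Lp ℝ 2 μ) : X →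
      ℝ) =ᵐ[μ]
      fun x => (N : ℝ)⁻¹ * ∑ i ∈ Finset.range N, ψ (T^[i] x) := by
    intro N
    have h1 : ∀ i : ℕ, (((U.toContinuousLinearMap)^[i] f : Lp ℝ 2 μ) : X → ℝ) =ᵐ[μ] fun x =>
        ψ (T^[i] x) := by
      intro i
      rw [hiter]
      refine (Lp.coeFn_compMeasurePreserving f _).trans ?_
      exact (hT.toMeasurePreserving.iterate i).quasiMeasurePreserving.ae_eq hψL.coeFn_toLp
    have h2 : ∀ᵐ x ∂μ, ∀ i : ℕ, (((U.toContinuousLinearMap)^[i] f : Lp ℝ 2 μ) : X → ℝ) x =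
        ψ (T^[i] x) := by
      rw [ae_all_iff]; exact h1
    have h3 : ((∑ i ∈ Finset.range N, (U.toContinuousLinearMap)^[i] f : Lp ℝ 2 μ) : X → ℝ) =ᵐ[μ]
        ∑ i ∈ Finset.range N, (((U.toContinuousLinearMap)^[i] f : Lp ℝ 2 μ) : X → ℝ) :=
            Lp.coeFn_finsetSum _ _
    simp only [birkhoffAverage, birkhoffSum, id]
    filter_upwards [h2, h3, Lp.coeFn_smul (N : ℝ)⁻¹ (∑ i ∈ Finset.range N,
        (U.toContinuousLinearMap)^[i] f)] with x h2 h3 h4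
    rw [h4, Pi.smul_apply, h3, smul_eq_mul, Finset.sum_apply]
    congr 1
    exact Finset.sum_congr rfl fun i _ => h2 i
  have hnorm : Tendsto (fun N : ℕ => eLpNorm (fun x => (N : ℝ)⁻¹ * ∑ i ∈ Finset.range N,
      ψ (T^[i] x)) 2 μ)
      atTop (nhds 0) := by
    have h1 : Tendsto (fun N => ‖birkhoffAverage ℝ U.toContinuousLinearMap _root_.id N f‖ₑ)
        atTop (nhds 0) := by
      have := key.enorm
      simpa using this
    refine h1.congr fun N => ?_
    rw [Lp.enorm_def]
    exact eLpNorm_congr_ae (hcoe N)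
  have hmeas : ∀ N : ℕ, Measurable (fun x => (N : ℝ)⁻¹ * ∑ i ∈ Finset.range N, ψ (T^[i] x)) := by
    intro N
    refine Measurable.const_mul (Finset.measurable_fun_sum _ fun i _ => ?_) _
    exact hψm.comp (hT.measurable.iterate i)
  have hdist : TendstoInMeasure μ (fun (N : ℕ) x => (N : ℝ)⁻¹ * ∑ i ∈ Finset.range N, ψ (T^[i] x))
      atTop (fun _ => 0) := by
    refine tendstoInMeasure_of_tendsto_eLpNorm (p := 2) (by norm_num)
      (fun N => (hmeas N).aestronglyMeasurable) aestronglyMeasurable_const ?_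
    refine hnorm.congr fun N => ?_
    congr 1
    ext x
    simp
  have h5 := hdist (ENNReal.ofReal δ) (by simpa using hδ)
  refine tendsto_of_tendsto_of_tendsto_of_le_of_le' tendsto_const_nhds h5
    (Eventually.of_forall fun _ => zero_le) ?_
  filter_upwards [eventually_gt_atTop 0] with N hN
  refine measure_mono fun x hx => ?_
  simp only [mem_ofPred_eq, edist_dist, Real.dist_eq, sub_zero] at hx ⊢
  refine ENNReal.ofReal_le_ofReal ?_
  have hN' : (0 : ℝ) < N := by exact_mod_cast hN
  have : ∑ i ∈ Finset.range N, ψ (T^[i] x) = ∑ i ∈ Finset.range N, φ (T^[i] x) - N * m := by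
    simp [hψ, Finset.sum_sub_distrib]
  rw [this]
  refine le_trans ?_ (le_abs_self _)
  rw [inv_mul_eq_div, le_div_iff₀ hN']
  nlinarith

end WeakErgodic

section MarkerCombinatorics

/-- Cut points of a block of length `r` into pieces of length `n` followed by pieces of length
`n + 1`. -/
def IsCut (n r e : ℕ) : Prop :=
  (e ≤ (r / n - r % n) * n ∧ n ∣ e) ∨
    ((r / n - r % n) * n < e ∧ (n + 1) ∣ (e - (r / n - r % n) * n))

lemma IsCut.not_add {n r e i : ℕ} (h : IsCut n r e) (h' : IsCut n r (e + i)) (hi : 0 < i)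
    (hin : i < n) : False := by
  unfold IsCut at h h'
  generalize r / n - r % n = a at h h'
  have h1 : ∀ m, 0 < m → i < m → ¬ m ∣ i := fun m _ h h' => absurd (Nat.le_of_dvd hi h') (by omega)
  rcases h with ⟨h, k, rfl⟩ | ⟨h, k, hk⟩
  · rcases h' with ⟨h', h2⟩ | ⟨h', l, h2⟩
    · exact h1 n (by omega) hin ((Nat.dvd_add_right (Dvd.intro _ rfl)).1 h2)
    · have hka : k ≤ a := by
        rw [mul_comm] at h; exact Nat.le_of_mul_le_mul_right h (by omega)
      rcases hka.eq_or_lt with rfl | hlt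
      · refine h1 (n + 1) (by omega) (by omega) ⟨l, ?_⟩
        rw [← h2, mul_comm k n]; omega
      · have : (k + 1) * n ≤ a * n := Nat.mul_le_mul_right n hlt
        have h3 : (k + 1) * n = n * k + n := by ring
        omega
  · rcases h' with ⟨h', h2⟩ | ⟨h', l, h2⟩
    · omega
    · refine h1 (n + 1) (by omega) (by omega) ?_
      have : (n + 1) ∣ (e + i - a * n) - (e - a * n) :=
        Nat.dvd_sub ⟨l, h2⟩ ⟨k, hk⟩
      rwa [show (e + i - a * n) - (e - a * n) = i by omega] at this

lemma cut_eq {n r : ℕ} (hn : 0 < n) (hr : n * n ≤ r) :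
    (r / n - r % n) * n + (r % n) * (n + 1) = r := by
  have h1 : r % n < n := Nat.mod_lt _ hn
  have h2 : n ≤ r / n := (Nat.le_div_iff_mul_le hn).2 hr
  have h3 := Nat.div_add_mod r n
  obtain ⟨a, ha⟩ := Nat.exists_eq_add_of_le (h1.le.trans h2)
  rw [ha] at h3 ⊢
  rw [Nat.add_sub_cancel_left]
  nlinarith

lemma IsCut.le_of_lt {n r e : ℕ} (h : IsCut n r e) (hn : 0 < n) (hr : n * n ≤ r) (her : e < r) :
    e + n ≤ r := by
  have h1 := cut_eq hn hr
  unfold IsCut at h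
  generalize r / n - r % n = a at h h1
  generalize r % n = b at h1
  rcases h with ⟨h, k, rfl⟩ | ⟨h, k, hk⟩
  · rcases Nat.eq_zero_or_pos b with rfl | hb
    · simp only [zero_mul, add_zero] at h1
      subst h1
      rw [mul_comm] at her
      have : k + 1 ≤ a := Nat.lt_of_mul_lt_mul_right her
      have := Nat.mul_le_mul_right n this
      nlinarith
    · nlinarith
  · have h2 : e = a * n + (n + 1) * k := by omega
    have h3 : k < b := by
      by_contra! h4
      have := Nat.mul_le_mul_right (n + 1) h4
      nlinarith
    have := Nat.mul_le_mul_right (n + 1) h3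
    have h4 : (k + 1) * (n + 1) = (n + 1) * k + n + 1 := by ring
    simp only [Nat.succ_eq_add_one] at this
    omega

lemma exists_isCut {n r : ℕ} (hn : 0 < n) (e : ℕ) : ∃ d ≤ n, d ≤ e ∧ IsCut n r (e - d) := by
  unfold IsCut
  generalize r / n - r % n = a
  rcases le_or_gt e (a * n) with h | h
  · exact ⟨e % n, (Nat.mod_lt _ hn).le, Nat.mod_le _ _, Or.inl ⟨by omega, Nat.dvd_sub_mod e⟩⟩
  · refine ⟨(e - a * n) % (n + 1), ?_, (Nat.mod_le _ _).trans (by omega), ?_⟩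
    · have := Nat.mod_lt (e - a * n) (show 0 < n + 1 by omega); omega
    · have h1 : (e - a * n) % (n + 1) ≤ e - a * n := Nat.mod_le _ _
      rcases h1.eq_or_lt with h2 | h2
      · left
        rw [h2]
        refine ⟨by omega, ?_⟩
        rw [show e - (e - a * n) = a * n by omega]
        exact Dvd.intro_left _ rfl
      · right
        refine ⟨by omega, ?_⟩
        rw [show e - (e - a * n) % (n + 1) - a * n = (e - a * n) - (e - a * n) % (n + 1) by omega]
        exact Nat.dvd_sub_mod _

/-- `0` is a cut point for the gap of `S` around it. -/
def IsMark (n : ℕ) (S : ℤ → Prop) : Prop :=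
  ∃ e s : ℕ, 0 < s ∧ S (-e) ∧ (∀ i < e, ¬ S (-i)) ∧ S s ∧ (∀ j, 0 < j → j < s → ¬ S (j : ℕ)) ∧
    IsCut n (e + s) e

lemma IsMark.not_shift {n : ℕ} {S : ℤ → Prop} (hn : 0 < n)
    (hS : ∀ i, S i → ∀ j : ℤ, 0 < j → j < n * n → ¬ S (i + j)) (h : IsMark n S) {i : ℕ}
    (hi : 0 < i) (hin : i < n) : ¬ IsMark n (fun j => S (j + i)) := by
  rintro ⟨e', s', hs', he', he2', hs1', hs2', hc'⟩
  obtain ⟨e, s, hs, he, he2, hs1, hs2, hc⟩ := h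
  have hr : n * n ≤ e + s := by
    by_contra! hlt
    exact hS _ he ((e + s : ℕ) : ℤ) (by omega) (by exact_mod_cast hlt) (by
      rw [show (-(e : ℤ) + ((e + s : ℕ) : ℤ)) = s by push_cast; ring]; exact hs1)
  have hns : n ≤ s := by have := hc.le_of_lt hn hr (by omega); omega
  have e1 : e' = e + i := by
    rcases lt_trichotomy e' (e + i) with h | h | h
    · exfalso
      rcases le_or_gt i e' with h3 | h3
      · refine he2 (e' - i) (by omega) ?_
        rw [show -((e' - i : ℕ) : ℤ) = -e' + i by omega]; exact he'
      · refine hs2 (i - e') (by omega) (by omega) ?_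
        rw [show ((i - e' : ℕ) : ℤ) = -e' + i by omega]; exact he'
    · exact h
    · exfalso
      refine he2' (e + i) h ?_
      beta_reduce
      rw [show -((e + i : ℕ) : ℤ) + i = -e by push_cast; ring]; exact he
  have e2 : s' + i = s := by
    rcases lt_trichotomy (s' + i) s with h | h | h
    · exfalso
      refine hs2 (s' + i) (by omega) h ?_
      push_cast; exact hs1'
    · exact h
    · exfalso
      refine hs2' (s - i) (by omega) (by omega) ?_
      beta_reduce
      rw [show ((s - i : ℕ) : ℤ) + i = s by omega]; exact hs1
  subst e1
  rw [show e + i + s' = e + s by omega] at hc'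
  exact hc.not_add hc' hi hin

lemma exists_isMark {n : ℕ} {S : ℤ → Prop} (hn : 0 < n) (h1 : ∃ e : ℕ, S (-e))
    (h2 : ∃ s : ℕ, 0 < s ∧ S s) : ∃ d : ℕ, d ≤ n ∧ IsMark n (fun j => S (j - d)) := by
  classical
  set e := Nat.find h1 with he
  set s := Nat.find h2 with hs
  have he1 : S (-e) := Nat.find_spec h1
  have he2 : ∀ i < e, ¬ S (-i) := fun i hi => Nat.find_min h1 hi
  obtain ⟨hs0, hs1⟩ := Nat.find_spec h2
  have hs2 : ∀ j, 0 < j → j < s → ¬ S (j : ℕ) := fun j hj hjs h => Nat.find_min h2 hjs ⟨hj, h⟩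
  obtain ⟨d, hd, hde, hc⟩ := exists_isCut (r := e + s) hn e
  refine ⟨d, hd, e - d, s + d, by omega, ?_, ?_, ?_, ?_, ?_⟩
  · beta_reduce
    rw [show -((e - d : ℕ) : ℤ) - d = -e by omega]; exact he1
  · intro i hi
    beta_reduce
    rw [show -(i : ℤ) - d = -((i + d : ℕ) : ℤ) by omega]; exact he2 _ (by omega)
  · beta_reduce
    rw [show ((s + d : ℕ) : ℤ) - d = s by omega]; exact hs1
  · intro j hj hjs
    beta_reduce
    rcases le_or_gt j d with h | h
    · rw [show (j : ℤ) - d = -((d - j : ℕ) : ℤ) by omega]; exact he2 _ (by omega)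
    · rw [show (j : ℤ) - d = ((j - d : ℕ) : ℤ) by omega]; exact hs2 _ (by omega) (by omega)
  · rwa [show e - d + (s + d) = e + s by omega]

end MarkerCombinatorics

section Markers

variable {X : Type*} [MeasurableSpace X] {μ : Measure X} [IsProbabilityMeasure μ]

lemma exists_measurableSet_small [StandardBorelSpace X] (hna : NoAtoms μ) {ε : ℝ≥0∞}
    (hε : 0 < ε) : ∃ A, MeasurableSet A ∧ 0 < μ A ∧ μ A < ε := by
  letI := upgradeStandardBorel X
  letI := TopologicalSpace.metrizableSpaceMetric X
  obtain ⟨x, -, hx⟩ := exists_mem_forall_mem_nhdsWithin_pos_measure (μ := μ) (s := univ) (by simp)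
  obtain ⟨U, hxU, hU, hlt⟩ := Set.exists_isOpen_lt_of_lt {x} ε
    (by rw [hna.measure_singleton x]; exact hε)
  exact ⟨U, hU.measurableSet, hx U (by simpa using hU.mem_nhds (hxU rfl)), hlt⟩

lemma Ergodic.ae_exists_visit {T : X → X} (hT : Ergodic T μ) {A : Set X} (hA : MeasurableSet A)
    (h0 : μ A ≠ 0) : ∀ᵐ x ∂μ, ∃ i : ℕ, T^[i] x ∈ A := by
  set V : Set X := ⋃ i : ℕ, (T^[i]) ⁻¹' A with hV
  have hVm : MeasurableSet V := MeasurableSet.iUnion fun i => (hT.measurable.iterate i) hA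
  have hsub : T ⁻¹' V ⊆ V := by
    intro x hx
    simp only [hV, mem_preimage, mem_iUnion] at hx ⊢
    obtain ⟨i, hi⟩ := hx
    exact ⟨i + 1, by simpa [Function.iterate_succ_apply] using hi⟩
  rcases hT.ae_empty_or_univ_of_preimage_ae_le hVm.nullMeasurableSet
    (LE.le.eventuallyLE hsub) with h | h
  · exfalso
    have : μ V = 0 := by rw [measure_congr h]; simp
    exact h0 (measure_mono_null (subset_iUnion_of_subset 0 (by simp)) this)
  · filter_upwards [h.mem_iff] with x hx
    have : x ∈ V := hx.2 trivial
    simpa [hV] using this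

lemma Ergodic.symm_equiv {T : X ≃ᵐ X} (hT : Ergodic T μ) : Ergodic T.symm μ := by
  refine ⟨hT.toMeasurePreserving.symm, ⟨fun s hs h => ?_⟩⟩
  refine hT.aeconst_set hs ?_
  conv_lhs => rw [← h]
  ext x; simp

lemma Ergodic.ae_exists_visit_int {T : X ≃ᵐ X} (hT : Ergodic T μ) {A : Set X}
    (hA : MeasurableSet A) (h0 : μ A ≠ 0) :
    ∀ᵐ x ∂μ, (∃ e : ℕ, itZ T (-e) x ∈ A) ∧ ∃ s : ℕ, 0 < s ∧ itZ T s x ∈ A := by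
  have h1 := Ergodic.ae_exists_visit hT.symm_equiv hA h0
  have h2 := ae_itZ hT.toMeasurePreserving (Ergodic.ae_exists_visit hT hA h0)
  filter_upwards [h1, h2] with x h1 h2
  constructor
  · obtain ⟨e, he⟩ := h1
    refine ⟨e, ?_⟩
    have : ∀ e : ℕ, itZ T (-e) x = T.symm^[e] x := by
      intro e
      induction e with
      | zero => simp [itZ_zero]
      | succ n ih =>
        rw [Function.iterate_succ_apply', ← ih, ← itZ_neg_one, ← itZ_add]
        congr 1; push_cast; ring
    rwa [this]
  · obtain ⟨s, hs⟩ := h2 1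
    refine ⟨s + 1, by omega, ?_⟩
    push_cast
    rwa [itZ_add, itZ_natCast]

lemma exists_sparse_set [StandardBorelSpace X] (hna : NoAtoms μ) {T : X ≃ᵐ X} (hT : Ergodic T μ)
    {K : ℕ} (hK : 0 < K) : ∃ B, MeasurableSet B ∧ μ B ≠ 0 ∧
      ∀ x ∈ B, ∀ i : ℕ, 0 < i → i < K → T^[i] x ∉ B := by
  obtain ⟨A, hA, hA0, hA1⟩ := exists_measurableSet_small (μ := μ) hna (ε := (K : ℝ≥0∞)⁻¹) (by simp)
  set B : Set X := ⋃ m : ℕ, {x | T^[(m + 1) * K] x ∈ A ∧ ∀ i < (m + 1) * K, T^[i] x ∉ A} with hB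
  have hTi : ∀ i, Measurable (T^[i]) := fun i => T.measurable.iterate i
  have hmem : ∀ x, x ∈ B ↔ ∃ m : ℕ, T^[(m + 1) * K] x ∈ A ∧ ∀ i < (m + 1) * K, T^[i] x ∉ A := by
    intro x; simp [hB]
  refine ⟨B, ?_, ?_, ?_⟩
  · refine MeasurableSet.iUnion fun m => (hTi _ hA).inter ?_
    have : {x | ∀ i < (m + 1) * K, T^[i] x ∉ A} = ⋂ i, ⋂ (_ : i < (m + 1) * K), (T^[i] ⁻¹' A)ᶜ := by
      ext x; simp
    rw [show (fun a => ∀ i < (m + 1) * K, (⇑T)^[i] a ∉ A) = fun x => x ∈ {x | ∀ i < (m + 1) * K,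
        T^[i] x ∉ A} from rfl, this]
    exact MeasurableSet.iInter fun i => MeasurableSet.iInter fun _ => (hTi i hA).compl
  · intro h0
    have h1 : ∀ᵐ x ∂μ, ∀ i : ℕ, T^[i] x ∉ B := by
      rw [ae_all_iff]
      intro i
      exact (hT.toMeasurePreserving.iterate i).quasiMeasurePreserving.ae (measure_eq_zero_iff_ae_notMem.1 h0)
    have h2 := Ergodic.ae_exists_visit hT hA hA0.ne'
    have h3 : ∀ᵐ x ∂μ, x ∈ ⋃ i ∈ Finset.range K, T^[i] ⁻¹' A := by
      filter_upwards [h1, h2] with x h1 h2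
      classical
      set e := Nat.find h2 with he
      have he1 : T^[e] x ∈ A := Nat.find_spec h2
      have he2 : ∀ i < e, T^[i] x ∉ A := fun i hi => Nat.find_min h2 hi
      rcases lt_or_ge e K with h | h
      · simp only [Finset.mem_range, mem_iUnion, mem_preimage]
        exact ⟨e, h, he1⟩
      · exfalso
        have hq : 0 < e / K := Nat.div_pos h hK
        have h3 := Nat.div_add_mod e K
        refine h1 (e % K) ((hmem _).2 ⟨e / K - 1, ?_, ?_⟩)
        · rw [Nat.sub_add_cancel hq, ← Function.iterate_add_apply, mul_comm, h3]; exact he1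
        · rw [Nat.sub_add_cancel hq]
          intro i hi
          rw [← Function.iterate_add_apply]
          refine he2 _ ?_
          rw [mul_comm] at hi; omega
    have h4 : μ (⋃ i ∈ Finset.range K, T^[i] ⁻¹' A) = 1 := by
      rw [← prob_compl_eq_zero_iff (Finset.measurableSet_biUnion _ fun i _ => hTi i hA)]
      exact h3
    have h5 : μ (⋃ i ∈ Finset.range K, T^[i] ⁻¹' A) ≤ K * μ A := by
      refine (measure_biUnion_finset_le _ _).trans ?_
      rw [Finset.sum_congr rfl fun i _ =>
        (hT.toMeasurePreserving.iterate i).measure_preimage hA.nullMeasurableSet]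
      simp
    have hK' : (K : ℝ≥0∞) ≠ 0 := by exact_mod_cast hK.ne'
    have h6 : (K : ℝ≥0∞) * μ A < K * (K : ℝ≥0∞)⁻¹ :=
      ENNReal.mul_lt_mul_right hK' (by simp) hA1
    rw [ENNReal.mul_inv_cancel hK' (by simp)] at h6
    rw [h4] at h5
    exact absurd h6 (not_lt.2 h5)
  · intro x hx i hi hiK hx'
    obtain ⟨m, h1, h2⟩ := (hmem x).1 hx
    obtain ⟨m', h1', h2'⟩ := (hmem _).1 hx'
    rw [← Function.iterate_add_apply] at h1'
    have h3 : (m' + 1) * K + i = (m + 1) * K := by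
      rcases lt_trichotomy ((m' + 1) * K + i) ((m + 1) * K) with h | h | h
      · exact absurd h1' (h2 _ h)
      · exact h
      · exfalso
        have hKm : K ≤ (m + 1) * K := Nat.le_mul_of_pos_left _ (by omega)
        refine h2' ((m + 1) * K - i) (by omega) ?_
        rw [← Function.iterate_add_apply, Nat.sub_add_cancel (by omega)]
        exact h1
    have h4 : K ∣ i := (Nat.dvd_add_right (Dvd.intro_left _ rfl)).1 (h3 ▸ Dvd.intro_left _ rfl)
    exact absurd (Nat.le_of_dvd hi h4) (by omega)

/-- A set meeting every orbit with return times `n` and `n + 1`. -/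
lemma exists_marker [StandardBorelSpace X] (hna : NoAtoms μ) {T : X ≃ᵐ X} (hT : Ergodic T μ)
    {n : ℕ} (hn : 0 < n) : ∃ B, MeasurableSet B ∧
      (∀ x ∈ B, ∀ i : ℕ, 0 < i → i < n → itZ T i x ∉ B) ∧
      ∀ᵐ x ∂μ, ∃ d : ℕ, d ≤ n ∧ itZ T (-d) x ∈ B := by
  obtain ⟨B0, hB0, h0, h1⟩ := exists_sparse_set hna hT (K := n * n) (by positivity)
  refine ⟨{x | IsMark n (fun j => itZ T j x ∈ B0)}, ?_, ?_, ?_⟩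
  · have hmi : ∀ j, MeasurableSet {x | itZ T j x ∈ B0} := fun j => measurable_itZ T j hB0
    unfold IsMark
    simp only [ofPred_exists, ofPred_and, ofPred_forall]
    refine MeasurableSet.iUnion fun e => MeasurableSet.iUnion fun s => ?_
    refine (MeasurableSet.const _).inter ((hmi _).inter (MeasurableSet.inter ?_
      ((hmi _).inter (MeasurableSet.inter ?_ (MeasurableSet.const _)))))
    · exact MeasurableSet.iInter fun i => MeasurableSet.iInter fun _ => (hmi _).compl
    · exact MeasurableSet.iInter fun i => MeasurableSet.iInter fun _ =>
        MeasurableSet.iInter fun _ => (hmi _).compl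
  · intro x hx i hi hin hx'
    refine IsMark.not_shift (S := fun j => itZ T j x ∈ B0) hn ?_ hx hi hin ?_
    · intro a ha j hj hjn hc
      rw [add_comm, itZ_add] at hc
      obtain ⟨j, rfl⟩ := Int.eq_ofNat_of_zero_le hj.le
      rw [itZ_natCast] at hc
      exact h1 _ ha j (by omega) (by exact_mod_cast hjn) hc
    · simpa [itZ_add] using hx'
  · filter_upwards [Ergodic.ae_exists_visit_int hT hB0 h0] with x hx
    obtain ⟨d, hd, h⟩ := exists_isMark hn (S := fun j => itZ T j x ∈ B0) hx.1 hx.2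
    refine ⟨d, hd, ?_⟩
    simpa [sub_eq_add_neg, itZ_add] using h

/-- A marker set which is at least as sparse in `E` as on average. -/
lemma exists_marker_avoiding [StandardBorelSpace X] (hna : NoAtoms μ) {T : X ≃ᵐ X}
    (hT : Ergodic T μ) {n : ℕ} (hn : 0 < n) {E : Set X} (hE : MeasurableSet E) :
    ∃ B, MeasurableSet B ∧
      (∀ x ∈ B, ∀ i : ℕ, 0 < i → i < n → itZ T i x ∉ B) ∧
      (∀ᵐ x ∂μ, ∃ d : ℕ, d ≤ n ∧ itZ T (-d) x ∈ B) ∧ n * μ (B ∩ E) ≤ μ E := by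
  obtain ⟨B, hB, h1, h2⟩ := exists_marker hna hT hn
  have hBs : ∀ s : ℕ, MeasurableSet (itZ T s ⁻¹' B) := fun s => measurable_itZ T s hB
  have hsum : ∑ s ∈ Finset.range n, μ (itZ T s ⁻¹' B ∩ E) ≤ μ E := by
    rw [← measure_biUnion_finset]
    · exact measure_mono (by simp)
    · intro s _ t _ hst
      refine Set.disjoint_left.2 fun x hxs hxt => ?_
      rename_i hs ht
      simp only [Finset.coe_range, mem_Iio] at hs ht
      rcases lt_or_gt_of_ne hst with h | h
      · refine h1 _ hxs.1 (t - s) (by omega) (by omega) ?_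
        rw [← itZ_add, show ((t - s : ℕ) : ℤ) + s = t by omega]; exact hxt.1
      · refine h1 _ hxt.1 (s - t) (by omega) (by omega) ?_
        rw [← itZ_add, show ((s - t : ℕ) : ℤ) + t = s by omega]; exact hxs.1
    · exact fun s _ => (hBs s).inter hE
  obtain ⟨s, hs, hle⟩ : ∃ s ∈ Finset.range n, n * μ (itZ T s ⁻¹' B ∩ E) ≤ μ E := by
    by_contra! hcon
    have : ∑ s ∈ Finset.range n, (n : ℝ≥0∞) * μ (itZ T s ⁻¹' B ∩ E) > ∑ s ∈ Finset.range n, μ E :=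
      ENNReal.sum_lt_sum_of_nonempty (by simpa using hn.ne') hcon
    rw [← Finset.mul_sum] at this
    simp only [Finset.sum_const, Finset.card_range, nsmul_eq_mul] at this
    exact absurd this (not_lt.2 (mul_le_mul_right hsum _))
  refine ⟨itZ T s ⁻¹' B, hBs s, ?_, ?_, hle⟩
  · intro x hx i hi hin hx'
    refine h1 _ hx i hi hin ?_
    rw [← itZ_add, add_comm, itZ_add]; exact hx'
  · filter_upwards [ae_itZ hT.toMeasurePreserving h2] with x hx
    obtain ⟨d, hd, h⟩ := hx s
    refine ⟨d, hd, ?_⟩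
    rw [mem_preimage, ← itZ_add, add_comm, itZ_add]; exact h

end Markers

section Entropy

variable {X : Type*} [MeasurableSpace X] {μ : Measure X} [IsProbabilityMeasure μ]

/-- The name of length `n` of a point with respect to an observable. -/
def nm {α : Type*} (T : X → X) (P : X → α) (n : ℕ) (x : X) : Fin n → α := fun i => P (T^[(i : ℕ)] x)

lemma measurable_nm {α : Type*} [MeasurableSpace α] {T : X → X} (hT : Measurable T) {P : X → α}
    (hP : Measurable P) (n : ℕ) : Measurable (nm T P n) :=
  measurable_pi_iff.2 fun i => hP.comp (hT.iterate i)

lemma sum_measureReal_fiber {α : Type*} [Fintype α] [MeasurableSpace α]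
    [MeasurableSingletonClass α] {Q : X → α} (hQ : Measurable Q) (s : Finset α) :
    ∑ a ∈ s, μ.real (Q ⁻¹' {a}) = μ.real (Q ⁻¹' s) := by
  rw [← measureReal_biUnion_finset]
  · congr 1; ext x; simp
  · intro a _ b _ hab
    refine Set.disjoint_left.2 fun x hx hx' => hab ?_
    simp only [mem_preimage, mem_singleton_iff] at hx hx'
    rw [← hx, ← hx']
  · exact fun a _ => hQ (measurableSet_singleton a)

lemma sum_measureReal_fiber_comp {α β : Type*} [Fintype α] [MeasurableSpace α] [DecidableEq β]
    [MeasurableSingletonClass α] {Q : X → α} (hQ : Measurable Q) (π : α → β) (b : β) :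
    ∑ a with π a = b, μ.real (Q ⁻¹' {a}) = μ.real ((fun x => π (Q x)) ⁻¹' {b}) := by
  rw [sum_measureReal_fiber hQ]
  congr 1; ext x; simp

lemma infoEntropy_nonneg {α : Type*} [Fintype α] (Q : X → α) : 0 ≤ infoEntropy μ Q :=
  Finset.sum_nonneg fun _ _ => Real.negMulLog_nonneg ENNReal.toReal_nonneg
    (ENNReal.toReal_le_of_le_ofReal zero_le_one (by simpa using prob_le_one))

lemma infoEntropy_le_log_card {α : Type*} [Fintype α] [MeasurableSpace α]
    [MeasurableSingletonClass α] [Nonempty α] {Q : X → α} (hQ : Measurable Q) :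
    infoEntropy μ Q ≤ Real.log (Fintype.card α) := by
  have hM : (0 : ℝ) < Fintype.card α := by exact_mod_cast Fintype.card_pos
  have h1 := Real.concaveOn_negMulLog.le_map_sum (t := Finset.univ)
    (w := fun _ : α => (Fintype.card α : ℝ)⁻¹) (p := fun a => μ.real (Q ⁻¹' {a}))
    (fun _ _ => by positivity) (by simp [hM.ne'])
    (fun _ _ => measureReal_nonneg)
  simp only [smul_eq_mul, ← Finset.mul_sum] at h1
  have h2 : ∑ a, μ.real (Q ⁻¹' {a}) = 1 := by
    have := sum_measureReal_fiber (μ := μ) hQ Finset.univ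
    simpa using this
  rw [h2, mul_one] at h1
  have h3 : Real.negMulLog ((Fintype.card α : ℝ)⁻¹) =
      (Fintype.card α : ℝ)⁻¹ * Real.log (Fintype.card α) := by
    rw [Real.negMulLog, Real.log_inv]; ring
  rw [h3] at h1
  exact le_of_mul_le_mul_left h1 (by positivity)

lemma negMulLog_sum_le {ι : Type*} (s : Finset ι) (p : ι → ℝ) (hp : ∀ i ∈ s, 0 ≤ p i) :
    Real.negMulLog (∑ i ∈ s, p i) ≤ ∑ i ∈ s, Real.negMulLog (p i) := by
  rw [Real.negMulLog, neg_mul, Finset.sum_mul, ← Finset.sum_neg_distrib]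
  refine Finset.sum_le_sum fun i hi => ?_
  rw [Real.negMulLog, neg_mul, neg_le_neg_iff]
  rcases (hp i hi).eq_or_lt with h | h
  · rw [← h]; simp
  · exact mul_le_mul_of_nonneg_left (Real.log_le_log h (Finset.single_le_sum hp hi)) h.le

lemma infoEntropy_comp_le {α β : Type*} [Fintype α] [Fintype β] [MeasurableSpace α]
    [MeasurableSingletonClass α] {Q : X → α} (hQ : Measurable Q) (π : α → β) :
    infoEntropy μ (fun x => π (Q x)) ≤ infoEntropy μ Q := by
  classical
  unfold infoEntropy
  rw [← Finset.sum_fiberwise Finset.univ π]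
  refine Finset.sum_le_sum fun b _ => ?_
  have := sum_measureReal_fiber_comp (μ := μ) hQ π b
  simp only [Measure.real] at this
  rw [← this]
  exact negMulLog_sum_le _ _ fun _ _ => ENNReal.toReal_nonneg

lemma infoEntropy_nm_le {q : ℕ} {T : X → X} (hT : Measurable T) {P : X → Fin q}
    (hP : Measurable P) (n : ℕ) : infoEntropy μ (nm T P n) / n ≤ Real.log q := by
  rcases Nat.eq_zero_or_pos n with rfl | hn
  · simp [Real.log_natCast_nonneg]
  · have hn' : (0 : ℝ) < n := by exact_mod_cast hn
    have : Nonempty X := by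
      by_contra h
      rw [not_nonempty_iff] at h
      have := IsProbabilityMeasure.measure_univ (μ := μ)
      simp [Set.eq_empty_of_isEmpty] at this
    have : Nonempty (Fin q) := ⟨P (Classical.arbitrary X)⟩
    have := infoEntropy_le_log_card (μ := μ) (measurable_nm hT hP n)
    rw [Fintype.card_fun, Fintype.card_fin, Fintype.card_fin, Nat.cast_pow, Real.log_pow] at this
    rw [div_le_iff₀ hn', mul_comm]
    exact this

lemma entropyWrt_eq {α : Type*} [Fintype α] (T : X → X) (P : X → α) : entropyWrt μ T P =
    atTop.liminf fun n : ℕ => infoEntropy μ (nm T P n) / n := rfl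

lemma isBoundedUnder_nm {q : ℕ} {T : X → X} (P : X → Fin q) :
    IsBoundedUnder (· ≥ ·) atTop fun n : ℕ => infoEntropy μ (nm T P n) / n :=
  ⟨0, eventually_map.2 (Eventually.of_forall fun n =>
    div_nonneg (infoEntropy_nonneg _) n.cast_nonneg)⟩

lemma isCoboundedUnder_nm {q : ℕ} {T : X → X} (hT : Measurable T) {P : X → Fin q}
    (hP : Measurable P) :
    IsCoboundedUnder (· ≥ ·) atTop fun n : ℕ => infoEntropy μ (nm T P n) / n :=
  IsBoundedUnder.isCoboundedUnder_ge
    ⟨Real.log q, eventually_map.2 (Eventually.of_forall (infoEntropy_nm_le hT hP))⟩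

lemma entropyWrt_nonneg {q : ℕ} {T : X → X} (hT : Measurable T) {P : X → Fin q}
    (hP : Measurable P) : 0 ≤ entropyWrt μ T P :=
  le_liminf_of_le (isCoboundedUnder_nm hT hP) (Eventually.of_forall fun n =>
    div_nonneg (infoEntropy_nonneg _) n.cast_nonneg)

lemma entropyWrt_comp_le {q q' : ℕ} {T : X → X} (hT : Measurable T) {P : X → Fin q}
    (hP : Measurable P) {P' : X → Fin q'} (hP' : Measurable P') {π : Fin q' → Fin q}
    (hπ : ∀ x, P x = π (P' x)) : entropyWrt μ T P ≤ entropyWrt μ T P' := by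
  refine liminf_le_liminf (Eventually.of_forall fun n => ?_) (isBoundedUnder_nm P)
    (isCoboundedUnder_nm hT hP')
  refine div_le_div_of_nonneg_right ?_ n.cast_nonneg
  let ρ : (Fin n → Fin q') → Fin n → Fin q := fun a i => π (a i)
  have : nm T P n = fun x => ρ (nm T P' n x) := by
    ext x i; simp [nm, hπ, ρ]
  change infoEntropy μ (nm T P n) ≤ infoEntropy μ (nm T P' n)
  rw [this]
  exact infoEntropy_comp_le (measurable_nm hT hP' n) ρ

lemma integral_comp_fintype {α : Type*} [Fintype α] [MeasurableSpace α]
    [MeasurableSingletonClass α] {Q : X → α} (hQ : Measurable Q) (F : α → ℝ) :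
    ∫ x, F (Q x) ∂μ = ∑ a, μ.real (Q ⁻¹' {a}) * F a := by
  have : IsProbabilityMeasure (μ.map Q) := Measure.isProbabilityMeasure_map hQ.aemeasurable
  have h1 := integral_map (μ := μ) (φ := Q) (f := F) hQ.aemeasurable
    (measurable_of_finite F).aestronglyMeasurable
  rw [← h1, integral_fintype (Integrable.of_finite)]
  refine Finset.sum_congr rfl fun a _ => ?_
  rw [smul_eq_mul, map_measureReal_apply hQ (measurableSet_singleton a)]

lemma integral_condInfo {α β : Type*} [Fintype α] [Fintype β] [MeasurableSpace α]
    [MeasurableSingletonClass α] {Q : X → α} (hQ : Measurable Q) (π : α → β) :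
    ∫ x, (Real.log (μ.real ((fun x => π (Q x)) ⁻¹' {π (Q x)})) - Real.log (μ.real (Q ⁻¹' {Q x}))) ∂μ
      = infoEntropy μ Q - infoEntropy μ (fun x => π (Q x)) := by
  classical
  rw [integral_comp_fintype hQ (fun a => Real.log (μ.real ((fun x => π (Q x)) ⁻¹' {π a})) -
    Real.log (μ.real (Q ⁻¹' {a})))]
  simp only [mul_sub, Finset.sum_sub_distrib]
  have h1 : ∑ a, μ.real (Q ⁻¹' {a}) * Real.log (μ.real ((fun x => π (Q x)) ⁻¹' {π a})) =
      - infoEntropy μ (fun x => π (Q x)) := by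
    rw [← Finset.sum_fiberwise Finset.univ π, infoEntropy, ← Finset.sum_neg_distrib]
    refine Finset.sum_congr rfl fun b _ => ?_
    rw [Real.negMulLog, neg_mul, neg_neg]
    have := sum_measureReal_fiber_comp (μ := μ) hQ π b
    simp only [Measure.real] at this ⊢
    rw [← this, Finset.sum_mul, this]
    refine Finset.sum_congr rfl fun a ha => ?_
    rw [(Finset.mem_filter.1 ha).2]
  have h2 : ∑ a, μ.real (Q ⁻¹' {a}) * Real.log (μ.real (Q ⁻¹' {a})) = - infoEntropy μ Q := by
    simp only [infoEntropy, Real.negMulLog, Measure.real, neg_mul, Finset.sum_neg_distrib, neg_neg]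
  rw [h1, h2]
  ring

lemma card_filter_prod_le {κ : Type*} [DecidableEq κ] {J : ℕ} (k : κ → ℝ) (hk : ∀ a, 0 ≤ k a)
    (F : Fin J → Finset κ) (hF : ∀ j, ∑ a ∈ F j, k a ≤ 1) (b : ℝ) :
    (((Fintype.piFinset F).filter fun c => Real.exp (-b) ≤ ∏ j, k (c j)).card : ℝ) ≤ Real.exp b :=
        by
  have h1 : ∏ j, ∑ a ∈ F j, k a ≤ 1 :=
    Finset.prod_le_one (fun j _ => Finset.sum_nonneg fun a _ => hk a) fun j _ => hF j
  rw [Finset.prod_univ_sum] at h1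
  have h2 : (((Fintype.piFinset F).filter fun c => Real.exp (-b) ≤ ∏ j, k (c j)).card : ℝ) *
      Real.exp (-b) ≤ 1 := by
    refine le_trans ?_ h1
    rw [← nsmul_eq_mul]
    refine (Finset.card_nsmul_le_sum _ (fun c : Fin J → κ => ∏ j, k (c j)) (Real.exp (-b))
      fun c hc => (Finset.mem_filter.1 hc).2).trans ?_
    exact Finset.sum_le_sum_of_subset_of_nonneg (Finset.filter_subset _ _) fun c _ _ =>
      Finset.prod_nonneg fun j _ => hk _
  have h3 := (le_div_iff₀ (Real.exp_pos (-b))).2 h2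
  rwa [one_div, ← Real.exp_neg, neg_neg] at h3

/-- The block of length `m` at position `i` of a word of length `N`. -/
def blk {α : Type*} {N : ℕ} (m : ℕ) (w : Fin N → α) (i : ℕ) (hi : i + m ≤ N) : Fin m → α :=
  fun t => w ⟨i + t, by omega⟩

lemma blk_pos {N m s j : ℕ} (hs : s < m) (hj : j < N / m - 1) : s + j * m + m ≤ N := by
  have h1 : N / m * m ≤ N := Nat.div_mul_le_self N m
  have h2 : (j + 2) * m ≤ N / m * m := Nat.mul_le_mul_right m (by omega)
  have h3 : (j + 2) * m = j * m + 2 * m := by ring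
  omega

lemma card_words_of_blocks {α β : Type*} [Fintype α] [DecidableEq α] [DecidableEq β]
    (π : α → β) {m N : ℕ} (k : (Fin m → α) → ℝ) (hk : ∀ a, 0 ≤ k a)
    (hk1 : ∀ b : Fin m → β, ∑ a with (fun i => π (a i)) = b, k a ≤ 1) (v : Fin N → β) {s : ℕ}
    (hs : s < m) (hN : 2 * m ≤ N) (b : ℝ) :
    ((Finset.univ.filter fun w : Fin N → α => (∀ i, π (w i) = v i) ∧
      Real.exp (-b) ≤ ∏ j : Fin (N / m - 1), k (blk m w (s + j * m) (blk_pos hs j.2))).card : ℝ) ≤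
      (Fintype.card α : ℝ) ^ (3 * m) * Real.exp b := by
  set F : Fin (N / m - 1) → Finset (Fin m → α) := fun j =>
    Finset.univ.filter fun a => (fun i => π (a i)) = blk m v (s + j * m) (blk_pos hs j.2) with hF
  set G := (Fintype.piFinset F).filter fun c : Fin (N / m - 1) → Fin m → α => Real.exp (-b) ≤ ∏ j,
      k (c j) with hG
  have hGc : (G.card : ℝ) ≤ Real.exp b := card_filter_prod_le k hk F (fun j => hk1 _) b
  set S := Finset.univ.filter fun w : Fin N → α => (∀ i, π (w i) = v i) ∧
      Real.exp (-b) ≤ ∏ j : Fin (N / m - 1), k (blk m w (s + j * m) (blk_pos hs j.2)) with hS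
  let Φ : (Fin N → α) → ((Fin m → α) × (Fin (2 * m) → α)) × (Fin (N / m - 1) → Fin m → α) :=
      fun w =>
    ((blk m w 0 (by omega), blk (2 * m) w (N - 2 * m) (by omega)),
      fun j => blk m w (s + j * m) (blk_pos hs j.2))
  have hinj : Function.Injective Φ := by
    intro w w' hww
    simp only [Φ, Prod.mk.injEq] at hww
    obtain ⟨⟨h1, h2⟩, h3⟩ := hww
    ext1 i
    rcases lt_or_ge (i : ℕ) m with hi | hi
    · have := congrFun h1 ⟨i, hi⟩
      simpa [blk] using this
    rcases lt_or_ge (i : ℕ) (N - 2 * m) with hi2 | hi2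
    · have h4 : (i - s : ℕ) / m < N / m - 1 := by
        have h5 : (i - s : ℕ) / m * m ≤ i - s := Nat.div_mul_le_self _ _
        have h6 := Nat.div_add_mod N m
        have h7 := Nat.mod_lt N (show 0 < m by omega)
        by_contra! h8
        have h9 := Nat.mul_le_mul_right m h8
        rw [Nat.sub_mul, mul_comm (N / m) m] at h9
        omega
      have := congrFun (congrFun h3 ⟨(i - s) / m, h4⟩) ⟨(i - s) % m, Nat.mod_lt _ (by omega)⟩
      simp only [blk] at this
      have h10 : s + (i - s : ℕ) / m * m + (i - s : ℕ) % m = i := by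
        have := Nat.div_add_mod (i - s : ℕ) m
        rw [mul_comm] at this
        omega
      simpa only [h10, Fin.eta] using this
    · have := congrFun h2 ⟨i - (N - 2 * m), by omega⟩
      simpa [blk, Nat.add_sub_cancel' hi2] using this
  have hmap : ∀ w ∈ S, Φ w ∈ (Finset.univ : Finset ((Fin m → α) × (Fin (2 * m) → α))) ×ˢ G := by
    intro w hw
    obtain ⟨hw1, hw2⟩ := (Finset.mem_filter.1 hw).2
    refine Finset.mem_product.2 ⟨Finset.mem_univ _, Finset.mem_filter.2 ⟨?_, hw2⟩⟩
    refine Fintype.mem_piFinset.2 fun j => Finset.mem_filter.2 ⟨Finset.mem_univ _, ?_⟩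
    ext1 i
    exact hw1 _
  have hc := Finset.card_le_card_of_injOn Φ hmap hinj.injOn
  rw [Finset.card_product, Finset.card_univ, Fintype.card_prod, Fintype.card_fun, Fintype.card_fun,
    Fintype.card_fin, Fintype.card_fin, ← pow_add] at hc
  calc (S.card : ℝ) ≤ ((Fintype.card α ^ (m + 2 * m) * G.card : ℕ) : ℝ) := by exact_mod_cast hc
    _ = (Fintype.card α : ℝ) ^ (3 * m) * G.card := by push_cast; ring_nf
    _ ≤ _ := by gcongr

end Entropy

section Counting

variable {X : Type*} [MeasurableSpace X] {μ : Measure X} [IsProbabilityMeasure μ]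

lemma sum_range_mul_eq (f : ℕ → ℝ) (J m : ℕ) :
    ∑ i ∈ Finset.range (J * m), f i = ∑ s : Fin m, ∑ j : Fin J, f (s + j * m) := by
  rw [← Fin.sum_univ_eq_sum_range, ← finProdFinEquiv.sum_comp, Fintype.sum_prod_type_right]
  refine Finset.sum_congr rfl fun s _ => Finset.sum_congr rfl fun j _ => ?_
  simp [finProdFinEquiv, mul_comm]

lemma blk_nm {α : Type*} (T : X → X) (P : X → α) {N m i : ℕ} (hi : i + m ≤ N) (x : X) :
    blk m (nm T P N x) i hi = nm T P m (T^[i] x) := by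
  ext t
  simp only [blk, nm]
  rw [← Function.iterate_add_apply, add_comm]

lemma exists_block_length {q q' : ℕ} {T : X → X} (hT : Measurable T) {P : X → Fin q}
    {P' : X → Fin q'} (hP : Measurable P) (hP' : Measurable P') {h : ℝ}
    (hh : entropyWrt μ T P' ≤ h) {δ : ℝ} (hδ : 0 < δ) :
    ∃ m : ℕ, 0 < m ∧ infoEntropy μ (nm T P' m) ≤ m * (h + δ) ∧
      m * (entropyWrt μ T P - δ) ≤ infoEntropy μ (nm T P m) := by
  have h1 : ∃ᶠ n : ℕ in atTop, infoEntropy μ (nm T P' n) / n < h + δ :=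
    frequently_lt_of_liminf_lt (isCoboundedUnder_nm hT hP')
      (by rw [← entropyWrt_eq]; linarith)
  have h2 : ∀ᶠ n : ℕ in atTop, entropyWrt μ T P - δ < infoEntropy μ (nm T P n) / n :=
    eventually_lt_of_lt_liminf (by rw [← entropyWrt_eq]; linarith) (isBoundedUnder_nm P)
  obtain ⟨m, hm1, hm2, hm3⟩ := (h1.and_eventually (h2.and (eventually_gt_atTop 0))).exists
  have hm : (0 : ℝ) < m := by exact_mod_cast hm3
  refine ⟨m, hm3, ?_, ?_⟩
  · rw [div_lt_iff₀ hm] at hm1; linarith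
  · rw [lt_div_iff₀ hm] at hm2; linarith

/-- Conditional counting of names: given the `P`-name, a set of `P'`-names of exponential size
`h - entropyWrt μ T P` suffices with high probability. -/
lemma exists_conditional_code {q q' : ℕ} {T : X → X} (hT : Ergodic T μ) {P : X → Fin q}
    {P' : X → Fin q'} (hP' : Measurable P') {π : Fin q' → Fin q} (hπ : ∀ x, P x = π (P' x)) {h : ℝ}
    (hh : entropyWrt μ T P' ≤ h) {δ : ℝ} (hδ : 0 < δ) {η : ℝ≥0∞} (hη : 0 < η) :
    ∀ᶠ N : ℕ in atTop, ∃ S : (Fin N → Fin q) → Finset (Fin N → Fin q'),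
      (∀ v, ((S v).card : ℝ) ≤ Real.exp (N * (h - entropyWrt μ T P + δ))) ∧
      μ {x | nm T P' N x ∉ S (nm T P N x)} ≤ η := by
  classical
  have hP : Measurable P := by
    have : P = π ∘ P' := funext hπ
    rw [this]; exact (measurable_of_finite π).comp hP'
  obtain ⟨m, hm, hm1, hm2⟩ := exists_block_length hT.measurable hP hP' hh (δ := δ / 8) (by linarith)
  have hm' : (0 : ℝ) < m := by exact_mod_cast hm
  let ρ : (Fin m → Fin q') → Fin m → Fin q := fun a i => π (a i)
  have hQ := measurable_nm hT.measurable hP' m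
  have hρ : nm T P m = fun x => ρ (nm T P' m x) := by
    ext x i; simp [nm, hπ, ρ]
  set p' : (Fin m → Fin q') → ℝ := fun a => μ.real (nm T P' m ⁻¹' {a}) with hp'
  set p : (Fin m → Fin q) → ℝ := fun b => μ.real ((fun x => ρ (nm T P' m x)) ⁻¹' {b}) with hp
  set k : (Fin m → Fin q') → ℝ := fun a => p' a / p (ρ a) with hk
  set I : (Fin m → Fin q') → ℝ := fun a => Real.log (p (ρ a)) - Real.log (p' a) with hI
  have hk0 : ∀ a, 0 ≤ k a := fun a => div_nonneg measureReal_nonneg measureReal_nonneg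
  have hk1 : ∀ b, ∑ a with ρ a = b, k a ≤ 1 := by
    intro b
    have : ∑ a with ρ a = b, k a = (∑ a with ρ a = b, p' a) / p b := by
      rw [Finset.sum_div]
      refine Finset.sum_congr rfl fun a ha => ?_
      change p' a / p (ρ a) = _
      rw [(Finset.mem_filter.1 ha).2]
    rw [this, sum_measureReal_fiber_comp hQ]
    exact div_self_le_one _
  have hkI : ∀ a, 0 < p' a → k a = Real.exp (- I a) := by
    intro a ha
    have hpa : 0 < p (ρ a) := by
      refine ha.trans_le (measureReal_mono ?_)
      intro x hx; simp only [mem_preimage, mem_singleton_iff] at hx ⊢; rw [hx]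
    rw [hI, neg_sub, Real.exp_sub, Real.exp_log ha, Real.exp_log hpa]
  have h_integral : ∫ x, I (nm T P' m x) ∂μ ≤ m * (h - entropyWrt μ T P + δ / 4) := by
    have h1 := integral_condInfo (μ := μ) hQ ρ
    rw [← hρ] at h1
    have h2 : ∫ x, I (nm T P' m x) ∂μ = infoEntropy μ (nm T P' m) - infoEntropy μ (nm T P m) := by
      rw [← h1, hI, hp, hp', hρ]
    rw [h2]; linarith
  have hpos : ∀ᵐ x ∂μ, ∀ i : ℕ, 0 < p' (nm T P' m (T^[i] x)) := by
    rw [ae_all_iff]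
    intro i
    refine (hT.toMeasurePreserving.iterate i).quasiMeasurePreserving.ae
      (p := fun x => 0 < p' (nm T P' m x)) ?_
    have : ∀ a, p' a = 0 → ∀ᵐ x ∂μ, nm T P' m x ≠ a := by
      intro a ha
      exact measure_eq_zero_iff_ae_notMem.1 ((measureReal_eq_zero_iff (measure_ne_top _ _)).1 ha)
    have h2 : ∀ᵐ x ∂μ, ∀ a, p' a = 0 → nm T P' m x ≠ a := by
      rw [ae_all_iff]; intro a
      by_cases ha : p' a = 0
      · filter_upwards [this a ha] with x hx _ using hx
      · exact Eventually.of_forall fun x h => absurd h ha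
    filter_upwards [h2] with x hx
    exact lt_of_le_of_ne measureReal_nonneg fun h => hx _ h.symm rfl
  have hIm : Measurable fun x => I (nm T P' m x) := (measurable_of_finite I).comp hQ
  obtain ⟨C, hC⟩ : ∃ C, ∀ a, |I a| ≤ C := by
    obtain ⟨C, hC⟩ := (Set.finite_range fun a => |I a|).bddAbove
    exact ⟨C, fun a => hC ⟨a, rfl⟩⟩
  have hlaw := Ergodic.tendsto_measure_birkhoffSum_gt hT hIm (fun x => hC _)
    (δ := m * (δ / 8)) (by positivity)
  have hJ : Tendsto (fun N : ℕ => (N / m - 1) * m) atTop atTop := by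
    refine tendsto_atTop_mono (f := fun N => N - 2 * m) (fun N => ?_) (tendsto_sub_atTop_nat _)
    have h6 := Nat.div_add_mod N m
    have h7 := Nat.mod_lt N hm
    rw [Nat.sub_mul, mul_comm (N / m) m]; omega
  have hlaw2 := (hlaw.comp hJ).eventually_lt_const hη
  set c : ℝ := h - entropyWrt μ T P + 3 * δ / 8 with hc
  have hbig : ∀ᶠ N : ℕ in atTop, m * (q' ^ (3 * m) * Real.exp (2 * m * |c|)) ≤
      Real.exp (N * (δ / 8)) := by
    have : Tendsto (fun N : ℕ => Real.exp (N * (δ / 8))) atTop atTop :=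
      Real.tendsto_exp_atTop.comp (tendsto_natCast_atTop_atTop.atTop_mul_const (by linarith))
    exact this.eventually_ge_atTop _
  filter_upwards [hlaw2, hbig, eventually_ge_atTop (2 * m)] with N hN1 hN2 hN3
  set J := N / m - 1 with hJdef
  set b : ℝ := J * (m * c) with hb
  have hbN : b ≤ N * c + 2 * m * |c| := by
    have h6 := Nat.div_add_mod N m
    have h7 := Nat.mod_lt N hm
    have h8 : J * m + 2 * m ≥ N := by rw [hJdef, Nat.sub_mul, mul_comm (N / m) m]; omega
    have h9 : J * m ≤ N := by rw [hJdef, Nat.sub_mul, mul_comm (N / m) m]; omega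
    have h8' : (J : ℝ) * m + 2 * m ≥ N := by exact_mod_cast h8
    have h9' : (J : ℝ) * m ≤ N := by exact_mod_cast h9
    rw [hb, ← mul_assoc]
    rcases abs_cases c with ⟨h, _⟩ | ⟨h, _⟩ <;> rw [h] <;> nlinarith
  refine ⟨fun v => Finset.univ.biUnion fun s : Fin m => Finset.univ.filter fun w : Fin N → Fin q' =>
    (∀ i, π (w i) = v i) ∧ Real.exp (-b) ≤ ∏ j : Fin (N / m - 1),
        k (blk m w (s + j * m) (blk_pos s.2 j.2)),
    ?_, ?_⟩
  · intro v
    have h1 : ∀ s : Fin m, _ := fun s => card_words_of_blocks π k hk0 hk1 v s.2 hN3 b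
    refine (Nat.cast_le.2 Finset.card_biUnion_le).trans ?_
    rw [Nat.cast_sum]
    refine (Finset.sum_le_sum fun s _ => h1 s).trans ?_
    rw [Finset.sum_const, Finset.card_univ, Fintype.card_fin, Fintype.card_fin, nsmul_eq_mul]
    calc (m : ℝ) * (q' ^ (3 * m) * Real.exp b)
        ≤ m * (q' ^ (3 * m) * Real.exp (N * c + 2 * m * |c|)) := by gcongr
      _ = (m * (q' ^ (3 * m) * Real.exp (2 * m * |c|))) * Real.exp (N * c) := by
        rw [Real.exp_add]; ring
      _ ≤ Real.exp (N * (δ / 8)) * Real.exp (N * c) := by gcongr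
      _ = Real.exp (N * (h - entropyWrt μ T P + δ / 2)) := by
        rw [← Real.exp_add, hc]; congr 1; ring
      _ ≤ _ := by gcongr; linarith
  · refine le_trans (measure_mono_ae ?_) hN1.le
    filter_upwards [hpos] with x hx hxS
    by_contra hcon
    refine hxS ?_
    have hcon' : ∑ i ∈ Finset.range (J * m), I (nm T P' m (T^[i] x)) ≤
        ((J * m : ℕ) : ℝ) * (∫ y, I (nm T P' m y) ∂μ + m * (δ / 8)) := not_lt.1 hcon
    rw [sum_range_mul_eq] at hcon'
    obtain ⟨s, -, hs⟩ : ∃ s ∈ (Finset.univ : Finset (Fin m)),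
        ∑ j : Fin J, I (nm T P' m (T^[(s : ℕ) + j * m] x)) ≤ b := by
      refine Finset.exists_le_of_sum_le (f := fun s : Fin m => ∑ j : Fin J, I (nm T P' m (T^[(s :
          ℕ) + j * m] x)))
        (g := fun _ => b) ⟨⟨0, hm⟩, Finset.mem_univ _⟩ (hcon'.trans ?_)
      rw [Finset.sum_const, Finset.card_univ, Fintype.card_fin, nsmul_eq_mul, hb, hc]
      push_cast
      have : ∫ y, I (nm T P' m y) ∂μ + m * (δ / 8) ≤ m * (h - entropyWrt μ T P + 3 * δ / 8) := by
        linarith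
      calc (J : ℝ) * m * (∫ y, I (nm T P' m y) ∂μ + m * (δ / 8)) ≤
          (J : ℝ) * m * (m * (h - entropyWrt μ T P + 3 * δ / 8)) := by gcongr
        _ = _ := by ring
    refine Finset.mem_biUnion.2 ⟨s, Finset.mem_univ _, Finset.mem_filter.2 ⟨Finset.mem_univ _, ?_,
        ?_⟩⟩
    · intro i; simp [nm, hπ]
    · have : ∀ j : Fin (N / m - 1), k (blk m (nm T P' N x) (s + j * m) (blk_pos s.2 j.2)) =
          Real.exp (- I (nm T P' m (T^[(s : ℕ) + j * m] x))) := by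
        intro j
        rw [blk_nm, hkI _ (hx _)]
      rw [Finset.prod_congr rfl fun j _ => this j, ← Real.exp_sum, Finset.sum_neg_distrib]
      exact Real.exp_le_exp.2 (neg_le_neg hs)

end Counting

section Subshift

variable {k : ℕ}

/-- The word of length `n` of a sequence starting at `a`. -/
def wd {A : Type*} (z : ℤ → A) (a : ℤ) (n : ℕ) : Fin n → A := fun i => z (a + i)

open Classical in
/-- The words of length `n` of a set of sequences. -/
noncomputable def lang (Xs : Set (ℤ → Fin k)) (n : ℕ) : Finset (Fin n → Fin k) :=
  Finset.univ.filter fun w => ∃ z ∈ Xs, wd z 0 n = w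

lemma mem_lang {Xs : Set (ℤ → Fin k)} {n : ℕ} {w : Fin n → Fin k} :
    w ∈ lang Xs n ↔ ∃ z ∈ Xs, wd z 0 n = w := by simp [lang]

/-- Invariance of a set of sequences under all translations. -/
def ShiftInv (Xs : Set (ℤ → Fin k)) : Prop := ∀ z ∈ Xs, ∀ i : ℤ, (fun n => z (n + i)) ∈ Xs

/-- Points of `Xs` can be glued along intervals of length at most `n` with gaps at least `L n`. -/
def Glues (Xs : Set (ℤ → Fin k)) (L : ℕ → ℕ) : Prop :=
  ∀ n g : ℕ, L n ≤ g → ∀ (t : ℕ) (y : ℕ → ℤ → Fin k) (a b : ℕ → ℤ), (∀ i < t, y i ∈ Xs) →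
    (∀ i < t, a i ≤ b i) → (∀ i < t, b i - a i ≤ n) → (∀ i, i + 1 < t → (g : ℤ) ≤ a (i + 1) - b i) →
    ∃ z ∈ Xs, ∀ i < t, ∀ j, a i ≤ j → j ≤ b i → z j = y i j

lemma wd_mem_lang {Xs : Set (ℤ → Fin k)} (hs : ShiftInv Xs) {z : ℤ → Fin k} (hz : z ∈ Xs) (a : ℤ)
    (n : ℕ) : wd z a n ∈ lang Xs n :=
  mem_lang.2 ⟨_, hs z hz a, by ext i; simp [wd, add_comm]⟩

lemma exists_of_mem_lang {Xs : Set (ℤ → Fin k)} (hs : ShiftInv Xs) {n : ℕ} {w : Fin n → Fin k}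
    (hw : w ∈ lang Xs n) (a : ℤ) : ∃ z ∈ Xs, wd z a n = w := by
  obtain ⟨z, hz, rfl⟩ := mem_lang.1 hw
  exact ⟨_, hs z hz (-a), by ext i; simp [wd]⟩

lemma lang_card_add {Xs : Set (ℤ → Fin k)} (hs : ShiftInv Xs) (m n : ℕ) :
    (lang Xs (m + n)).card ≤ (lang Xs m).card * (lang Xs n).card := by
  rw [← Finset.card_product]
  refine Finset.card_le_card_of_injOn
    (fun w => (fun i => w (Fin.castAdd n i), fun i => w (Fin.natAdd m i))) ?_ ?_
  · intro w hw
    obtain ⟨z, hz, rfl⟩ := mem_lang.1 hw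
    refine Finset.mem_product.2 ⟨?_, ?_⟩
    · exact wd_mem_lang hs hz 0 m
    · convert wd_mem_lang hs hz m n using 1
      ext i; simp [wd]
  · intro w _ w' _ h
    simp only [Prod.mk.injEq] at h
    ext1 i
    refine Fin.addCases (fun i => congrFun h.1 i) (fun i => congrFun h.2 i) i

lemma lang_card_mul {Xs : Set (ℤ → Fin k)} (hs : ShiftInv Xs) (n j : ℕ) :
    (lang Xs (n * j)).card ≤ (lang Xs n).card ^ j := by
  induction j with
  | zero =>
    rw [pow_zero, mul_zero]
    refine (Finset.card_le_univ _).trans ?_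
    simp
  | succ j ih =>
    rw [Nat.mul_succ, pow_succ]
    exact (lang_card_add hs _ _).trans (Nat.mul_le_mul_right _ ih)

lemma lang_nonempty {Xs : Set (ℤ → Fin k)} (hne : Xs.Nonempty) (n : ℕ) : (lang Xs n).Nonempty := by
  obtain ⟨z, hz⟩ := hne
  exact ⟨_, mem_lang.2 ⟨z, hz, rfl⟩⟩

variable {Xs : Set (ℤ → Fin k)} {σX : ↥Xs ≃ ↥Xs}

lemma zpow_shift (hσ : ∀ x : ↥Xs, (σX x : ℤ → Fin k) = fullShift (x : ℤ → Fin k)) (x : ↥Xs) (i : ℤ)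
    (n : ℤ) : (((σX : Equiv.Perm ↥Xs) ^ i) x : ℤ → Fin k) n = (x : ℤ → Fin k) (n + i) := by
  induction i using Int.induction_on generalizing n with
  | zero => simp
  | succ i ih =>
    rw [add_comm (i : ℤ) 1, zpow_add, Equiv.Perm.mul_apply, zpow_one, hσ, fullShift, ih]
    congr 1; ring
  | pred i ih =>
    have h := ih (n - 1)
    rw [show (-(i : ℤ)) = 1 + (-i - 1) by ring, zpow_add, Equiv.Perm.mul_apply, zpow_one, hσ,
      fullShift, sub_add_cancel] at h
    rw [h]
    congr 1; ring

lemma shiftInv_of_equiv (hσ : ∀ x : ↥Xs, (σX x : ℤ → Fin k) = fullShift (x : ℤ → Fin k)) :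
    ShiftInv Xs := by
  intro z hz i
  have : (fun n => z (n + i)) = (((σX : Equiv.Perm ↥Xs) ^ i) ⟨z, hz⟩ : ℤ → Fin k) := by
    ext1 n; rw [zpow_shift hσ]
  rw [this]; exact Subtype.property _

lemma iterate_shift (hσ : ∀ x : ↥Xs, (σX x : ℤ → Fin k) = fullShift (x : ℤ → Fin k)) (x : ↥Xs)
    (i : ℕ) (n : ℤ) : ((σX^[i]) x : ℤ → Fin k) n = (x : ℤ → Fin k) (n + i) := by
  rw [← zpow_shift hσ x i n, zpow_natCast, Equiv.Perm.iterate_eq_pow]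

lemma exists_cylinder_subset {U : Set (↥Xs × ↥Xs)} (hU : U ∈ uniformity ↥Xs) :
    ∃ w : ℕ, ∀ x y : ↥Xs, (∀ i : ℤ, -w ≤ i → i ≤ w → (x : ℤ → Fin k) i = (y : ℤ → Fin k) i) →
      (x, y) ∈ U := by
  rw [uniformity_subtype, mem_comap] at hU
  obtain ⟨V, hV, hVU⟩ := hU
  have hV' : V ∈ ⨅ i : ℤ, comap (fun a : (ℤ → Fin k) × (ℤ → Fin k) => (a.1 i, a.2 i))
    (uniformity (Fin k)) := by rw [← Pi.uniformity]; exact hV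
  obtain ⟨t, ht⟩ := (mem_iInf_finite _).1 hV'
  have h2 : V ∈ Filter.principal {p : (ℤ → Fin k) × (ℤ → Fin k) | ∀ i ∈ t, p.1 i = p.2 i} := by
    refine (?_ : Filter.principal _ ≤ _) ht
    refine le_iInf₂ fun i hi => ?_
    rw [← Filter.map_le_iff_le_comap, Filter.map_principal]
    refine le_trans ?_ refl_le_uniformity
    rw [Filter.principal_mono]
    rintro _ ⟨p, hp, rfl⟩
    exact hp i hi
  refine ⟨t.sup Int.natAbs, fun x y hxy => hVU (h2 ?_)⟩
  intro i hi
  have := Finset.le_sup (f := Int.natAbs) hi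
  exact hxy i (by omega) (by omega)

lemma exp_le_lang_card (hne : Xs.Nonempty)
    (hσ : ∀ x : ↥Xs, (σX x : ℤ → Fin k) = fullShift (x : ℤ → Fin k)) {c : ℝ}
    (hc : (c : EReal) < topEntropy (⇑σX)) (n : ℕ) : Real.exp (c * n) ≤ (lang Xs n).card := by
  by_contra! hlt
  have hs := shiftInv_of_equiv hσ
  have hcard : ∀ n, (1 : ℝ) ≤ (lang Xs n).card := fun n => by
    exact_mod_cast (lang_nonempty hne n).card_pos
  have hn : n ≠ 0 := by
    rintro rfl
    rw [Nat.cast_zero, mul_zero, Real.exp_zero] at hlt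
    linarith [hcard 0]
  set b := Real.log (lang Xs n).card with hb
  have hb0 : 0 ≤ b := Real.log_nonneg (hcard n)
  have hbc : b < c * n := by
    rw [hb, Real.log_lt_iff_lt_exp (by linarith [hcard n])]; exact hlt
  have hn' : (0 : ℝ) < n := by positivity
  have hc0 : 0 < c := by by_contra! h; nlinarith
  refine absurd hc (not_lt.2 ?_)
  refine iSup₂_le fun U hU => ?_
  obtain ⟨w, hw⟩ := exists_cylinder_subset hU
  let V : SetRel ↥Xs ↥Xs := {p | ∀ i : ℤ, -w ≤ i → i ≤ w → (p.1 : ℤ → Fin k) i = (p.2 : ℤ →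
      Fin k) i}
  have hVsymm : V.IsSymm := ⟨fun x y h i h1 h2 => (h i h1 h2).symm⟩
  have hVV : V.comp V ⊆ U := by
    rintro ⟨x, y⟩ ⟨u, h1, h2⟩
    exact hw x y fun i hi hi' => (h1 i hi hi').trans (h2 i hi hi')
  refine (Dynamics.coverEntropyEntourage_antitone _ _ hVV).trans ?_
  obtain ⟨j, hj⟩ := exists_nat_gt (max (2 * (w : ℝ)) (2 * w * c / (c * n - b)))
  have hj1 : (2 * w : ℝ) < j := (le_max_left _ _).trans_lt hj
  have hj2 : 2 * w * c < j * (c * n - b) := by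
    rw [← div_lt_iff₀ (by linarith)]; exact (le_max_right _ _).trans_lt hj
  have hj1' : 2 * w < j := by exact_mod_cast hj1
  have hnj : 2 * w < n * j := hj1'.trans_le (Nat.le_mul_of_pos_left _ (by omega))
  set N := n * j - 2 * w with hN
  have hNj : N + 2 * w = n * j := by omega
  classical
  have : Nonempty (ℤ → Fin k) := ⟨hne.some⟩
  choose! rep hrep1 hrep2 using fun (u : Fin (n * j) → Fin k) (hu : u ∈ lang Xs (n * j)) =>
    exists_of_mem_lang hs hu (-w)
  let s : Finset ↥Xs := (lang Xs (n * j)).attach.image fun u => ⟨rep u.1, hrep1 _ u.2⟩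
  have hscard : s.card ≤ (lang Xs n).card ^ j :=
    (Finset.card_image_le.trans (Finset.card_attach).le).trans (lang_card_mul hs n j)
  have hcov : Dynamics.IsDynCoverOf (⇑σX) univ V N (s : Set ↥Xs) := by
    intro x _
    have hu : wd (x : ℤ → Fin k) (-w) (n * j) ∈ lang Xs (n * j) := wd_mem_lang hs x.2 _ _
    refine ⟨⟨rep _, hrep1 _ hu⟩, ?_, ?_⟩
    · exact Finset.mem_coe.2 (Finset.mem_image.2 ⟨⟨_, hu⟩, Finset.mem_attach _ _, rfl⟩)
    · rw [Dynamics.mem_dynEntourage]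
      intro i hi l hl1 hl2
      simp only [iterate_shift hσ]
      have := congrFun (hrep2 _ hu) ⟨(l + i + w).toNat, by omega⟩
      simp only [wd] at this
      rw [show -(w : ℤ) + ((l + i + w).toNat : ℕ) = l + i by omega] at this
      exact this.symm
  refine (Dynamics.IsDynCoverOf.coverEntropyEntourage_le_log_card_div (mapsTo_univ _ _)
    (by omega) hcov).trans ?_
  have hN0 : (0 : ℝ) < N := by
    have : 0 < N := by omega
    exact_mod_cast this
  rw [EReal.div_le_iff_le_mul (by exact_mod_cast hN0) (EReal.natCast_ne_top _)]
  have h1 : ((s.card : ℕ) : ℝ≥0∞) ≤ ENNReal.ofReal (Real.exp (N * c)) := by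
    rw [← ENNReal.ofReal_natCast]
    refine ENNReal.ofReal_le_ofReal ?_
    calc (s.card : ℝ) ≤ (lang Xs n).card ^ j := by exact_mod_cast hscard
      _ = Real.exp (j * b) := by
        rw [Real.exp_nat_mul, hb, Real.exp_log (by linarith [hcard n])]
      _ ≤ _ := by
        have : (N : ℝ) + 2 * w = n * j := by exact_mod_cast hNj
        refine Real.exp_le_exp.2 ?_
        have : (N : ℝ) = n * j - 2 * w := by linarith
        rw [this]; nlinarith
  refine (ENNReal.log_monotone h1).trans ?_
  rw [ENNReal.log_ofReal_of_pos (Real.exp_pos _), Real.log_exp]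
  exact_mod_cast le_of_eq (by ring)

lemma exists_glues (hσ : ∀ x : ↥Xs, (σX x : ℤ → Fin k) = fullShift (x : ℤ → Fin k))
    (hspec : AlmostWeakSpec σX) : ∃ L : ℕ → ℕ, Monotone L ∧
      Tendsto (fun m : ℕ => (L m : ℝ) / m) atTop (nhds 0) ∧ Glues Xs L := by
  set ε : ℝ := 2⁻¹ ^ (Encodable.encode (0 : ℤ)) / 2 with hε
  have hε0 : 0 < ε := by positivity
  obtain ⟨L, ⟨hL1, -, hL3⟩, hL4⟩ := hspec ε hε0
  have hdist : ∀ x y : ↥Xs, dist x y ≤ ε → (x : ℤ → Fin k) 0 = (y : ℤ → Fin k) 0 := by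
    intro x y hxy
    by_contra hne
    have h1 : min (2⁻¹ ^ Encodable.encode (0 : ℤ)) (dist ((x : ℤ → Fin k) 0) ((y : ℤ → Fin k) 0)) ≤
        dist x y :=
      PiCountable.min_dist_le_dist_pi _ _ 0
    have h2 : (1 : ℝ) ≤ dist ((x : ℤ → Fin k) 0) ((y : ℤ → Fin k) 0) := by
      generalize (x : ℤ → Fin k) 0 = u at hne ⊢
      generalize (y : ℤ → Fin k) 0 = v at hne ⊢
      change (1 : ℝ) ≤ dist (u : ℝ) (v : ℝ)
      rw [Real.dist_eq]
      have h3 : ((u : ℕ) : ℤ) - (v : ℕ) ≠ 0 := by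
        intro h; exact hne (Fin.ext (by omega))
      have := Int.one_le_abs h3
      exact_mod_cast this
    have h3 : (2⁻¹ : ℝ) ^ Encodable.encode (0 : ℤ) ≤ 1 := pow_le_one₀ (by norm_num) (by norm_num)
    rw [min_eq_left (h3.trans h2)] at h1
    have : (0 : ℝ) < 2⁻¹ ^ Encodable.encode (0 : ℤ) := by positivity
    linarith
  refine ⟨L, hL1, hL4, ?_⟩
  intro n g hg t y a b hy hab hbn hgap
  obtain ⟨z, hz⟩ := hL3 t (fun i => ⟨y i, hy i i.2⟩) (fun i => a i) (fun i => b i)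
    (fun i => hab i i.2) (by
      intro i j hij
      have h1 := hgap i (by omega)
      rw [hij] at h1
      have h2 := hbn j j.2
      have h3 : L (b j - a j).toNat ≤ L n := hL1 (by omega)
      omega)
  refine ⟨z, z.2, fun i hi j h1 h2 => ?_⟩
  have := hdist _ _ (hz ⟨i, hi⟩ j h1 h2)
  rw [zpow_shift hσ, zpow_shift hσ] at this
  simpa using this

end Subshift

section Codebook

variable {k : ℕ} {Xs : Set (ℤ → Fin k)}

/-- The word `W` occurs in the word `x` at position `i`. -/
def Occ {A : Type*} {ℓ M : ℕ} (x : Fin ℓ → A) (W : Fin M → A) (i : ℕ) : Prop :=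
  ∀ j : Fin M, ∃ h : i + j < ℓ, x ⟨i + j, h⟩ = W j

/-- The subword of length `m` at position `a`. -/
def subw {A : Type*} {ℓ : ℕ} (x : Fin ℓ → A) (a m : ℕ) (h : a + m ≤ ℓ) : Fin m → A :=
  fun i => x ⟨a + i, by omega⟩

lemma subw_eq {A : Type*} {ℓ : ℕ} {x x' : Fin ℓ → A} {a m : ℕ} {h : a + m ≤ ℓ}
    (he : subw x a m h = subw x' a m h) (j : ℕ) (hj : j < ℓ) (h1 : a ≤ j) (h2 : j < a + m) :
    x ⟨j, hj⟩ = x' ⟨j, hj⟩ := by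
  have := congrFun he ⟨j - a, by omega⟩
  simp only [subw] at this
  simpa [show a + (j - a) = j by omega] using this

lemma eq_of_recurrence {A : Type*} {ℓ M : ℕ} {x x' : Fin ℓ → A} {i : ℕ} (hi : 0 < i)
    (hx : ∀ j < M, ∃ (h1 : j < ℓ) (h2 : i + j < ℓ), x ⟨j, h1⟩ = x ⟨i + j, h2⟩)
    (hx' : ∀ j < M, ∃ (h1 : j < ℓ) (h2 : i + j < ℓ), x' ⟨j, h1⟩ = x' ⟨i + j, h2⟩)
    (h : ∀ j (hj : j < ℓ), M ≤ j → x ⟨j, hj⟩ = x' ⟨j, hj⟩) : x = x' := by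
  have key : ∀ m j (hj : j < ℓ), M ≤ j + m → x ⟨j, hj⟩ = x' ⟨j, hj⟩ := by
    intro m
    induction m with
    | zero => intro j hj hm; exact h j hj hm
    | succ m ih =>
      intro j hj hm
      by_cases hjM : M ≤ j
      · exact h j hj hjM
      · obtain ⟨h1, h2, h3⟩ := hx j (by omega)
        obtain ⟨_, _, h3'⟩ := hx' j (by omega)
        rw [h3, h3']
        exact ih _ _ (by omega)
  ext1 j
  exact key M j.1 j.2 (by omega)

lemma exists_codebook_core (hs : ShiftInv Xs) {L : ℕ → ℕ} (hgl : Glues Xs L) {z : ℤ → Fin k}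
    (hz : z ∈ Xs) (w M g ℓ' ℓ : ℕ) (hℓ' : 0 < ℓ') (hℓ : ℓ = M + g + ℓ' + g + (2 * w + 1)) (hM : 0 <
        M)
    (hg : L (M + ℓ' + 2 * w + 1) ≤ g) (Bad : Finset (Fin M → Fin k))
    (hbig : (ℓ + Bad.card) * k ^ (2 * g) + 1 ≤ (lang Xs M).card) :
    ∃ W ∉ Bad, ∃ C : Finset (Fin ℓ → Fin k), C ⊆ lang Xs ℓ ∧
      (lang Xs ℓ').card ≤ C.card * k ^ M ∧ ∀ x ∈ C, Occ x W 0 ∧ (∀ i, 0 < i → ¬ Occ x W i) ∧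
        Occ x (wd z (-w) (2 * w + 1)) (ℓ - (2 * w + 1)) := by
  classical
  set u := wd z (-w) (2 * w + 1) with hu
  let pre : (Fin ℓ → Fin k) → (Fin M → Fin k) := fun x => subw x 0 M (by omega)
  let mid : (Fin ℓ → Fin k) → (Fin ℓ' → Fin k) := fun x => subw x (M + g) ℓ' (by omega)
  let g1 : (Fin ℓ → Fin k) → (Fin g → Fin k) := fun x => subw x M g (by omega)
  let g2 : (Fin ℓ → Fin k) → (Fin g → Fin k) := fun x => subw x (M + g + ℓ') g (by omega)
  let G := (lang Xs ℓ).filter fun x => mid x ∈ lang Xs ℓ' ∧ Occ x u (ℓ - (2 * w + 1))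
  have hGcard : (lang Xs M).card * (lang Xs ℓ').card ≤ G.card := by
    rw [← Finset.card_product]
    refine Finset.card_le_card_of_surjOn (fun x => (pre x, mid x)) ?_
    rintro ⟨a, b⟩ hab
    obtain ⟨ha, hb⟩ := Finset.mem_product.1 (Finset.mem_coe.1 hab)
    obtain ⟨y0, hy0, ha⟩ := exists_of_mem_lang hs ha 0
    obtain ⟨y1, hy1, hb⟩ := exists_of_mem_lang hs hb (M + g : ℕ)
    dsimp only at ha hb
    have hy2 : (fun n => z (n + (-(ℓ : ℤ) + w + 1))) ∈ Xs := hs z hz _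
    obtain ⟨v, hv, hv'⟩ := hgl _ g hg 3
      (fun i => if i = 0 then y0 else if i = 1 then y1 else fun n => z (n + (-(ℓ : ℤ) + w + 1)))
      (fun i => if i = 0 then 0 else if i = 1 then (M + g : ℕ) else (M + g + ℓ' + g : ℕ))
      (fun i => if i = 0 then M - 1 else if i = 1 then (M + g + ℓ' : ℕ) - 1 else (ℓ : ℤ) - 1)
      (by intro i hi; interval_cases i <;> simp [hy0, hy1, hy2])
      (by intro i hi; interval_cases i <;> simp <;> omega)
      (by intro i hi; interval_cases i <;> simp <;> omega)
      (by
        intro i hi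
        have : i = 0 ∨ i = 1 := by omega
        rcases this with rfl | rfl <;> simp)
    have e0 := hv' 0 (by omega)
    have e1 := hv' 1 (by omega)
    have e2 := hv' 2 (by omega)
    simp only [if_true, one_ne_zero, if_false, OfNat.ofNat_ne_zero, OfNat.ofNat_ne_one] at e0 e1 e2
    have hmid : mid (wd v 0 ℓ) = b := by
      rw [← hb]; ext1 i
      simp only [mid, subw, wd]
      rw [zero_add, ← e1 _ (by omega) (by omega)]
      push_cast; ring_nf
    refine ⟨wd v 0 ℓ, ?_, ?_⟩
    · refine Finset.mem_coe.2 (Finset.mem_filter.2 ⟨wd_mem_lang hs hv _ _, ?_, ?_⟩)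
      · rw [hmid]; assumption
      · intro j
        refine ⟨by omega, ?_⟩
        simp only [wd, hu]
        rw [e2 _ (by omega) (by omega)]
        congr 1
        omega
    · simp only [Prod.mk.injEq]
      refine ⟨?_, hmid⟩
      rw [← ha]; ext1 i
      simp only [pre, subw, wd]
      rw [← e0 _ (by omega) (by omega)]
      push_cast; ring_nf
  -- words with given data
  have hfib : ∀ R : Finset (Fin ℓ → Fin k), R ⊆ G → (∀ x ∈ R, ∀ x' ∈ R,
      (∀ j (hj : j < ℓ), M ≤ j → x ⟨j, hj⟩ = x' ⟨j, hj⟩) → x = x') →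
      R.card ≤ (lang Xs ℓ').card * k ^ (2 * g) := by
    intro R hR hinj
    have : R.card ≤ ((lang Xs ℓ') ×ˢ ((Finset.univ : Finset (Fin g → Fin k)) ×ˢ
        (Finset.univ : Finset (Fin g → Fin k)))).card := by
      refine Finset.card_le_card_of_injOn (fun x => (mid x, g1 x, g2 x)) ?_ ?_
      · intro x hx
        have := (Finset.mem_filter.1 (hR hx)).2.1
        exact Finset.mem_coe.2 (Finset.mem_product.2 ⟨this, Finset.mem_product.2 ⟨Finset.mem_univ _,
            Finset.mem_univ _⟩⟩)
      · intro x hx x' hx' h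
        simp only [Prod.mk.injEq] at h
        refine hinj x hx x' hx' fun j hj hMj => ?_
        by_cases h1 : j < M + g
        · exact subw_eq h.2.1 j hj hMj h1
        by_cases h2 : j < M + g + ℓ'
        · exact subw_eq h.1 j hj (by omega) h2
        by_cases h3 : j < M + g + ℓ' + g
        · exact subw_eq h.2.2 j hj (by omega) h3
        obtain ⟨_, q⟩ := (Finset.mem_filter.1 (hR hx)).2.2 ⟨j - (ℓ - (2 * w + 1)), by omega⟩
        obtain ⟨_, q'⟩ := (Finset.mem_filter.1 (hR hx')).2.2 ⟨j - (ℓ - (2 * w + 1)), by omega⟩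
        have := q.trans q'.symm
        simpa [show ℓ - (2 * w + 1) + (j - (ℓ - (2 * w + 1))) = j by omega] using this
    refine this.trans (le_of_eq ?_)
    rw [Finset.card_product, Finset.card_product]
    simp [two_mul, pow_add]
  let D := G.filter fun x => (∀ i, 0 < i → ¬ Occ x (pre x) i) ∧ pre x ∉ Bad
  let Rec : ℕ → Finset (Fin ℓ → Fin k) := fun i => G.filter fun x => 0 < i ∧ Occ x (pre x) i
  let BadW : (Fin M → Fin k) → Finset (Fin ℓ → Fin k) := fun W => G.filter fun x => pre x = W
  have hcov : G ⊆ D ∪ ((Finset.range ℓ).biUnion Rec ∪ Bad.biUnion BadW) := by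
    intro x hx
    by_cases h1 : pre x ∈ Bad
    · refine Finset.mem_union_right _ (Finset.mem_union_right _ ?_)
      exact Finset.mem_biUnion.2 ⟨_, h1, Finset.mem_filter.2 ⟨hx, rfl⟩⟩
    by_cases h2 : ∀ i, 0 < i → ¬ Occ x (pre x) i
    · exact Finset.mem_union_left _ (Finset.mem_filter.2 ⟨hx, h2, h1⟩)
    · push Not at h2
      obtain ⟨i, hi, hi'⟩ := h2
      refine Finset.mem_union_right _ (Finset.mem_union_left _ ?_)
      obtain ⟨h, _⟩ := hi' ⟨0, hM⟩
      exact Finset.mem_biUnion.2 ⟨i, Finset.mem_range.2 (by simp at h; omega),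
        Finset.mem_filter.2 ⟨hx, hi, hi'⟩⟩
  have hRec : ∀ i, (Rec i).card ≤ (lang Xs ℓ').card * k ^ (2 * g) := by
    intro i
    refine hfib _ (Finset.filter_subset _ _) fun x hx x' hx' h => ?_
    have h1 := (Finset.mem_filter.1 hx).2
    have h2 := (Finset.mem_filter.1 hx').2
    refine eq_of_recurrence (M := M) h1.1 ?_ ?_ h
    · intro j hj
      obtain ⟨a, b⟩ := h1.2 ⟨j, hj⟩
      refine ⟨by omega, a, ?_⟩
      rw [b]; simp [pre, subw]
    · intro j hj
      obtain ⟨a, b⟩ := h2.2 ⟨j, hj⟩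
      refine ⟨by omega, a, ?_⟩
      rw [b]; simp [pre, subw]
  have hBad : ∀ W, (BadW W).card ≤ (lang Xs ℓ').card * k ^ (2 * g) := by
    intro W
    refine hfib _ (Finset.filter_subset _ _) fun x hx x' hx' h => ?_
    have h1 := (Finset.mem_filter.1 hx).2
    have h2 := (Finset.mem_filter.1 hx').2
    ext1 j
    by_cases hj : j.1 < M
    · exact subw_eq (h1.trans h2.symm) j.1 j.2 (by omega) (by omega)
    · exact h j.1 j.2 (by omega)
  have hDcard : (lang Xs ℓ').card ≤ D.card := by
    have h1 : G.card ≤ D.card + (ℓ * ((lang Xs ℓ').card * k ^ (2 * g)) +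
        Bad.card * ((lang Xs ℓ').card * k ^ (2 * g))) := by
      refine (Finset.card_le_card hcov).trans ((Finset.card_union_le _ _).trans ?_)
      refine Nat.add_le_add_left ((Finset.card_union_le _ _).trans (Nat.add_le_add ?_ ?_)) _
      · refine (Finset.card_biUnion_le_card_mul _ _ _ fun i _ => hRec i).trans ?_
        simp
      · exact Finset.card_biUnion_le_card_mul _ _ _ fun W _ => hBad W
    have h2 := Nat.mul_le_mul_right (lang Xs ℓ').card hbig
    have h3 := h2.trans (hGcard.trans h1)
    have h4 : ((ℓ + Bad.card) * k ^ (2 * g) + 1) * (lang Xs ℓ').card =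
      (lang Xs ℓ').card + (ℓ * ((lang Xs ℓ').card * k ^ (2 * g)) +
        Bad.card * ((lang Xs ℓ').card * k ^ (2 * g))) := by ring
    omega
  have hDne : (D.image pre).Nonempty := by
    rw [Finset.image_nonempty, ← Finset.card_pos]
    exact ((lang_nonempty ⟨z, hz⟩ ℓ').card_pos).trans_le hDcard
  obtain ⟨W, hW, hmax⟩ := Finset.exists_max_image (D.image pre)
    (fun W => (D.filter fun x => pre x = W).card) hDne
  refine ⟨W, ?_, D.filter fun x => pre x = W, ?_, ?_, ?_⟩
  · obtain ⟨x, hx, rfl⟩ := Finset.mem_image.1 hW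
    exact (Finset.mem_filter.1 hx).2.2
  · intro x hx
    exact (Finset.mem_filter.1 (Finset.mem_filter.1 (Finset.mem_filter.1 hx).1).1).1
  · refine hDcard.trans ((Finset.card_le_mul_card_image D _ hmax).trans (Nat.mul_le_mul_left _ ?_))
    refine (Finset.card_le_univ _).trans ?_
    simp
  · intro x hx
    obtain ⟨hxD, rfl⟩ := Finset.mem_filter.1 hx
    have h1 := Finset.mem_filter.1 hxD
    refine ⟨?_, h1.2.1, (Finset.mem_filter.1 h1.1).2.2⟩
    intro j
    exact ⟨by omega, rfl⟩

end Codebook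

section CodebookAsymptotic

variable {k : ℕ} {Xs : Set (ℤ → Fin k)}

lemma eventually_quadratic_le_exp {b : ℝ} (hb : 0 < b) :
    ∀ᶠ n : ℕ in atTop, (n : ℝ) ^ 2 + n + 1 ≤ Real.exp (b * n) := by
  have h1 : (fun x : ℝ => x ^ 2 + x + 1) =o[atTop] fun x => Real.exp (b * x) := by
    have h2 := isLittleO_pow_exp_pos_mul_atTop 2 hb
    have h3 := isLittleO_pow_exp_pos_mul_atTop 1 hb
    have h4 := isLittleO_pow_exp_pos_mul_atTop 0 hb
    simp only [pow_one, pow_zero] at h3 h4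
    exact (h2.add h3).add h4
  have h2 := (h1.bound one_pos).filter_mono le_rfl
  filter_upwards [tendsto_natCast_atTop_atTop.eventually h2] with n hn
  rw [one_mul, Real.norm_eq_abs, Real.norm_eq_abs, abs_of_pos (Real.exp_pos _)] at hn
  exact (le_abs_self _).trans hn

lemma exists_codebook (hs : ShiftInv Xs) {L : ℕ → ℕ} (hLmono : Monotone L)
    (hLlim : Tendsto (fun m : ℕ => (L m : ℝ) / m) atTop (nhds 0)) (hgl : Glues Xs L) {c : ℝ}
    (hc0 : 0 < c) (hc : ∀ n : ℕ, Real.exp (c * n) ≤ (lang Xs n).card) {z : ℤ → Fin k} (hz : z ∈ Xs)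
    (w : ℕ) {α ρ κ : ℝ} (hα1 : α ≤ 1) (hκ : 0 < κ) (hρ : 0 < ρ) (hρα : ρ < α)
    (hρκ : 2 * ρ * (c + Real.log k) ≤ κ) :
    ∀ᶠ n : ℕ in atTop, ∀ Bad : Finset (Fin ⌊ρ * n⌋₊ → Fin k), Bad.card ≤ n ^ 2 →
      ∃ W ∉ Bad, ∃ C : Finset (Fin ⌊α * n⌋₊ → Fin k), C ⊆ lang Xs ⌊α * n⌋₊ ∧
      Real.exp (n * (α * c - κ)) ≤ C.card ∧ ∀ x ∈ C, Occ x W 0 ∧ (∀ i, 0 < i → ¬ Occ x W i) ∧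
        ∃ i, Occ x (wd z (-w) (2 * w + 1)) i := by
  have hk : 1 ≤ k := by
    have := (z 0).2
    omega
  have hkpos : (0 : ℝ) < k := by exact_mod_cast hk
  have hlogk : 0 ≤ Real.log k := Real.log_nonneg (by exact_mod_cast hk)
  -- the gap is a small proportion of `n`
  obtain ⟨x, hx0, hx1, hx2, hx3⟩ : ∃ x : ℝ, 0 < x ∧ 8 * x ≤ α - ρ ∧ 8 * c * x ≤ κ ∧
      4 * x * (Real.log k + 1) ≤ c * ρ / 2 := by
    refine ⟨min ((α - ρ) / 8) (min (κ / (8 * c)) (c * ρ / (8 * (Real.log k + 1)))),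
      ?_, ?_, ?_, ?_⟩
    · have := sub_pos.2 hρα; positivity
    · have := min_le_left ((α - ρ) / 8) (min (κ / (8 * c)) (c * ρ / (8 * (Real.log k + 1))))
      linarith
    · have := (min_le_right ((α - ρ) / 8) (min (κ / (8 * c)) (c * ρ / (8 * (Real.log k + 1))))).trans (min_le_left _ _)
      rw [le_div_iff₀ (by positivity)] at this
      linarith
    · have := (min_le_right ((α - ρ) / 8) (min (κ / (8 * c)) (c * ρ / (8 * (Real.log k + 1))))).trans (min_le_right _ _)
      rw [le_div_iff₀ (by positivity)] at this
      linarith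
  have hb : 0 < c * ρ / 2 := by positivity
  have hbig : ∀ K : ℝ, ∀ᶠ n : ℕ in atTop, K ≤ x * n := fun K =>
    (tendsto_natCast_atTop_atTop.const_mul_atTop hx0).eventually_ge_atTop K
  have hbigρ : ∀ K : ℝ, ∀ᶠ n : ℕ in atTop, K ≤ ρ * n := fun K =>
    (tendsto_natCast_atTop_atTop.const_mul_atTop hρ).eventually_ge_atTop K
  filter_upwards [eventually_quadratic_le_exp hb, hbig (2 * w + 2), hbigρ 1, hbig c,
    hLlim.eventually (gt_mem_nhds hx0), eventually_gt_atTop 0] with n h1 h2 h3 h5 h6 hn0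
  have hn : (0 : ℝ) < n := by exact_mod_cast hn0
  rw [div_lt_iff₀ hn] at h6
  set ℓ := ⌊α * n⌋₊ with hℓ
  set M := ⌊ρ * n⌋₊ with hM
  set g := L n with hg
  intro Bad hBad
  have hα : 0 < α := hρ.trans hρα
  have hℓ1 : (ℓ : ℝ) ≤ α * n := Nat.floor_le (by positivity)
  have hℓ2 : α * n < ℓ + 1 := Nat.lt_floor_add_one _
  have hM1 : (M : ℝ) ≤ ρ * n := Nat.floor_le (by positivity)
  have hM2 : ρ * n < M + 1 := Nat.lt_floor_add_one _
  have hMpos : 0 < M := Nat.floor_pos.2 h3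
  have hw0 : (0 : ℝ) ≤ w := Nat.cast_nonneg _
  have hsmall : M + 2 * g + (2 * w + 1) < ℓ := by
    have : (M : ℝ) + 2 * g + (2 * w + 1) < ℓ := by
      have : 8 * x * n ≤ (α - ρ) * n := by gcongr
      nlinarith
    exact_mod_cast this
  set ℓ' := ℓ - (M + 2 * g + (2 * w + 1)) with hℓ'
  have hℓn : ℓ ≤ n := by
    have : (ℓ : ℝ) ≤ n := hℓ1.trans (by nlinarith)
    exact_mod_cast this
  obtain ⟨W, hW, C, hC1, hC2, hC3⟩ := exists_codebook_core hs hgl hz w M g ℓ' ℓ (by omega)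
    (by omega) hMpos (hLmono (by omega)) Bad (by
      have : (((ℓ + Bad.card) * k ^ (2 * g) + 1 : ℕ) : ℝ) ≤ ((lang Xs M).card : ℝ) := by
        refine le_trans ?_ (hc M)
        push_cast
        have e1 : (ℓ : ℝ) ≤ n := by exact_mod_cast hℓn
        have e2 : (Bad.card : ℝ) ≤ n ^ 2 := by exact_mod_cast hBad
        have e3 : (k : ℝ) ^ (2 * g) = Real.exp (2 * g * Real.log k) := by
          rw [← Real.rpow_natCast, Real.rpow_def_of_pos hkpos]; push_cast; ring_nf
        have e4 : (1 : ℝ) ≤ (k : ℝ) ^ (2 * g) := one_le_pow₀ (by exact_mod_cast hk)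
        calc ((ℓ : ℝ) + Bad.card) * k ^ (2 * g) + 1 ≤ (n + n ^ 2) * k ^ (2 * g) + 1 * k ^ (2 * g) :=
            by
              gcongr; linarith
          _ = (n ^ 2 + n + 1) * Real.exp (2 * g * Real.log k) := by rw [e3]; ring
          _ ≤ Real.exp (c * ρ / 2 * n) * Real.exp (2 * g * Real.log k) := by gcongr
          _ = Real.exp (c * ρ / 2 * n + 2 * g * Real.log k) := (Real.exp_add _ _).symm
          _ ≤ Real.exp (c * M) := by
            refine Real.exp_le_exp.2 ?_
            have f1 : 2 * g * Real.log k ≤ 2 * (x * n) * Real.log k := by gcongr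
            have f2 : 4 * x * (Real.log k + 1) * n ≤ c * ρ / 2 * n := by gcongr
            have f3 : c * (ρ * n) ≤ c * (M + 1) := by gcongr
            have f4 : 0 ≤ x * n * Real.log k := by positivity
            nlinarith
      exact_mod_cast this)
  refine ⟨W, hW, C, hC1, ?_, fun y hy => ⟨(hC3 y hy).1, (hC3 y hy).2.1, _, (hC3 y hy).2.2⟩⟩
  have h7 : Real.exp (c * ℓ') ≤ C.card * Real.exp (M * Real.log k) := by
    refine (hc ℓ').trans ?_
    have : ((lang Xs ℓ').card : ℝ) ≤ C.card * k ^ M := by exact_mod_cast hC2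
    rwa [← Real.rpow_natCast, Real.rpow_def_of_pos hkpos, mul_comm (Real.log k)] at this
  have h8 : Real.exp (c * ℓ' - M * Real.log k) ≤ C.card := by
    rw [Real.exp_sub, div_le_iff₀ (Real.exp_pos _)]; exact h7
  refine le_trans (Real.exp_le_exp.2 ?_) h8
  have h9 : (ℓ' : ℝ) = ℓ - (M + 2 * g + (2 * w + 1)) := by
    rw [hℓ', Nat.cast_sub hsmall.le]; push_cast; ring
  have h10 : 2 * ρ * (c + Real.log k) * n ≤ κ * n := by gcongr
  have h11 : 8 * c * x * n ≤ κ * n := by gcongr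
  have h12 : (M : ℝ) * Real.log k ≤ ρ * n * Real.log k := by gcongr
  have h13 : c * (α * n - ρ * n - 2 * (x * n) - x * n) ≤ c * ℓ' := by
    rw [h9]
    refine mul_le_mul_of_nonneg_left ?_ hc0.le
    linarith
  have h14 : 0 ≤ κ * n := by positivity
  nlinarith

end CodebookAsymptotic

section Combinatorics

open Classical in
lemma card_hamming_ball_le {q N : ℕ} (R : Fin N → Fin q) {θ : ℝ} (hθ : 0 ≤ θ) (t : ℝ) :
    (((Finset.univ : Finset (Fin N → Fin q)).filter fun u =>
      ((Finset.univ.filter fun i => u i ≠ R i).card : ℝ) ≤ t).card : ℝ) ≤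
      Real.exp (θ * t) * (1 + q * Real.exp (-θ)) ^ N := by
  have h1 : ∑ u : Fin N → Fin q, ∏ i, (if u i ≠ R i then Real.exp (-θ) else 1) ≤
      (1 + q * Real.exp (-θ)) ^ N := by
    rw [← Fintype.piFinset_univ, ← Finset.prod_univ_sum (fun _ => Finset.univ)
      (fun i a => if a ≠ R i then Real.exp (-θ) else 1)]
    refine (Finset.prod_le_prod (g := fun _ => 1 + q * Real.exp (-θ)) ?_ ?_).trans (by simp)
    · intro i _
      exact Finset.sum_nonneg fun a _ => by split_ifs <;> positivity
    · intro i _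
      calc ∑ a, (if a ≠ R i then Real.exp (-θ) else 1)
          ≤ ∑ a, (Real.exp (-θ) + if a = R i then 1 else 0) := by
            refine Finset.sum_le_sum fun a _ => ?_
            by_cases h : a = R i <;> simp [h, Real.exp_nonneg]
        _ = 1 + q * Real.exp (-θ) := by
            rw [Finset.sum_add_distrib]; simp [add_comm]
  have h2 : ∀ u : Fin N → Fin q, ∏ i, (if u i ≠ R i then Real.exp (-θ) else 1) =
      Real.exp (-(θ * (Finset.univ.filter fun i => u i ≠ R i).card)) := by
    intro u
    rw [Finset.prod_ite, Finset.prod_const, Finset.prod_const_one, mul_one, ← Real.exp_nat_mul]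
    congr 1; ring
  set S := (Finset.univ : Finset (Fin N → Fin q)).filter fun u =>
      ((Finset.univ.filter fun i => u i ≠ R i).card : ℝ) ≤ t with hS
  have h3 : (S.card : ℝ) * Real.exp (-(θ * t)) ≤ (1 + q * Real.exp (-θ)) ^ N := by
    refine le_trans ?_ h1
    calc (S.card : ℝ) * Real.exp (-(θ * t)) = ∑ u ∈ S, Real.exp (-(θ * t)) := by simp
      _ ≤ ∑ u ∈ S, ∏ i, (if u i ≠ R i then Real.exp (-θ) else 1) := by
        refine Finset.sum_le_sum fun u hu => ?_
        rw [h2]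
        have := (Finset.mem_filter.1 hu).2
        gcongr
      _ ≤ _ := Finset.sum_le_sum_of_subset_of_nonneg (Finset.subset_univ _) fun u _ _ =>
        Finset.prod_nonneg fun i _ => by split_ifs <;> positivity
  rw [Real.exp_neg, ← div_eq_mul_inv, div_le_iff₀ (Real.exp_pos _)] at h3
  linarith

/-- Positions of a set of integers which look like the beginning of a coded block of length `n`
around the origin. -/
structure Frame (O : ℤ → Prop) (ℓ g M n : ℕ) (p : ℤ) : Prop where
  nonpos : p ≤ 0
  pos : 0 < p + n - g - M
  start : O p
  next : O (p + n) ∨ O (p + n + 1)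
  code : ∀ i, p < i → i ≤ p + ℓ - M → ¬ O i
  fill : ∀ i, p + ℓ + g ≤ i → i ≤ p + n - g - M → ¬ O i

lemma Frame.not_lt {O : ℤ → Prop} {ℓ g M n : ℕ} {p p' : ℤ}
    (hp : Frame O ℓ g M n p) (hp' : Frame O ℓ g M n p') (h0 : ℓ + g < n)
    (h : n + 2 * M ≤ 2 * ℓ ∨ (2 * ℓ + 2 * g ≤ n ∧ 2 * M + g + 1 ≤ ℓ)) : ¬ p < p' := by
  intro hlt
  obtain ⟨a1, a2, a3, a4, a5, a6⟩ := hp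
  obtain ⟨b1, b2, b3, b4, b5, b6⟩ := hp'
  have h1 : p + ℓ - M < p' := by
    by_contra h'; exact a5 p' hlt (by omega) b3
  have h2 : p' < p + ℓ + g := by
    by_contra h'; exact a6 p' (by omega) (by omega) b3
  obtain ⟨q, hq, hq'⟩ : ∃ q, O q ∧ (q = p + n ∨ q = p + n + 1) := by
    rcases a4 with h | h
    · exact ⟨_, h, Or.inl rfl⟩
    · exact ⟨_, h, Or.inr rfl⟩
  rcases h with h | ⟨h3, h4⟩
  · exact b5 q (by omega) (by omega) hq
  · exact b6 q (by omega) (by omega) hq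

lemma Frame.unique {O : ℤ → Prop} {ℓ g M n : ℕ} {p p' : ℤ}
    (hp : Frame O ℓ g M n p) (hp' : Frame O ℓ g M n p') (h0 : ℓ + g < n)
    (h : n + 2 * M ≤ 2 * ℓ ∨ (2 * ℓ + 2 * g ≤ n ∧ 2 * M + g + 1 ≤ ℓ)) : p = p' :=
  le_antisymm (_root_.not_lt.1 (Frame.not_lt hp' hp h0 h)) (_root_.not_lt.1 (Frame.not_lt hp hp' h0 h))

lemma exists_fill {k : ℕ} {Xs : Set (ℤ → Fin k)} (hne : Xs.Nonempty) (m : ℕ) :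
    ∃ fill : (Fin m → Option (Fin k)) → (Fin m → Fin k), (∀ φ, fill φ ∈ lang Xs m) ∧
      ∀ φ, (∃ v ∈ lang Xs m, ∀ i a, φ i = some a → v i = a) →
        ∀ i a, φ i = some a → fill φ i = a := by
  have : ∀ φ : Fin m → Option (Fin k), ∃ v ∈ lang Xs m,
      (∃ v ∈ lang Xs m, ∀ i a, φ i = some a → v i = a) → ∀ i a, φ i = some a → v i = a := by
    intro φ
    by_cases h : ∃ v ∈ lang Xs m, ∀ i a, φ i = some a → v i = a
    · obtain ⟨v, hv, hv'⟩ := h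
      exact ⟨v, hv, fun _ => hv'⟩
    · obtain ⟨v, hv⟩ := lang_nonempty hne m
      exact ⟨v, hv, fun h' => absurd h' h⟩
  choose fill h1 h2 using this
  exact ⟨fill, h1, h2⟩

lemma exists_encoding {V N Γ : Type*} (C : Finset Γ) (hC : C.Nonempty) (S : V → Finset N)
    (h : ∀ v, (S v).card ≤ C.card) :
    ∃ enc : V → N → Γ, (∀ v a, enc v a ∈ C) ∧ ∀ v, InjOn (enc v) (S v) := by
  classical
  have : ∀ v, ∃ e : N → Γ, (∀ a, e a ∈ C) ∧ InjOn e (S v) := by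
    intro v
    obtain ⟨e⟩ := Function.Embedding.nonempty_of_card_le (α := S v) (β := C) (by simpa using h v)
    obtain ⟨c, hc⟩ := hC
    refine ⟨fun a => if ha : a ∈ S v then e ⟨a, ha⟩ else c, ?_, ?_⟩
    · intro a
      dsimp only
      split_ifs
      · exact Subtype.property _
      · exact hc
    · intro a ha b hb hab
      rw [Finset.mem_coe] at ha hb
      simp only [ha, hb, dif_pos] at hab
      have := e.injective (Subtype.ext hab)
      exact congrArg Subtype.val this
  choose enc h1 h2 using this
  exact ⟨enc, h1, h2⟩

end Combinatorics

section BlockCode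

lemma next_marker {O : ℤ → Prop} {n : ℕ} (hsep : ∀ p, O p → ∀ i : ℕ, 0 < i → i < n → ¬ O (p + i))
    (hback : ∀ i : ℤ, ∃ d : ℕ, d ≤ n ∧ O (i - d)) {p : ℤ} (hp : O p) :
    O (p + n) ∨ O (p + n + 1) := by
  obtain ⟨d, hd, hd'⟩ := hback (p + n + 1)
  by_cases h : d = 0
  · right; simpa [h] using hd'
  by_cases h1 : d = 1
  · left; simpa [h1] using hd'
  have := hsep p hp (n + 1 - d) (by omega) (by omega)
  rw [show p + ((n + 1 - d : ℕ) : ℤ) = p + n + 1 - d by omega] at this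
  exact absurd hd' this

lemma exists_glued_blocks {k : ℕ} {Xs : Set (ℤ → Fin k)} (hs : ShiftInv Xs) {L : ℕ → ℕ}
    (hgl : Glues Xs L) {ℓ g m n : ℕ} (hn : n = ℓ + g + m + g) (hℓ : 0 < ℓ) (hm : 0 < m)
    (hg : L n ≤ g) {O : ℤ → Prop} (hsep : ∀ p, O p → ∀ i : ℕ, 0 < i → i < n → ¬ O (p + i))
    (hback : ∀ i : ℤ, ∃ d : ℕ, d ≤ n ∧ O (i - d)) {φ : ℤ → Option (Fin k)}
    {cw : ℤ → Fin ℓ → Fin k} {vw : ℤ → Fin m → Fin k} (hcw : ∀ p, cw p ∈ lang Xs ℓ)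
    (hvw : ∀ p, vw p ∈ lang Xs m)
    (hφ : ∀ j a, φ j = some a → ∃ p, O p ∧ ((∃ i : Fin ℓ, j = p + i ∧ cw p i = a) ∨
      (∃ i : Fin m, j = p + ℓ + g + i ∧ vw p i = a))) (N : ℕ) :
    ∃ z ∈ Xs, ∀ j : ℤ, |j| ≤ N → ∀ a, φ j = some a → z j = a := by
  classical
  obtain ⟨d0, hd0, hp0⟩ := hback (-N)
  let nx : ℤ → ℤ := fun p => if O (p + n) then p + n else p + n + 1
  let P : ℕ → ℤ := fun i => nx^[i] (-N - d0)
  have hPs : ∀ i, P (i + 1) = nx (P i) := fun i => Function.iterate_succ_apply' _ _ _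
  have hP : ∀ i, O (P i) := by
    intro i
    induction i with
    | zero => exact hp0
    | succ i ih =>
      rw [hPs]
      simp only [nx]
      split_ifs with h
      · exact h
      · exact (next_marker hsep hback ih).resolve_left h
  have hP1 : ∀ i, P (i + 1) = P i + n ∨ (P (i + 1) = P i + n + 1 ∧ ¬ O (P i + n)) := by
    intro i
    rw [hPs]
    simp only [nx]
    split_ifs with h
    · exact Or.inl rfl
    · exact Or.inr ⟨rfl, h⟩
  have hPlow : ∀ i : ℕ, -N - d0 + (i : ℤ) ≤ P i := by
    intro i
    induction i with
    | zero => simp [P]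
    | succ i ih => rcases hP1 i with h | h <;> push_cast <;> omega
  have hmark : ∀ t q, O q → -N - d0 ≤ q → q < P t → ∃ i < t, q = P i := by
    intro t
    induction t with
    | zero => intro q _ h1 h2; simp [P] at h2; omega
    | succ t ih =>
      intro q hq h1 h2
      by_cases h3 : q < P t
      · obtain ⟨i, hi, h⟩ := ih q hq h1 h3
        exact ⟨i, by omega, h⟩
      refine ⟨t, by omega, ?_⟩
      by_contra hne
      by_cases h4 : q < P t + n
      · have := hsep _ (hP t) (q - P t).toNat (by omega) (by omega)
        rw [show P t + ((q - P t).toNat : ℤ) = q by omega] at this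
        exact this hq
      · rcases hP1 t with h | ⟨h, h'⟩
        · omega
        · exact h' (by rwa [show P t + n = q by omega])
  choose yc hyc hyc' using fun p : ℤ => exists_of_mem_lang hs (hcw p) p
  choose yv hyv hyv' using fun p : ℤ => exists_of_mem_lang hs (hvw p) (p + ℓ + g)
  set t := 2 * N + n + 1 with ht
  obtain ⟨z, hz, hz'⟩ := hgl n g hg (2 * t)
    (fun i => if i % 2 = 0 then yc (P (i / 2)) else yv (P (i / 2)))
    (fun i => if i % 2 = 0 then P (i / 2) else P (i / 2) + ℓ + g)
    (fun i => if i % 2 = 0 then P (i / 2) + ℓ - 1 else P (i / 2) + ℓ + g + m - 1)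
    (by intro i _; split_ifs; exacts [hyc _, hyv _])
    (by intro i _; split_ifs <;> omega)
    (by intro i _; split_ifs <;> omega)
    (by
      intro i _
      by_cases h : i % 2 = 0
      · rw [if_neg (by omega), if_pos h, show (i + 1) / 2 = i / 2 by omega]; omega
      · rw [if_pos (by omega), if_neg h, show (i + 1) / 2 = i / 2 + 1 by omega]
        rcases hP1 (i / 2) with h1 | h1 <;> omega)
  refine ⟨z, hz, fun j hj a hja => ?_⟩
  rw [abs_le] at hj
  obtain ⟨p, hp, hcase⟩ := hφ j a hja
  have hjp : p ≤ j ∧ j < p + n := by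
    rcases hcase with ⟨i, rfl, _⟩ | ⟨i, rfl, _⟩ <;> omega
  have hpt := hPlow t
  have hpge : -N - d0 ≤ p := by
    by_contra hlt
    have := hsep p hp (-N - d0 - p).toNat (by omega) (by omega)
    rw [show p + ((-N - d0 - p).toNat : ℤ) = -N - d0 by omega] at this
    exact this hp0
  obtain ⟨i, hi, rfl⟩ := hmark t p hp hpge (by omega)
  rcases hcase with ⟨e, rfl, he⟩ | ⟨e, rfl, he⟩
  · have h := hz' (2 * i) (by omega)
    rw [if_pos (by omega), if_pos (by omega), if_pos (by omega), show 2 * i / 2 = i by omega] at h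
    rw [h _ (by omega) (by omega), ← he, ← hyc' (P i)]
    rfl
  · have h := hz' (2 * i + 1) (by omega)
    rw [if_neg (by omega), if_neg (by omega), if_neg (by omega),
      show (2 * i + 1) / 2 = i by omega] at h
    rw [h _ (by omega) (by omega), ← he, ← hyv' (P i)]
    rfl

variable {X : Type*} [MeasurableSpace X] {T : X ≃ᵐ X} {B : Set X} {n : ℕ} {A : Type*}

open Classical in
/-- The code which writes `F d b` at the `d`-th point after a marker `b`, for `d < n`. -/
noncomputable def blockCode (T : X ≃ᵐ X) (B : Set X) (n : ℕ) (F : ℕ → X → Option A) (x : X) :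
    Option A :=
  if h : ∃ d, d < n ∧ itZ T (-(d : ℕ)) x ∈ B then
    F (Nat.find h) (itZ T (-(Nat.find h : ℕ)) x) else none

lemma exists_of_blockCode_eq_some {F : ℕ → X → Option A} {x : X} {a : A}
    (h : blockCode T B n F x = some a) :
    ∃ d < n, itZ T (-(d : ℕ)) x ∈ B ∧ F d (itZ T (-(d : ℕ)) x) = some a := by
  classical
  unfold blockCode at h
  split_ifs at h with h1
  exact ⟨_, (Nat.find_spec h1).1, (Nat.find_spec h1).2, h⟩

lemma blockCode_of_mem {F : ℕ → X → Option A} (hsep : ∀ x ∈ B, ∀ i : ℕ, 0 < i → i < n →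
    itZ T i x ∉ B) {x : X} {d : ℕ} (hd : d < n) (hx : itZ T (-(d : ℕ)) x ∈ B) :
    blockCode T B n F x = F d (itZ T (-(d : ℕ)) x) := by
  classical
  have h : ∃ d, d < n ∧ itZ T (-(d : ℕ)) x ∈ B := ⟨d, hd, hx⟩
  unfold blockCode
  rw [dif_pos h]
  have h1 : Nat.find h ≤ d := Nat.find_min' h ⟨hd, hx⟩
  have h2 := Nat.find_spec h
  suffices Nat.find h = d by rw [this]
  by_contra hne
  refine hsep _ hx (d - Nat.find h) (by omega) (by omega) ?_
  rw [← itZ_add, show ((d - Nat.find h : ℕ) : ℤ) + -(d : ℕ) = -(Nat.find h : ℕ) by omega]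
  exact h2.2

lemma blockCode_add {F : ℕ → X → Option A} (hsep : ∀ x ∈ B, ∀ i : ℕ, 0 < i → i < n →
    itZ T i x ∉ B) {x : X} {p : ℤ} (hp : itZ T p x ∈ B) {d : ℕ} (hd : d < n) :
    blockCode T B n F (itZ T (p + d) x) = F d (itZ T p x) := by
  have h : itZ T (-(d : ℕ)) (itZ T (p + d) x) = itZ T p x := by
    rw [← itZ_add]; congr 1; ring
  rw [blockCode_of_mem hsep hd (by rwa [h]), h]

instance optionFinMeasurableSpace (k : ℕ) : MeasurableSpace (Option (Fin k)) := ⊤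

instance optionFinDiscrete (k : ℕ) : DiscreteMeasurableSpace (Option (Fin k)) := ⟨fun _ => trivial⟩

lemma measurable_blockCode {k : ℕ} (hB : MeasurableSet B) (hsep : ∀ x ∈ B, ∀ i : ℕ, 0 < i → i < n →
    itZ T i x ∉ B) {F : ℕ → X → Option (Fin k)} (hF : ∀ d, Measurable (F d)) :
    Measurable (blockCode T B n F) := by
  have hsome : ∀ a : Fin k, MeasurableSet (blockCode T B n F ⁻¹' {some a}) := by
    intro a
    have : blockCode T B n F ⁻¹' {some a} = ⋃ d ∈ Set.Iio n,
        (itZ T (-(d : ℕ)) ⁻¹' B ∩ (fun x => F d (itZ T (-(d : ℕ)) x)) ⁻¹' {some a}) := by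
      ext x
      simp only [Set.mem_preimage, Set.mem_singleton_iff, Set.mem_iUnion, Set.mem_inter_iff,
        Set.mem_Iio, exists_prop]
      constructor
      · intro h
        obtain ⟨d, h1, h2, h3⟩ := exists_of_blockCode_eq_some h
        exact ⟨d, h1, h2, h3⟩
      · rintro ⟨d, h1, h2, h3⟩
        rw [blockCode_of_mem hsep h1 h2, h3]
    rw [this]
    refine MeasurableSet.biUnion (Set.to_countable _) fun d _ => ?_
    exact (measurable_itZ T _ hB).inter (((hF d).comp (measurable_itZ T _)) (measurableSet_singleton _))
  refine measurable_to_countable' fun o => ?_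
  cases o with
  | some a => exact hsome a
  | none =>
    have : blockCode T B n F ⁻¹' {none} = (⋃ a, blockCode T B n F ⁻¹' {some a})ᶜ := by
      ext x
      simp only [Set.mem_preimage, Set.mem_singleton_iff, Set.mem_compl_iff, Set.mem_iUnion,
        not_exists]
      constructor
      · intro h a; rw [h]; simp
      · intro h
        cases h' : blockCode T B n F x with
        | none => rfl
        | some a => exact absurd h' (h a)
    rw [this]
    exact (MeasurableSet.iUnion hsome).compl

end BlockCode

section Mass

variable {X : Type*} [MeasurableSpace X] {μ : Measure X} {T : X ≃ᵐ X} {B : Set X} {n : ℕ}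

lemma measure_exists_mem_le (hT : MeasurePreserving T μ μ) (I : Finset ℕ) (S : Set X) :
    μ {x | ∃ d ∈ I, itZ T (-(d : ℕ)) x ∈ S} ≤ I.card * μ S := by
  have : {x | ∃ d ∈ I, itZ T (-(d : ℕ)) x ∈ S} = ⋃ d ∈ I, itZ T (-(d : ℕ)) ⁻¹' S := by
    ext x; simp
  rw [this]
  refine (measure_biUnion_finset_le _ _).trans ?_
  simp only [measure_preimage_itZ hT]
  simp

lemma card_mul_measure_le_one [IsProbabilityMeasure μ] (hT : MeasurePreserving T μ μ)
    (hB : MeasurableSet B) (hsep : ∀ x ∈ B, ∀ i : ℕ, 0 < i → i < n → itZ T i x ∉ B) :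
    n * μ B ≤ 1 := by
  have h : ∑ d ∈ Finset.range n, μ (itZ T (-(d : ℕ)) ⁻¹' B) = n * μ B := by
    simp only [measure_preimage_itZ hT]
    simp
  rw [← h, ← measure_biUnion_finset _ fun d _ => measurable_itZ T _ hB]
  · exact prob_le_one
  · intro i hi j hj hij
    have key : ∀ i j : ℕ, i < n → j < n → i < j → ∀ x, itZ T (-(i : ℕ)) x ∈ B →
        itZ T (-(j : ℕ)) x ∈ B → False := by
      intro i j _ hj hlt x h1 h2
      refine hsep _ h2 (j - i) (by omega) (by omega) ?_
      rw [← itZ_add, show ((j - i : ℕ) : ℤ) + -(j : ℕ) = -(i : ℕ) by omega]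
      exact h1
    rw [Function.onFun, Set.disjoint_left]
    intro x h1 h2
    have hi' := Finset.mem_range.1 hi
    have hj' := Finset.mem_range.1 hj
    rcases lt_or_gt_of_ne hij with h | h
    · exact key i j hi' hj' h x h1 h2
    · exact key j i hj' hi' h x h2 h1

open Classical in
lemma card_frequent_words_le {k m M : ℕ} (hB : MeasurableSet B)
    (hmass : n * μ B ≤ 1) {v : X → Fin m → Fin k} (hv : Measurable v) (hmn : m ≤ n) (hn : 0 < n)
    (hM : 0 < M) :
    ((Finset.univ : Finset (Fin M → Fin k)).filter fun W =>
      ((n : ℝ≥0∞) ^ 2)⁻¹ < μ (B ∩ {x | ∃ i, Occ (v x) W i})).card ≤ n ^ 2 := by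
  set Bad := (Finset.univ : Finset (Fin M → Fin k)).filter fun W =>
      ((n : ℝ≥0∞) ^ 2)⁻¹ < μ (B ∩ {x | ∃ i, Occ (v x) W i}) with hBad
  have h1 : ∀ W : Fin M → Fin k, μ (B ∩ {x | ∃ i, Occ (v x) W i}) ≤
      ∑ i ∈ Finset.range m, μ (B ∩ {x | Occ (v x) W i}) := by
    intro W
    refine (measure_mono ?_).trans (measure_biUnion_finset_le _ _)
    rintro x ⟨hx, i, hi⟩
    obtain ⟨h, -⟩ := hi ⟨0, hM⟩
    simp only [Set.mem_iUnion]
    exact ⟨i, Finset.mem_range.2 (by simp at h; omega), hx, hi⟩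
  have hmeas : ∀ (W : Fin M → Fin k) i, MeasurableSet {x | Occ (v x) W i} := fun W i =>
    hv (Set.toFinite {u | Occ u W i}).measurableSet
  have h2 : ∀ i, ∑ W : Fin M → Fin k, μ (B ∩ {x | Occ (v x) W i}) ≤ μ B := by
    intro i
    rw [← measure_biUnion_finset]
    · refine measure_mono ?_
      intro x hx
      simp only [Set.mem_iUnion] at hx
      obtain ⟨_, _, hx, _⟩ := hx
      exact hx
    · intro W _ W' _ hne
      rw [Function.onFun, Set.disjoint_left]
      rintro x ⟨_, hx⟩ ⟨_, hx'⟩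
      refine hne (funext fun j => ?_)
      obtain ⟨_, h⟩ := hx j
      obtain ⟨_, h'⟩ := hx' j
      exact h.symm.trans h'
    · exact fun W _ => hB.inter (hmeas W i)
  have h3 : Bad.card * ((n : ℝ≥0∞) ^ 2)⁻¹ ≤ 1 := by
    calc Bad.card * ((n : ℝ≥0∞) ^ 2)⁻¹ = ∑ W ∈ Bad, ((n : ℝ≥0∞) ^ 2)⁻¹ := by simp
      _ ≤ ∑ W ∈ Bad, μ (B ∩ {x | ∃ i, Occ (v x) W i}) :=
        Finset.sum_le_sum fun W hW => (Finset.mem_filter.1 hW).2.le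
      _ ≤ ∑ W, μ (B ∩ {x | ∃ i, Occ (v x) W i}) :=
        Finset.sum_le_sum_of_subset (Finset.subset_univ _)
      _ ≤ ∑ W, ∑ i ∈ Finset.range m, μ (B ∩ {x | Occ (v x) W i}) := Finset.sum_le_sum fun W _ =>
          h1 W
      _ = ∑ i ∈ Finset.range m, ∑ W, μ (B ∩ {x | Occ (v x) W i}) := Finset.sum_comm
      _ ≤ ∑ i ∈ Finset.range m, μ B := Finset.sum_le_sum fun i _ => h2 i
      _ = m * μ B := by simp
      _ ≤ n * μ B := by gcongr
      _ ≤ 1 := hmass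
  have h4 : (Bad.card : ℝ≥0∞) ≤ (n : ℝ≥0∞) ^ 2 := by
    rw [← div_eq_mul_inv] at h3
    have := (ENNReal.div_le_iff (by simp [hn.ne']) (by simp)).1 h3
    simpa using this
  exact_mod_cast h4

end Mass

section Coding

/-- The sequence `y` agrees with the partial sequence `f` read along the orbit of `x` in the
window of radius `r`. -/
def Extends {X A : Type*} [MeasurableSpace X] (T : X ≃ᵐ X) (f : X → Option A) (r : ℕ) (x : X)
    (y : ℤ → A) : Prop :=
  ∀ i : ℤ, |i| ≤ r → ∀ a, f (itZ T i x) = some a → y i = a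

/-- The partial sequences read along almost every orbit are consistent with `Xs`. -/
def Consistent {X A : Type*} [MeasurableSpace X] (μ : Measure X) (T : X ≃ᵐ X) (Xs : Set (ℤ → A))
    (f : X → Option A) : Prop :=
  ∀ᵐ x ∂μ, ∀ N : ℕ, ∃ z ∈ Xs, Extends T f N x z

/-- The data for coding an observable `P` by blocks of length `n`: the markers `B`, the words `v`
to be repeated, the code words given by `enc`, and the synchronizing word `W`. -/
structure BlockCoding {X : Type*} [MeasurableSpace X] (μ : Measure X) (T : X ≃ᵐ X) {k q : ℕ}
    (Xs : Set (ℤ → Fin k)) (L : ℕ → ℕ) (P : X → Fin q) (ℓ g m M n w : ℕ) (z : ℤ → Fin k) where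
  (B Typ : Set X)
  v : X → Fin m → Fin k
  enc : (Fin m → Fin k) → (Fin n → Fin q) → Fin ℓ → Fin k
  W : Fin M → Fin k
  n_eq : n = ℓ + g + m + g
  ℓ_pos : 0 < ℓ
  m_pos : 0 < m
  M_le : M ≤ n
  gap : L n ≤ g
  geom : n + 2 * M ≤ 2 * ℓ ∨ (2 * ℓ + 2 * g ≤ n ∧ 2 * M + g + 1 ≤ ℓ)
  measB : MeasurableSet B
  measv : Measurable v
  sep : ∀ x ∈ B, ∀ i : ℕ, 0 < i → i < n → itZ T i x ∉ B
  back : ∀ᵐ x ∂μ, ∃ d : ℕ, d ≤ n ∧ itZ T (-(d : ℕ)) x ∈ B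
  v_mem : ∀ x, v x ∈ lang Xs m
  enc_mem : ∀ u a, enc u a ∈ lang Xs ℓ
  enc_zero : ∀ u a, Occ (enc u a) W 0
  enc_not : ∀ u a i, 0 < i → ¬ Occ (enc u a) W i
  enc_target : ∀ u a, ∃ i, Occ (enc u a) (wd z (-w) (2 * w + 1)) i
  enc_inj : ∀ x ∈ Typ, ∀ x' ∈ Typ, v x = v x' → enc (v x) (nm T P n x) = enc (v x') (nm T P n x') →
    nm T P n x = nm T P n x'

namespace BlockCoding

variable {X : Type*} [MeasurableSpace X] {μ : Measure X} [IsProbabilityMeasure μ] {T : X ≃ᵐ X}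
  {k q : ℕ} {Xs : Set (ℤ → Fin k)} {L : ℕ → ℕ} {P : X → Fin q} {ℓ g m M n w : ℕ} {z : ℤ → Fin k}
  (𝔅 : BlockCoding μ T Xs L P ℓ g m M n w z)

/-- The symbol written at position `d` of the block of `b`. -/
noncomputable def letter (d : ℕ) (b : X) : Option (Fin k) :=
  if h : d < ℓ then some (𝔅.enc (𝔅.v b) (nm T P n b) ⟨d, h⟩)
  else if h : ℓ + g ≤ d ∧ d < ℓ + g + m then some (𝔅.v b ⟨d - (ℓ + g), by omega⟩)
  else none

/-- The coded partial sequence. -/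
noncomputable def code : X → Option (Fin k) := blockCode T 𝔅.B n 𝔅.letter

/-- The points in the decodable part of typical blocks. -/
def Good : Set X := {x | ∃ d : ℕ, d + g + M < n ∧ itZ T (-(d : ℕ)) x ∈ 𝔅.B ∧
  itZ T (-(d : ℕ)) x ∈ 𝔅.Typ ∧ (∀ i, ¬ Occ (𝔅.v (itZ T (-(d : ℕ)) x)) 𝔅.W i) ∧
  (itZ T (-(d : ℕ) + n) x ∈ 𝔅.B ∨ itZ T (-(d : ℕ) + n + 1) x ∈ 𝔅.B)}

lemma letter_code {d : ℕ} (h : d < ℓ) (b : X) :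
    𝔅.letter d b = some (𝔅.enc (𝔅.v b) (nm T P n b) ⟨d, h⟩) := dif_pos h

lemma letter_fill (i : Fin m) (b : X) : 𝔅.letter (ℓ + g + i) b = some (𝔅.v b i) := by
  unfold letter
  rw [dif_neg (by omega), dif_pos (by omega)]
  congr 2
  ext; simp

lemma measurable_code (hP : Measurable P) : Measurable 𝔅.code := by
  refine measurable_blockCode 𝔅.measB 𝔅.sep fun d => ?_
  have h1 : Measurable fun b => (𝔅.v b, nm T P n b) :=
    𝔅.measv.prodMk (measurable_nm T.measurable hP n)
  let F : (Fin m → Fin k) × (Fin n → Fin q) → Option (Fin k) := fun a =>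
    if h : d < ℓ then some (𝔅.enc a.1 a.2 ⟨d, h⟩)
    else if h : ℓ + g ≤ d ∧ d < ℓ + g + m then some (a.1 ⟨d - (ℓ + g), by omega⟩) else none
  have h2 : Measurable F := fun s _ => (Set.toFinite _).measurableSet
  exact h2.comp h1

lemma code_at_marker {x : X} {p : ℤ} (hp : itZ T p x ∈ 𝔅.B) {d : ℕ} (hd : d < n) :
    𝔅.code (itZ T (p + d) x) = 𝔅.letter d (itZ T p x) := blockCode_add 𝔅.sep hp hd

lemma consistent (hT : MeasurePreserving T μ μ) (hs : ShiftInv Xs) (hgl : Glues Xs L) :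
    Consistent μ T Xs 𝔅.code := by
  filter_upwards [ae_itZ hT 𝔅.back] with x hx N
  have hn := 𝔅.n_eq
  refine exists_glued_blocks hs hgl 𝔅.n_eq 𝔅.ℓ_pos 𝔅.m_pos 𝔅.gap
    (O := fun i => itZ T i x ∈ 𝔅.B) ?_ ?_
    (cw := fun p => 𝔅.enc (𝔅.v (itZ T p x)) (nm T P n (itZ T p x)))
    (vw := fun p => 𝔅.v (itZ T p x)) (fun p => 𝔅.enc_mem _ _) (fun p => 𝔅.v_mem _) ?_ N
  · intro p hp i h1 h2
    rw [add_comm, itZ_add]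
    exact 𝔅.sep _ hp i h1 h2
  · intro i
    obtain ⟨d, hd, h⟩ := hx i
    refine ⟨d, hd, ?_⟩
    rwa [sub_eq_add_neg, add_comm, itZ_add]
  · intro j a hja
    obtain ⟨d, hd, hB, hF⟩ := exists_of_blockCode_eq_some hja
    rw [← itZ_add] at hB hF
    refine ⟨-(d : ℕ) + j, hB, ?_⟩
    unfold letter at hF
    split_ifs at hF with h1 h2
    · exact Or.inl ⟨⟨d, h1⟩, by simp, Option.some_injective _ hF⟩
    · refine Or.inr ⟨⟨d - (ℓ + g), by omega⟩, ?_, Option.some_injective _ hF⟩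
      dsimp only; omega

/-- Reading off the block structure from an extension of the coded sequence. -/
lemma frame_of_good {r : ℕ} (hr : 2 * n + 1 ≤ r) {x : X} {d : ℕ} (h1 : d + g + M < n)
    (h2 : itZ T (-(d : ℕ)) x ∈ 𝔅.B) (h4 : ∀ i, ¬ Occ (𝔅.v (itZ T (-(d : ℕ)) x)) 𝔅.W i)
    (h5 : itZ T (-(d : ℕ) + n) x ∈ 𝔅.B ∨ itZ T (-(d : ℕ) + n + 1) x ∈ 𝔅.B) {y : ℤ → Fin k}
    (hy : Extends T 𝔅.code r x y) :
    Frame (fun i => wd y i M = 𝔅.W) ℓ g M n (-(d : ℕ)) ∧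
    wd y (-(d : ℕ)) ℓ = 𝔅.enc (𝔅.v (itZ T (-(d : ℕ)) x)) (nm T P n (itZ T (-(d : ℕ)) x)) ∧
    wd y (-(d : ℕ) + ℓ + g) m = 𝔅.v (itZ T (-(d : ℕ)) x) := by
  have hn := 𝔅.n_eq
  have hMn := 𝔅.M_le
  have hcode : ∀ p : ℤ, -(n : ℤ) ≤ p → p ≤ n + 1 → itZ T p x ∈ 𝔅.B → ∀ i : Fin ℓ, y (p + i) =
      𝔅.enc (𝔅.v (itZ T p x)) (nm T P n (itZ T p x)) i := by
    intro p hp1 hp2 hp i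
    refine hy _ ?_ _ ?_
    · rw [abs_le]; constructor <;> omega
    · rw [𝔅.code_at_marker hp (by omega), 𝔅.letter_code i.2]
  have hW : ∀ p : ℤ, -(n : ℤ) ≤ p → p ≤ n + 1 → itZ T p x ∈ 𝔅.B → wd y p M = 𝔅.W := by
    intro p hp1 hp2 hp
    ext1 j
    obtain ⟨h, e⟩ := 𝔅.enc_zero (𝔅.v (itZ T p x)) (nm T P n (itZ T p x)) j
    rw [← e, ← hcode p hp1 hp2 hp]
    simp [wd]
  have hfill : ∀ i : Fin m, y (-(d : ℕ) + ℓ + g + i) = 𝔅.v (itZ T (-(d : ℕ)) x) i := by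
    intro i
    refine hy _ ?_ _ ?_
    · rw [abs_le]; constructor <;> omega
    · rw [show (-(d : ℕ) + ℓ + g + i : ℤ) = -(d : ℕ) + (ℓ + g + i : ℕ) by push_cast; ring,
        𝔅.code_at_marker h2 (by omega), 𝔅.letter_fill]
  refine ⟨⟨by omega, by omega, hW _ (by omega) (by omega) h2, ?_, ?_, ?_⟩, ?_, ?_⟩
  · rcases h5 with h | h
    · exact Or.inl (hW _ (by omega) (by omega) h)
    · exact Or.inr (hW _ (by omega) (by omega) h)
  · intro i hi1 hi2 hi
    refine 𝔅.enc_not (𝔅.v (itZ T (-(d : ℕ)) x)) (nm T P n (itZ T (-(d : ℕ)) x)) (i + d).toNat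
      (by omega) fun j => ⟨by omega, ?_⟩
    rw [← hcode _ (by omega) (by omega) h2, ← hi]
    simp only [wd]
    congr 1; omega
  · intro i hi1 hi2 hi
    refine h4 (i + d - ℓ - g).toNat fun j => ⟨by omega, ?_⟩
    rw [← hfill, ← hi]
    simp only [wd]
    congr 1; omega
  · ext1 i; exact hcode _ (by omega) (by omega) h2 i
  · ext1 i; exact hfill i

lemma eq_of_ext {r : ℕ} (hr : 2 * n + 1 ≤ r) {x x' : X} (hx : x ∈ 𝔅.Good) (hx' : x' ∈ 𝔅.Good)
    {y : ℤ → Fin k} (hy : Extends T 𝔅.code r x y) (hy' : Extends T 𝔅.code r x' y) : P x = P x' := by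
  obtain ⟨d, h1, h2, h3, h4, h5⟩ := hx
  obtain ⟨d', h1', h2', h3', h4', h5'⟩ := hx'
  obtain ⟨f1, f2, f3⟩ := 𝔅.frame_of_good hr h1 h2 h4 h5 hy
  obtain ⟨f1', f2', f3'⟩ := 𝔅.frame_of_good hr h1' h2' h4' h5' hy'
  have hn := 𝔅.n_eq
  have hm := 𝔅.m_pos
  have hd := Frame.unique f1 f1' (by omega) 𝔅.geom
  obtain rfl : d = d' := by omega
  have hname := 𝔅.enc_inj _ h3 _ h3' (f3.symm.trans f3') (f2.symm.trans f2')
  have := congrFun hname ⟨d, by omega⟩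
  simpa [nm, ← itZ_natCast, ← itZ_add, itZ_zero] using this

lemma exists_target {r : ℕ} (hr : 2 * n + 1 ≤ r) {x : X} (hx : x ∈ 𝔅.Good)
    {y : ℤ → Fin k} (hy : Extends T 𝔅.code r x y) : ∃ i : ℤ, ∀ t : ℤ, |t| ≤ w → y (i + t) = z t :=
        by
  obtain ⟨d, h1, h2, h3, h4, h5⟩ := hx
  obtain ⟨f1, f2, f3⟩ := 𝔅.frame_of_good hr h1 h2 h4 h5 hy
  obtain ⟨i, hi⟩ := 𝔅.enc_target (𝔅.v (itZ T (-(d : ℕ)) x)) (nm T P n (itZ T (-(d : ℕ)) x))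
  refine ⟨-(d : ℕ) + i + w, fun t ht => ?_⟩
  rw [abs_le] at ht
  obtain ⟨h, e⟩ := hi ⟨(t + w).toNat, by omega⟩
  rw [← f2] at e
  simp only [wd] at e
  convert e using 2 <;> omega

lemma measure_good_compl_le (hT : MeasurePreserving T μ μ) :
    μ 𝔅.Goodᶜ ≤ (g + M + 1 : ℕ) * μ 𝔅.B + n * μ (𝔅.B ∩ 𝔅.Typᶜ) +
      n * μ (𝔅.B ∩ {x | ∃ i, Occ (𝔅.v x) 𝔅.W i}) := by
  have hn := 𝔅.n_eq
  have hℓ := 𝔅.ℓ_pos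
  have h1 : ∀ᵐ x ∂μ, x ∈ 𝔅.Goodᶜ →
      x ∈ {x | ∃ d ∈ Finset.Icc (n - g - M) n, itZ T (-(d : ℕ)) x ∈ 𝔅.B} ∪
      {x | ∃ d ∈ Finset.range n, itZ T (-(d : ℕ)) x ∈ 𝔅.B ∩ 𝔅.Typᶜ} ∪
      {x | ∃ d ∈ Finset.range n, itZ T (-(d : ℕ)) x ∈ 𝔅.B ∩ {x | ∃ i, Occ (𝔅.v x) 𝔅.W i}} := by
    filter_upwards [ae_itZ hT 𝔅.back] with x hx hbad
    by_contra hcon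
    simp only [Set.mem_union, Set.mem_ofPred_eq, not_or, not_exists, not_and, Finset.mem_Icc,
      Finset.mem_range, Set.mem_inter_iff, Set.mem_compl_iff, not_not] at hcon
    obtain ⟨⟨c1, c2⟩, c3⟩ := hcon
    obtain ⟨d, hd, hB⟩ := hx 0
    rw [itZ_zero] at hB
    have hdn : d < n - g - M := by
      by_contra h
      exact c1 d ⟨by omega, hd⟩ hB
    refine hbad ⟨d, by omega, hB, c2 d (by omega) hB, c3 d (by omega) hB, ?_⟩
    refine next_marker (O := fun i => itZ T i x ∈ 𝔅.B) ?_ ?_ hB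
    · intro p hp i h1 h2
      rw [add_comm, itZ_add]
      exact 𝔅.sep _ hp i h1 h2
    · intro i
      obtain ⟨d, hd, h⟩ := hx i
      refine ⟨d, hd, ?_⟩
      rwa [sub_eq_add_neg, add_comm, itZ_add]
  refine (measure_mono_ae h1).trans ((measure_union_le _ _).trans (add_le_add
    ((measure_union_le _ _).trans (add_le_add ?_ ?_)) ?_))
  · refine (measure_exists_mem_le hT _ _).trans ?_
    gcongr
    rw [Nat.card_Icc]; omega
  · refine (measure_exists_mem_le hT _ _).trans ?_
    rw [Finset.card_range]
  · refine (measure_exists_mem_le hT _ _).trans ?_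
    rw [Finset.card_range]

lemma measure_code_eq_none_le (hT : MeasurePreserving T μ μ) :
    μ {x | 𝔅.code x = none} ≤ (2 * g + 1 : ℕ) * μ 𝔅.B := by
  classical
  have hn := 𝔅.n_eq
  set I := Finset.Ico ℓ (ℓ + g) ∪ Finset.Icc (ℓ + g + m) n with hI
  have h1 : ∀ᵐ x ∂μ, x ∈ {x | 𝔅.code x = none} →
      x ∈ {x | ∃ d ∈ I, itZ T (-(d : ℕ)) x ∈ 𝔅.B} := by
    filter_upwards [𝔅.back] with x hx hnone
    obtain ⟨d, hd, hB⟩ := hx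
    refine ⟨d, ?_, hB⟩
    rcases hd.lt_or_eq with hlt | rfl
    · have h := 𝔅.code_at_marker hB hlt
      rw [show -(d : ℕ) + (d : ℤ) = 0 by omega, itZ_zero, show 𝔅.code x = none from hnone] at h
      unfold letter at h
      rw [hI, Finset.mem_union, Finset.mem_Ico, Finset.mem_Icc]
      split_ifs at h with h3 h4
      omega
    · rw [hI, Finset.mem_union, Finset.mem_Icc]; right; omega
  refine (measure_mono_ae h1).trans ((measure_exists_mem_le hT _ _).trans ?_)
  gcongr
  refine (Finset.card_union_le _ _).trans ?_
  rw [Nat.card_Icc, Nat.card_Ico]; omega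

lemma measure_change_le (hT : MeasurePreserving T μ μ) {f : X → Option (Fin k)} (r : ℕ)
    (hf : ∀ x ∈ 𝔅.Typ, ∀ (i : Fin m) a, f (itZ T (ℓ + g + i : ℕ) x) = some a → 𝔅.v x i = a) :
    μ {x | ¬ ∀ i : ℤ, |i| ≤ r → ∀ a, f (itZ T i x) = some a → 𝔅.code (itZ T i x) = some a} ≤
      (ℓ + 2 * g + 2 * r + 1 : ℕ) * μ 𝔅.B + n * μ (𝔅.B ∩ 𝔅.Typᶜ) := by
  classical
  have hn := 𝔅.n_eq
  set I := Finset.range (ℓ + g + r) ∪ Finset.Icc (n - (g + r)) n with hI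
  have h1 : ∀ᵐ x ∂μ, x ∈ {x | ¬ ∀ i : ℤ, |i| ≤ r → ∀ a, f (itZ T i x) = some a →
        𝔅.code (itZ T i x) = some a} →
      x ∈ {x | ∃ d ∈ I, itZ T (-(d : ℕ)) x ∈ 𝔅.B} ∪
        {x | ∃ d ∈ Finset.range n, itZ T (-(d : ℕ)) x ∈ 𝔅.B ∩ 𝔅.Typᶜ} := by
    filter_upwards [𝔅.back] with x hx hbad
    obtain ⟨d, hd, hB⟩ := hx
    by_cases hdI : d ∈ I
    · exact Or.inl ⟨d, hdI, hB⟩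
    rw [hI, Finset.mem_union, Finset.mem_range, Finset.mem_Icc] at hdI
    push Not at hdI
    refine Or.inr ⟨d, Finset.mem_range.2 (by omega), hB, fun hTyp => hbad fun i hi a hia => ?_⟩
    rw [abs_le] at hi
    have e : itZ T i x = itZ T (-(d : ℕ) + (i + d).toNat) x := by congr 1; omega
    have hidx : ((i + d).toNat : ℕ) = ℓ + g + ((i + d).toNat - (ℓ + g)) := by omega
    rw [e, 𝔅.code_at_marker hB (by omega), hidx]
    have := 𝔅.letter_fill ⟨(i + d).toNat - (ℓ + g), by omega⟩ (itZ T (-(d : ℕ)) x)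
    simp only at this
    rw [this]
    congr 1
    refine hf _ hTyp _ a ?_
    simp only
    rw [← hidx, ← itZ_add, ← hia]
    congr 2; omega
  refine (measure_mono_ae h1).trans ((measure_union_le _ _).trans (add_le_add ?_ ?_))
  · refine (measure_exists_mem_le hT _ _).trans ?_
    gcongr
    refine (Finset.card_union_le _ _).trans ?_
    rw [Nat.card_Icc, Finset.card_range]; omega
  · refine (measure_exists_mem_le hT _ _).trans ?_
    rw [Finset.card_range]

end BlockCoding

end Coding

section StepPreparation

open Classical in
lemma card_names_le {q q' ℓ g m n : ℕ} (hn : n = ℓ + g + m + g) (S₁ : Finset (Fin ℓ → Fin q'))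
    (S₂ : (Fin m → Fin q) → Finset (Fin m → Fin q')) (R : Finset (Fin m → Fin q))
    (π : Fin q' → Fin q) {K : ℝ} (hK : ∀ u, ((S₂ u).card : ℝ) ≤ K) :
    (((Finset.univ : Finset (Fin n → Fin q')).filter fun u => subw u 0 ℓ (by omega) ∈ S₁ ∧
      (fun i => π (subw u (ℓ + g) m (by omega) i)) ∈ R ∧ subw u (ℓ + g) m (by omega) ∈
        S₂ (fun i => π (subw u (ℓ + g) m (by omega) i))).card : ℝ) ≤
      S₁.card * q' ^ (2 * g) * (R.card * K) := by
  set N := (Finset.univ : Finset (Fin n → Fin q')).filter fun u => subw u 0 ℓ (by omega) ∈ S₁ ∧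
      (fun i => π (subw u (ℓ + g) m (by omega) i)) ∈ R ∧ subw u (ℓ + g) m (by omega) ∈
        S₂ (fun i => π (subw u (ℓ + g) m (by omega) i)) with hN
  have h1 : N.card ≤ (S₁ ×ˢ (((Finset.univ : Finset (Fin g → Fin q')) ×ˢ
      (Finset.univ : Finset (Fin g → Fin q'))) ×ˢ R.biUnion S₂)).card := by
    refine Finset.card_le_card_of_injOn (fun u => (subw u 0 ℓ (by omega),
      ((subw u ℓ g (by omega), subw u (ℓ + g + m) g (by omega)),
          subw u (ℓ + g) m (by omega)))) ?_ ?_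
    · intro u hu
      obtain ⟨-, a, b, c⟩ := Finset.mem_filter.1 (Finset.mem_coe.1 hu)
      refine Finset.mem_coe.2 (Finset.mem_product.2 ⟨a, Finset.mem_product.2 ⟨by simp, ?_⟩⟩)
      exact Finset.mem_biUnion.2 ⟨_, b, c⟩
    · intro u _ u' _ h
      simp only [Prod.mk.injEq] at h
      obtain ⟨e1, ⟨e2, e3⟩, e4⟩ := h
      ext1 ⟨j, hj⟩
      by_cases j1 : j < ℓ
      · exact subw_eq e1 j hj (by omega) (by omega)
      by_cases j2 : j < ℓ + g
      · exact subw_eq e2 j hj (by omega) (by omega)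
      by_cases j3 : j < ℓ + g + m
      · exact subw_eq e4 j hj (by omega) (by omega)
      · exact subw_eq e3 j hj (by omega) (by omega)
  have h2 : ((R.biUnion S₂).card : ℝ) ≤ R.card * K := by
    calc ((R.biUnion S₂).card : ℝ) ≤ ∑ u ∈ R, ((S₂ u).card : ℝ) := by
          exact_mod_cast Finset.card_biUnion_le
      _ ≤ ∑ u ∈ R, K := Finset.sum_le_sum fun u _ => hK u
      _ = _ := by simp
  calc (N.card : ℝ) ≤ S₁.card * q' ^ (2 * g) * (R.biUnion S₂).card := by
        have h3 : N.card ≤ S₁.card * q' ^ (2 * g) * (R.biUnion S₂).card := by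
          refine h1.trans (le_of_eq ?_)
          simp only [Finset.card_product, Finset.card_univ, Fintype.card_fun, Fintype.card_fin]
          ring
        exact_mod_cast h3
    _ ≤ _ := by gcongr

set_option maxHeartbeats 1000000 in
lemma eventually_params {L : ℕ → ℕ} (hLlim : Tendsto (fun m : ℕ => (L m : ℝ) / m) atTop (nhds 0))
    {α ρ τ : ℝ} (hα0 : 0 < α) (hα1 : α < 1) (hρ : 0 < ρ) (hρα : 4 * ρ ≤ α)
    (hρ2 : 4 * ρ ≤ |2 * α - 1|) (hα2 : α ≠ 1 / 2) (hτ : 0 < τ) (hρτ : 4 * ρ ≤ τ)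
    {H Q θ E Λ b Γ : ℝ} (hH : 0 ≤ H) (hQ : 0 ≤ Q) (hθ : 0 ≤ θ) (hΛ : 0 ≤ Λ) (hb : 0 ≤ b)
    (hΓ : α * H + θ * E + Λ + (1 - α) * b < Γ) (r : ℕ) :
    ∀ᶠ n : ℕ in atTop, 0 < n ∧ 0 < ⌊α * n⌋₊ ∧ 0 < ⌊ρ * n⌋₊ ∧ ⌊ρ * n⌋₊ ≤ n ∧
      ⌊α * n⌋₊ + 2 * L n < n ∧
      (n + 2 * ⌊ρ * n⌋₊ ≤ 2 * ⌊α * n⌋₊ ∨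
        (2 * ⌊α * n⌋₊ + 2 * L n ≤ n ∧ 2 * ⌊ρ * n⌋₊ + L n + 1 ≤ ⌊α * n⌋₊)) ∧
      ((L n : ℝ) + ⌊ρ * n⌋₊ + 2) / n ≤ τ / 2 ∧ (2 * (L n : ℝ) + 1) / n ≤ τ ∧
      ((⌊α * n⌋₊ : ℝ) + 2 * L n + 2 * r + 1) / n ≤ α + τ / 2 ∧
      ⌊α * n⌋₊ * H + 2 * L n * Q + θ * (E * n + 2 * r) + (n - ⌊α * n⌋₊ : ℝ) * (Λ + b) ≤ n * Γ := by
  have habs : 0 < |2 * α - 1| := abs_pos.2 (by intro h; apply hα2; linarith)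
  obtain ⟨x, hx0, hx1, hx2, hx3, hx4, hx5⟩ : ∃ x : ℝ, 0 < x ∧ 16 * x ≤ τ ∧ 16 * x ≤ α ∧
      16 * x ≤ |2 * α - 1| ∧ 16 * x ≤ 1 - α ∧
      x * (2 * Q + θ + Λ + b) ≤ Γ - (α * H + θ * E + Λ + (1 - α) * b) := by
    have hp : 0 < 2 * Q + θ + Λ + b + 1 := by positivity
    have hs : 0 < Γ - (α * H + θ * E + Λ + (1 - α) * b) := by linarith
    have h1α : 0 < 1 - α := by linarith
    refine ⟨min (τ / 16) (min (α / 16) (min (|2 * α - 1| / 16) (min ((1 - α) / 16)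
      ((Γ - (α * H + θ * E + Λ + (1 - α) * b)) / (2 * Q + θ + Λ + b + 1))))), ?_⟩
    set x := min (τ / 16) (min (α / 16) (min (|2 * α - 1| / 16) (min ((1 - α) / 16)
      ((Γ - (α * H + θ * E + Λ + (1 - α) * b)) / (2 * Q + θ + Λ + b + 1))))) with hx
    have hx0 : 0 < x := by positivity
    have a := le_min_iff.1 (le_of_eq hx)
    have a2 := le_min_iff.1 a.2
    have a3 := le_min_iff.1 a2.2
    have a4 := le_min_iff.1 a3.2
    have a5 := (le_div_iff₀ hp).1 a4.2
    refine ⟨hx0, by linarith, by linarith, by linarith, by linarith, by nlinarith⟩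
  have hbig : ∀ K : ℝ, ∀ᶠ n : ℕ in atTop, K ≤ x * n := fun K =>
    (tendsto_natCast_atTop_atTop.const_mul_atTop hx0).eventually_ge_atTop K
  have hbigρ : ∀ᶠ n : ℕ in atTop, 1 ≤ ρ * (n : ℝ) :=
    (tendsto_natCast_atTop_atTop.const_mul_atTop hρ).eventually_ge_atTop 1
  filter_upwards [hbig (2 * r + 4), hbigρ, hLlim.eventually (gt_mem_nhds hx0),
      eventually_gt_atTop 0]
    with n h1 h2 h3 hn0
  have hn : (0 : ℝ) < n := by exact_mod_cast hn0
  rw [div_lt_iff₀ hn] at h3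
  have hr : (0 : ℝ) ≤ r := Nat.cast_nonneg _
  set ℓ := ⌊α * n⌋₊ with hℓ
  set M := ⌊ρ * n⌋₊ with hM
  set g := L n with hg
  have hℓ1 : (ℓ : ℝ) ≤ α * n := Nat.floor_le (by positivity)
  have hℓ2 : α * n < ℓ + 1 := Nat.lt_floor_add_one _
  have hM1 : (M : ℝ) ≤ ρ * n := Nat.floor_le (by positivity)
  have e1 : 16 * x * n ≤ τ * n := by gcongr
  have e2 : 16 * x * n ≤ α * n := by gcongr
  have e3 : 16 * x * n ≤ |2 * α - 1| * n := by gcongr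
  have e4 : 16 * x * n ≤ (1 - α) * n := by gcongr
  have e5 : x * (2 * Q + θ + Λ + b) * n ≤ (Γ - (α * H + θ * E + Λ + (1 - α) * b)) * n := by gcongr
  have e6 : 4 * ρ * n ≤ α * n := by gcongr
  have e7 : 4 * ρ * n ≤ |2 * α - 1| * n := by gcongr
  have e8 : 4 * ρ * n ≤ τ * n := by gcongr
  refine ⟨hn0, ?_, Nat.floor_pos.2 h2, ?_, ?_, ?_, ?_, ?_, ?_, ?_⟩
  · have : (0 : ℝ) < ℓ := by linarith
    exact_mod_cast this
  · have : (M : ℝ) ≤ n := by linarith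
    exact_mod_cast this
  · have : (ℓ : ℝ) + 2 * g < n := by linarith
    exact_mod_cast this
  · rcases lt_or_gt_of_ne hα2 with h | h
    · right
      rw [abs_of_neg (by linarith)] at e3 e7
      constructor
      · have : (2 : ℝ) * ℓ + 2 * g ≤ n := by linarith
        exact_mod_cast this
      · have : (2 : ℝ) * M + g + 1 ≤ ℓ := by linarith
        exact_mod_cast this
    · left
      rw [abs_of_pos (by linarith)] at e3 e7
      have : (n : ℝ) + 2 * M ≤ 2 * ℓ := by linarith
      exact_mod_cast this
  · rw [div_le_iff₀ hn]; linarith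
  · rw [div_le_iff₀ hn]; linarith
  · rw [div_le_iff₀ hn]; linarith
  · have f1 : ℓ * H ≤ α * n * H := by gcongr
    have f2 : 2 * g * Q ≤ 2 * (x * n) * Q := by gcongr
    have f3 : θ * (2 * r) ≤ θ * (x * n) := by
      refine mul_le_mul_of_nonneg_left ?_ hθ
      linarith
    have f4 : (n - ℓ : ℝ) * (Λ + b) ≤ (n - α * n + 1) * (Λ + b) := by
      refine mul_le_mul_of_nonneg_right ?_ (by positivity)
      linarith
    have f5 : (1 : ℝ) * (Λ + b) ≤ x * n * (Λ + b) := by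
      refine mul_le_mul_of_nonneg_right ?_ (by positivity)
      linarith
    have f6 : 0 ≤ α * n * Λ := by positivity
    linarith

variable {X : Type*} [MeasurableSpace X] {μ : Measure X} [IsProbabilityMeasure μ]

lemma eventually_typical {T : X ≃ᵐ X} (hT : Ergodic T μ) {q q' : ℕ} {P : X → Fin q} {P' : X →
    Fin q'}
    (hP' : Measurable P') {π : Fin q' → Fin q} (hπ : ∀ x, P x = π (P' x)) {G : Set X}
    (hG : MeasurableSet G) {h δ ε : ℝ} (hh : entropyWrt μ T P' ≤ h) (hδ : 0 < δ)
    (hε : μ.real Gᶜ ≤ ε) {η : ℝ≥0∞} (hη : 0 < η) {ℓ m : ℕ → ℕ} (o : ℕ → ℕ)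
    (hℓ : Tendsto ℓ atTop atTop) (hm : Tendsto m atTop atTop) :
    ∀ᶠ n in atTop, ∃ (S₁ : Finset (Fin (ℓ n) → Fin q'))
      (S₂ : (Fin (m n) → Fin q) → Finset (Fin (m n) → Fin q')),
      (S₁.card : ℝ) ≤ Real.exp (ℓ n * (h + δ)) ∧
      (∀ u, ((S₂ u).card : ℝ) ≤ Real.exp (m n * (h - entropyWrt μ T P + δ))) ∧
      μ {x | ¬ (nm T P' (ℓ n) x ∈ S₁ ∧ nm T P' (m n) (itZ T (o n : ℕ) x) ∈
          S₂ (nm T P (m n) (itZ T (o n : ℕ) x)) ∧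
        ∑ i ∈ Finset.range n, Gᶜ.indicator (fun _ => (1 : ℝ)) (T^[i] x) ≤ (ε + δ) * n)} ≤ 3 * η :=
            by
  have h1 := hℓ.eventually (exists_conditional_code (q := 1) (P := fun _ => 0) (π := fun _ => 0)
    hT hP' (fun _ => rfl) hh hδ hη)
  have h2 := hm.eventually (exists_conditional_code hT hP' hπ hh hδ hη)
  have h3 := Ergodic.tendsto_measure_birkhoffSum_gt hT (φ := Gᶜ.indicator (fun _ => (1 : ℝ)))
    (measurable_const.indicator hG.compl) (C := 1) (by
      intro x
      by_cases hx : x ∈ Gᶜ <;> simp [hx]) hδ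
  have h3' := h3.eventually (gt_mem_nhds hη)
  have h_integral : ∫ y, Gᶜ.indicator (fun _ => (1 : ℝ)) y ∂μ = μ.real Gᶜ := by
    rw [integral_indicator hG.compl]; simp
  filter_upwards [h1, h2, h3'] with n ⟨S₁, a1, a2⟩ ⟨S₂, b1, b2⟩ c1
  refine ⟨S₁ (fun _ => 0), S₂, (a1 _).trans ?_, b1, ?_⟩
  · have : 0 ≤ entropyWrt μ T (fun _ : X => (0 : Fin 1)) :=
      entropyWrt_nonneg T.measurable measurable_const
    gcongr
    linarith
  · have hsub : {x | ¬ (nm T P' (ℓ n) x ∈ S₁ (fun _ => 0) ∧ nm T P' (m n) (itZ T (o n : ℕ) x) ∈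
          S₂ (nm T P (m n) (itZ T (o n : ℕ) x)) ∧
        ∑ i ∈ Finset.range n, Gᶜ.indicator (fun _ => (1 : ℝ)) (T^[i] x) ≤ (ε + δ) * n)} ⊆
        {x | nm T P' (ℓ n) x ∉ S₁ (nm T (fun _ => 0) (ℓ n) x)} ∪
        (itZ T (o n : ℕ) ⁻¹' {x | nm T P' (m n) x ∉ S₂ (nm T P (m n) x)} ∪
        {x | n * (∫ y, Gᶜ.indicator (fun _ => (1 : ℝ)) y ∂μ + δ) <
          ∑ i ∈ Finset.range n, Gᶜ.indicator (fun _ => (1 : ℝ)) (T^[i] x)}) := by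
      intro x hx
      by_contra hcon
      simp only [Set.mem_union, not_or, Set.mem_ofPred_eq, Set.mem_preimage, not_not,
          not_lt] at hcon
      refine hx ⟨hcon.1, hcon.2.1, hcon.2.2.trans ?_⟩
      rw [h_integral, mul_comm]
      gcongr
    refine (measure_mono hsub).trans ((measure_union_le _ _).trans ?_)
    rw [show (3 : ℝ≥0∞) * η = η + (η + η) by ring]
    refine add_le_add a2 ((measure_union_le _ _).trans (add_le_add ?_ c1.le))
    rw [measure_preimage_itZ hT.toMeasurePreserving]
    exact b2

end StepPreparation

section Decoding

/-- Apply a function of bi-infinite sequences along a finite word. -/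
def slide {A B : Type*} {m : ℕ} (D : (ℤ → A) → B) (a₀ : A) (v : Fin m → A) (i : Fin m) : B :=
  D fun j => if h : 0 ≤ i + j ∧ i + j < m then v ⟨(i + j).toNat, by omega⟩ else a₀

variable {X : Type*} [MeasurableSpace X]

lemma slide_eq {T : X ≃ᵐ X} {k q : ℕ} {P : X → Fin q} {f : X → Option (Fin k)} {G : Set X}
    {r : ℕ} {D : (ℤ → Fin k) → Fin q} (hD : ∀ x ∈ G, ∀ y, Extends T f r x y → D y = P x)
    (a₀ : Fin k) {o m : ℕ} {x : X} {v : Fin m → Fin k}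
    (hv : ∀ (i : Fin m) a, f (itZ T (o + i : ℕ) x) = some a → v i = a) {i : Fin m}
    (h1 : r ≤ i) (h2 : i + r < m) (hG : itZ T (o + i : ℕ) x ∈ G) :
    slide D a₀ v i = P (itZ T (o + i : ℕ) x) := by
  refine hD _ hG _ fun j hj a ha => ?_
  rw [abs_le] at hj
  rw [dif_pos (by omega)]
  refine hv _ a ?_
  rw [← ha, ← itZ_add]
  congr 2
  push_cast
  omega

open Classical in
lemma card_slide_ne_le {T : X ≃ᵐ X} {k q : ℕ} {P : X → Fin q} {f : X → Option (Fin k)} {G : Set X}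
    {r : ℕ} {D : (ℤ → Fin k) → Fin q} (hD : ∀ x ∈ G, ∀ y, Extends T f r x y → D y = P x)
    (a₀ : Fin k) {o m n : ℕ} (hn : o + m ≤ n) {x : X} {v : Fin m → Fin k}
    (hv : ∀ (i : Fin m) a, f (itZ T (o + i : ℕ) x) = some a → v i = a) :
    ((Finset.univ.filter fun i => nm T P m (itZ T (o : ℕ) x) i ≠ slide D a₀ v i).card : ℝ) ≤
      ∑ i ∈ Finset.range n, Gᶜ.indicator (fun _ => (1 : ℝ)) (T^[i] x) + 2 * r := by
  have hnm : ∀ i : Fin m, nm T P m (itZ T (o : ℕ) x) i = P (itZ T (o + i : ℕ) x) := by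
    intro i
    rw [Nat.cast_add, add_comm, itZ_add, itZ_natCast T i]; rfl
  have hsub : (Finset.univ.filter fun i => nm T P m (itZ T (o : ℕ) x) i ≠ slide D a₀ v i) ⊆
      (Finset.univ.filter fun i : Fin m => itZ T (o + i : ℕ) x ∉ G) ∪
      ((Finset.univ.filter fun i : Fin m => (i : ℕ) < r) ∪
        (Finset.univ.filter fun i : Fin m => m ≤ i + r)) := by
    intro i hi
    simp only [Finset.mem_filter, Finset.mem_univ, true_and, Finset.mem_union] at hi ⊢
    by_contra hcon
    push Not at hcon
    exact hi ((hnm i).trans (slide_eq hD a₀ hv hcon.2.1 hcon.2.2 hcon.1).symm)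
  have h1 : (Finset.univ.filter fun i : Fin m => itZ T (o + i : ℕ) x ∉ G).card ≤
      ((Finset.range n).filter fun i => T^[i] x ∈ Gᶜ).card := by
    refine Finset.card_le_card_of_injOn (fun i => o + i) ?_ ?_
    · intro i hi
      have := (Finset.mem_filter.1 (Finset.mem_coe.1 hi)).2
      refine Finset.mem_coe.2 (Finset.mem_filter.2 ⟨Finset.mem_range.2 (by dsimp only; omega), ?_⟩)
      rwa [itZ_natCast] at this
    · intro i _ j _ h
      ext; simpa using h
  have h2 : (Finset.univ.filter fun i : Fin m => (i : ℕ) < r).card ≤ r := by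
    conv_rhs => rw [← Finset.card_range r]
    refine Finset.card_le_card_of_injOn (fun i => i) ?_ ?_
    · intro i hi
      simpa using hi
    · intro i _ j _ h
      ext; simpa using h
  have h3 : (Finset.univ.filter fun i : Fin m => m ≤ i + r).card ≤ r := by
    conv_rhs => rw [← Finset.card_range r]
    refine Finset.card_le_card_of_injOn (fun i => m - 1 - i) ?_ ?_
    · intro i hi
      have := (Finset.mem_filter.1 (Finset.mem_coe.1 hi)).2
      exact Finset.mem_coe.2 (Finset.mem_range.2 (by dsimp only; omega))
    · intro i _ j _ h
      ext
      simp only at h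
      omega
  have h4 : ∑ i ∈ Finset.range n, Gᶜ.indicator (fun _ => (1 : ℝ)) (T^[i] x) =
      ((Finset.range n).filter fun i => T^[i] x ∈ Gᶜ).card := by
    rw [Finset.card_filter]
    push_cast
    refine Finset.sum_congr rfl fun i _ => ?_
    simp [Set.indicator_apply]
  rw [h4]
  have h5 := (Finset.card_le_card hsub).trans ((Finset.card_union_le _ _).trans
    (add_le_add h1 ((Finset.card_union_le _ _).trans (add_le_add h2 h3))))
  have h6 : ((Finset.univ.filter fun i => nm T P m (itZ T (o : ℕ) x) i ≠ slide D a₀ v i).card : ℝ) ≤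
    ((Finset.range n).filter fun i => T^[i] x ∈ Gᶜ).card + (r + r) := by exact_mod_cast h5
  linarith

lemma tendsto_block_lengths {L : ℕ → ℕ}
    (hLlim : Tendsto (fun m : ℕ => (L m : ℝ) / m) atTop (nhds 0)) {α : ℝ} (hα0 : 0 < α)
    (hα1 : α < 1) : Tendsto (fun n : ℕ => ⌊α * n⌋₊) atTop atTop ∧
      Tendsto (fun n : ℕ => n - ⌊α * n⌋₊ - 2 * L n) atTop atTop := by
  constructor
  · exact tendsto_nat_floor_atTop.comp (tendsto_natCast_atTop_atTop.const_mul_atTop hα0)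
  · rw [← tendsto_natCast_atTop_iff (R := ℝ)]
    have h1 : Tendsto (fun n : ℕ => (1 - α) / 2 * (n : ℝ)) atTop atTop :=
      tendsto_natCast_atTop_atTop.const_mul_atTop (by linarith)
    refine tendsto_atTop_mono' _ ?_ h1
    have hx : 0 < (1 - α) / 4 := by linarith
    filter_upwards [hLlim.eventually (gt_mem_nhds hx), eventually_gt_atTop 0] with n h2 hn
    have hn' : (0 : ℝ) < n := by exact_mod_cast hn
    rw [div_lt_iff₀ hn'] at h2
    have h3 : (⌊α * n⌋₊ : ℝ) ≤ α * n := Nat.floor_le (by positivity)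
    have h4 : (n : ℝ) ≤ ((n - ⌊α * n⌋₊ - 2 * L n : ℕ) : ℝ) + ⌊α * n⌋₊ + 2 * L n := by
      have : n ≤ (n - ⌊α * n⌋₊ - 2 * L n) + ⌊α * n⌋₊ + 2 * L n := by omega
      exact_mod_cast this
    linarith

end Decoding

section Construction

variable {X : Type*} [MeasurableSpace X] {μ : Measure X} [IsProbabilityMeasure μ]

lemma exists_fill_words {T : X ≃ᵐ X} {k : ℕ} {Xs : Set (ℤ → Fin k)} (hne : Xs.Nonempty)
    (hs : ShiftInv Xs) {f : X → Option (Fin k)} (hf : Measurable f) (o m : ℕ) :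
    ∃ v : X → Fin m → Fin k, Measurable v ∧ (∀ x, v x ∈ lang Xs m) ∧
      ∀ x, (∀ N : ℕ, ∃ z ∈ Xs, Extends T f N x z) →
        ∀ (i : Fin m) a, f (itZ T (o + i : ℕ) x) = some a → v x i = a := by
  obtain ⟨fill, h1, h2⟩ := exists_fill hne m
  refine ⟨fun x => fill fun i => f (itZ T (o + i : ℕ) x), ?_, fun x => h1 _, ?_⟩
  · have hm : Measurable fill := fun s _ => (Set.toFinite _).measurableSet
    exact hm.comp (measurable_pi_iff.2 fun i => hf.comp (measurable_itZ T _))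
  · intro x hx i a hia
    refine h2 _ ?_ i a hia
    obtain ⟨z, hz, he⟩ := hx (o + m)
    refine ⟨wd z o m, wd_mem_lang hs hz _ _, fun j b hj => ?_⟩
    have := he (o + j : ℕ) (by rw [abs_le]; constructor <;> omega) b hj
    rw [← this]
    simp [wd]

/-- The numerical slack of the construction can be distributed among the parameters. -/
lemma exists_slack {α c h e θ ε Λ lk τ : ℝ} (hα0 : 0 < α) (hα2 : α ≠ 1 / 2) (hθ : 0 ≤ θ)
    (hc0 : 0 < c) (hlk : 0 ≤ lk) (hτ : 0 < τ)
    (hnum : α * h + (1 - α) * (h - e) + θ * ε + Λ < α * c) :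
    ∃ δ κ ρ : ℝ, 0 < δ ∧ 0 < κ ∧ 0 < ρ ∧ 4 * ρ ≤ α ∧ 4 * ρ ≤ |2 * α - 1| ∧ 4 * ρ ≤ τ ∧ ρ < α ∧
      2 * ρ * (c + lk) ≤ κ ∧
      α * (h + δ) + θ * (ε + δ) + Λ + (1 - α) * (h - e + δ) < α * c - κ := by
  have hs : 0 < α * c - (α * h + (1 - α) * (h - e) + θ * ε + Λ) := by linarith
  set s := α * c - (α * h + (1 - α) * (h - e) + θ * ε + Λ) with hs'
  have habs : 0 < |2 * α - 1| := abs_pos.2 (by intro h; apply hα2; linarith)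
  have hδ : s / (4 * (1 + θ)) * (1 + θ) = s / 4 := by field_simp
  have hck : 0 < 2 * (c + lk) := by positivity
  obtain ⟨ρ, r0, r1, r2, r3, r4⟩ : ∃ ρ : ℝ, 0 < ρ ∧ ρ ≤ α / 4 ∧ ρ ≤ |2 * α - 1| / 4 ∧ ρ ≤ τ / 4 ∧
      ρ ≤ s / 4 / (2 * (c + lk)) :=
    ⟨min (α / 4) (min (|2 * α - 1| / 4) (min (τ / 4) (s / 4 / (2 * (c + lk))))), by positivity,
      min_le_left _ _, (min_le_right _ _).trans (min_le_left _ _),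
      (min_le_right _ _).trans ((min_le_right _ _).trans (min_le_left _ _)),
      (min_le_right _ _).trans ((min_le_right _ _).trans (min_le_right _ _))⟩
  rw [le_div_iff₀ hck] at r4
  refine ⟨s / (4 * (1 + θ)), s / 4, ρ, by positivity, by positivity, r0, by linarith, by linarith,
    by linarith, by linarith, by linarith, ?_⟩
  nlinarith

open Classical in
lemma card_codes_le {q q' ℓ g m n : ℕ} (hn : n = ℓ + g + m + g) (hq' : 0 < q')
    {S₁ : Finset (Fin ℓ → Fin q')} {S₂ : (Fin m → Fin q) → Finset (Fin m → Fin q')}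
    (π : Fin q' → Fin q) {H b θ t Γ : ℝ} (hθ : 0 ≤ θ) (h1 : (S₁.card : ℝ) ≤ Real.exp (ℓ * H))
    (h2 : ∀ u, ((S₂ u).card : ℝ) ≤ Real.exp (m * b)) (hb : 0 ≤ b)
    (hΓ : ℓ * H + 2 * g * Real.log q' + θ * t +
      (n - ℓ : ℝ) * (Real.log (1 + q * Real.exp (-θ)) + b) ≤ n * Γ) (R : Fin m → Fin q) :
    (((Finset.univ : Finset (Fin n → Fin q')).filter fun u => subw u 0 ℓ (by omega) ∈ S₁ ∧
      (fun i => π (subw u (ℓ + g) m (by omega) i)) ∈ ((Finset.univ : Finset (Fin m → Fin q)).filter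
        fun u => ((Finset.univ.filter fun i => u i ≠ R i).card : ℝ) ≤ t) ∧
      subw u (ℓ + g) m (by omega) ∈
        S₂ (fun i => π (subw u (ℓ + g) m (by omega) i))).card : ℝ) ≤ Real.exp (n * Γ) := by
  refine (card_names_le hn S₁ S₂ _ π h2).trans ?_
  have h3 := card_hamming_ball_le R hθ t
  have hq : (0 : ℝ) < q' := by exact_mod_cast hq'
  have hΛ : (0 : ℝ) < 1 + q * Real.exp (-θ) := by positivity
  have hΛ0 : 0 ≤ Real.log (1 + q * Real.exp (-θ)) := by
    refine Real.log_nonneg ?_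
    have : 0 ≤ (q : ℝ) * Real.exp (-θ) := by positivity
    linarith
  have e1 : (q' : ℝ) ^ (2 * g) = Real.exp (2 * g * Real.log q') := by
    rw [show 2 * (g : ℝ) * Real.log q' = (2 * g : ℕ) * Real.log q' by push_cast; ring,
      Real.exp_nat_mul, Real.exp_log hq]
  have e2 : (1 + q * Real.exp (-θ)) ^ m = Real.exp (m * Real.log (1 + q * Real.exp (-θ))) := by
    rw [Real.exp_nat_mul, Real.exp_log hΛ]
  calc _ ≤ Real.exp (ℓ * H) * Real.exp (2 * g * Real.log q') *
        (Real.exp (θ * t) * Real.exp (m * Real.log (1 + q * Real.exp (-θ))) * Real.exp (m * b)) :=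
            by
        rw [← e1, ← e2]
        gcongr
    _ = Real.exp (ℓ * H + 2 * g * Real.log q' +
        (θ * t + m * Real.log (1 + q * Real.exp (-θ)) + m * b)) := by
        simp only [Real.exp_add]
    _ ≤ _ := by
        refine Real.exp_le_exp.2 (le_trans ?_ hΓ)
        have h4 : (m : ℝ) * (Real.log (1 + q * Real.exp (-θ)) + b) ≤
            (n - ℓ : ℝ) * (Real.log (1 + q * Real.exp (-θ)) + b) := by
          refine mul_le_mul_of_nonneg_right ?_ (by positivity)
          rw [hn]; push_cast
          have : (0 : ℝ) ≤ g := Nat.cast_nonneg _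
          linarith
        linarith


lemma exists_blockCoding_of_typical [StandardBorelSpace X] (hna : NoAtoms μ) {T : X ≃ᵐ X}
    (hT : Ergodic T μ) {k : ℕ} {Xs : Set (ℤ → Fin k)} (hs : ShiftInv Xs) {L : ℕ → ℕ} {q q' : ℕ}
    (hq' : 0 < q') {P : X → Fin q} {P' : X → Fin q'} {π : Fin q' → Fin q} (hπ : ∀ x, P x = π (P' x))
    {f : X → Option (Fin k)} (hf : Measurable f) (hcons : Consistent μ T Xs f) {G : Set X}
    {r : ℕ} {D : (ℤ → Fin k) → Fin q}
    (hD : ∀ x ∈ G, ∀ y, Extends T f r x y → D y = P x) {H b E θ Γ : ℝ} (hθ : 0 ≤ θ) (hb : 0 ≤ b)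
    {z : ℤ → Fin k} (hz : z ∈ Xs) (w : ℕ) {η : ℝ≥0∞} {ℓ g m M n : ℕ} (hn : n = ℓ + g + m + g)
    (hℓ : 0 < ℓ) (hm : 0 < m) (hM : 0 < M) (hMn : M ≤ n) (hgap : L n ≤ g)
    (hgeom : n + 2 * M ≤ 2 * ℓ ∨ (2 * ℓ + 2 * g ≤ n ∧ 2 * M + g + 1 ≤ ℓ))
    (hΓ : ℓ * H + 2 * g * Real.log q' + θ * (E * n + 2 * r) +
      (n - ℓ : ℝ) * (Real.log (1 + q * Real.exp (-θ)) + b) ≤ n * Γ)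
    (hcode : ∀ Bad : Finset (Fin M → Fin k), Bad.card ≤ n ^ 2 →
      ∃ W ∉ Bad, ∃ C : Finset (Fin ℓ → Fin k), C ⊆ lang Xs ℓ ∧
      Real.exp (n * Γ) ≤ C.card ∧ ∀ x ∈ C, Occ x W 0 ∧ (∀ i, 0 < i → ¬ Occ x W i) ∧
        ∃ i, Occ x (wd z (-w) (2 * w + 1)) i)
    {S₁ : Finset (Fin ℓ → Fin q')} {S₂ : (Fin m → Fin q) → Finset (Fin m → Fin q')}
    (h1 : (S₁.card : ℝ) ≤ Real.exp (ℓ * H)) (h2 : ∀ u, ((S₂ u).card : ℝ) ≤ Real.exp (m * b))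
    (htyp : μ {x | ¬ (nm T P' ℓ x ∈ S₁ ∧ nm T P' m (itZ T (ℓ + g : ℕ) x) ∈
          S₂ (nm T P m (itZ T (ℓ + g : ℕ) x)) ∧
        ∑ i ∈ Finset.range n, Gᶜ.indicator (fun _ => (1 : ℝ)) (T^[i] x) ≤ E * n)} ≤ η) :
    ∃ 𝔅 : BlockCoding μ T Xs L P' ℓ g m M n w z, n * μ 𝔅.B ≤ 1 ∧
      n * μ (𝔅.B ∩ 𝔅.Typᶜ) ≤ η ∧
      n * μ (𝔅.B ∩ {x | ∃ i, Occ (𝔅.v x) 𝔅.W i}) ≤ (n : ℝ≥0∞)⁻¹ ∧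
      ∀ x ∈ 𝔅.Typ, ∀ (i : Fin m) a, f (itZ T (ℓ + g + i : ℕ) x) = some a → 𝔅.v x i = a := by
  classical
  have hn0 : 0 < n := by omega
  obtain ⟨v, v1, v2, v3⟩ := exists_fill_words (T := T) ⟨z, hz⟩ hs hf (ℓ + g) m
  set N := {x | ¬ (nm T P' ℓ x ∈ S₁ ∧ nm T P' m (itZ T (ℓ + g : ℕ) x) ∈
          S₂ (nm T P m (itZ T (ℓ + g : ℕ) x)) ∧
        ∑ i ∈ Finset.range n, Gᶜ.indicator (fun _ => (1 : ℝ)) (T^[i] x) ≤ E * n)} ∪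
      {x | ¬ ∀ N : ℕ, ∃ z ∈ Xs, Extends T f N x z} with hN
  have hNη : μ (toMeasurable μ N) ≤ η := by
    rw [measure_toMeasurable]
    refine (measure_union_le _ _).trans ?_
    rw [show μ {x | ¬ ∀ N : ℕ, ∃ z ∈ Xs, Extends T f N x z} = 0 from hcons, add_zero]
    exact htyp
  obtain ⟨B, B1, B2, B3, B4⟩ := exists_marker_avoiding hna hT hn0 (measurableSet_toMeasurable μ N)
  have hB1 := card_mul_measure_le_one hT.toMeasurePreserving B1 B2
  obtain ⟨W, hW, C, C1, C2, C3⟩ := hcode _ (card_frequent_words_le B1 hB1 v1 (by omega) hn0 hM)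
  have hCne : C.Nonempty := by
    rw [← Finset.card_pos]
    have : (0 : ℝ) < C.card := (Real.exp_pos _).trans_le C2
    exact_mod_cast this
  obtain ⟨enc, enc1, enc2⟩ := exists_encoding C hCne (fun u : Fin m → Fin k =>
    ((Finset.univ : Finset (Fin n → Fin q')).filter fun u' => subw u' 0 ℓ (by omega) ∈ S₁ ∧
      (fun i => π (subw u' (ℓ + g) m (by omega) i)) ∈ ((Finset.univ : Finset (Fin m → Fin q)).filter
        fun u'' => ((Finset.univ.filter fun i => u'' i ≠ slide D (z 0) u i).card : ℝ) ≤
          E * n + 2 * r) ∧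
      subw u' (ℓ + g) m (by omega) ∈ S₂ (fun i => π (subw u' (ℓ + g) m (by omega) i)))) (by
    intro u
    have := (card_codes_le hn hq' π hθ h1 h2 hb hΓ (slide D (z 0) u)).trans C2
    exact_mod_cast this)
  have hTyp : ∀ x ∈ (toMeasurable μ N)ᶜ, (∀ (i : Fin m) a, f (itZ T (ℓ + g + i : ℕ) x) = some a →
      v x i = a) ∧ nm T P' n x ∈
    ((Finset.univ : Finset (Fin n → Fin q')).filter fun u' => subw u' 0 ℓ (by omega) ∈ S₁ ∧
      (fun i => π (subw u' (ℓ + g) m (by omega) i)) ∈ ((Finset.univ : Finset (Fin m → Fin q)).filter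
        fun u'' => ((Finset.univ.filter fun i => u'' i ≠ slide D (z 0) (v x) i).card : ℝ) ≤
          E * n + 2 * r) ∧
      subw u' (ℓ + g) m (by omega) ∈ S₂ (fun i => π (subw u' (ℓ + g) m (by omega) i))) := by
    intro x hx
    have hx' : x ∉ N := fun h => hx (subset_toMeasurable μ N h)
    rw [hN, Set.mem_union, not_or] at hx'
    have hx1 := not_not.1 hx'.1
    have hv := v3 x (not_not.1 hx'.2)
    have e1 : subw (nm T P' n x) 0 ℓ (by omega) = nm T P' ℓ x := by
      ext1 i; simp [subw, nm]
    have e2 : subw (nm T P' n x) (ℓ + g) m (by omega) = nm T P' m (itZ T (ℓ + g : ℕ) x) := by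
      ext1 i
      simp only [subw, nm]
      rw [itZ_natCast, ← Function.iterate_add_apply, add_comm]
    have e3 : (fun i => π (subw (nm T P' n x) (ℓ + g) m (by omega) i)) =
        nm T P m (itZ T (ℓ + g : ℕ) x) := by
      rw [e2]; ext1 i; exact (hπ _).symm
    refine ⟨hv, Finset.mem_filter.2 ⟨Finset.mem_univ _, e1 ▸ hx1.1, ?_, ?_⟩⟩
    · rw [e3, Finset.mem_filter]
      refine ⟨Finset.mem_univ _, ?_⟩
      refine (card_slide_ne_le hD (z 0) (n := n) (by omega) hv).trans ?_
      have := hx1.2.2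
      linarith
    · rw [e3, e2]; exact hx1.2.1
  refine ⟨{
      B := B, Typ := (toMeasurable μ N)ᶜ, v := v, enc := enc, W := W, n_eq := hn, ℓ_pos := hℓ
      m_pos := hm, M_le := hMn, gap := hgap, geom := hgeom, measB := B1, measv := v1, sep := B2
      back := B3, v_mem := v2, enc_mem := fun u a => C1 (enc1 u a)
      enc_zero := fun u a => (C3 _ (enc1 u a)).1
      enc_not := fun u a => (C3 _ (enc1 u a)).2.1
      enc_target := fun u a => (C3 _ (enc1 u a)).2.2
      enc_inj := ?_ }, hB1, ?_, ?_,
    fun x hx => (hTyp x hx).1⟩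
  · intro x hx x' hx' hv he
    refine enc2 (v x) (hTyp x hx).2 ?_ ?_
    · rw [hv]; exact (hTyp x' hx').2
    · rw [he, hv]
  · rw [compl_compl]
    exact B4.trans hNη
  · simp only [Finset.mem_filter, Finset.mem_univ, true_and, not_lt] at hW
    calc (n : ℝ≥0∞) * μ (B ∩ {x | ∃ i, Occ (v x) W i}) ≤ n * ((n : ℝ≥0∞) ^ 2)⁻¹ := by gcongr
      _ = (n : ℝ≥0∞)⁻¹ := by
        have h0 : (n : ℝ≥0∞) ≠ 0 := by exact_mod_cast hn0.ne'
        rw [sq, ENNReal.mul_inv (Or.inl h0) (Or.inl (ENNReal.natCast_ne_top n)), ← mul_assoc,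
          ENNReal.mul_inv_cancel h0 (ENNReal.natCast_ne_top n), one_mul]

lemma exists_blockCoding [StandardBorelSpace X] (hna : NoAtoms μ) {T : X ≃ᵐ X} (hT : Ergodic T μ)
    {k : ℕ} {Xs : Set (ℤ → Fin k)} (hs : ShiftInv Xs) {L : ℕ → ℕ} (hLmono : Monotone L)
    (hLlim : Tendsto (fun m : ℕ => (L m : ℝ) / m) atTop (nhds 0)) (hgl : Glues Xs L) {c : ℝ}
    (hc0 : 0 < c) (hc : ∀ n : ℕ, Real.exp (c * n) ≤ (lang Xs n).card) {q q' : ℕ} {P : X → Fin q}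
    {P' : X → Fin q'} {π : Fin q' → Fin q} (hP' : Measurable P') (hπ : ∀ x, P x = π (P' x))
    {f : X → Option (Fin k)} (hf : Measurable f) (hcons : Consistent μ T Xs f) {G : Set X}
    (hG : MeasurableSet G) {r : ℕ} {D : (ℤ → Fin k) → Fin q}
    (hD : ∀ x ∈ G, ∀ y, Extends T f r x y → D y = P x) {h ε θ α : ℝ} (hh : entropyWrt μ T P' ≤ h)
    (hε : μ.real Gᶜ ≤ ε) (hα0 : 0 < α) (hα1 : α < 1) (hα2 : α ≠ 1 / 2) (hθ : 0 ≤ θ)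
    (hnum : α * h + (1 - α) * (h - entropyWrt μ T P) + θ * ε + Real.log (1 + q * Real.exp (-θ)) <
      α * c) {z : ℤ → Fin k} (hz : z ∈ Xs) (w : ℕ) {τ : ℝ} (hτ : 0 < τ) :
    ∃ (ℓ g m M n : ℕ) (𝔅 : BlockCoding μ T Xs L P' ℓ g m M n w z), 0 < n ∧ n * μ 𝔅.B ≤ 1 ∧
      n * μ (𝔅.B ∩ 𝔅.Typᶜ) ≤ ENNReal.ofReal (τ / 4) ∧
      n * μ (𝔅.B ∩ {x | ∃ i, Occ (𝔅.v x) 𝔅.W i}) ≤ (n : ℝ≥0∞)⁻¹ ∧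
      ((g : ℝ) + M + 2) / n ≤ τ / 2 ∧ (2 * (g : ℝ) + 1) / n ≤ τ ∧
      ((ℓ : ℝ) + 2 * g + 2 * r + 1) / n ≤ α + τ / 2 ∧
      ∀ x ∈ 𝔅.Typ, ∀ (i : Fin m) a, f (itZ T (ℓ + g + i : ℕ) x) = some a → 𝔅.v x i = a := by
  classical
  have hP : Measurable P := by
    have : P = π ∘ P' := funext hπ
    rw [this]
    exact (measurable_of_finite π).comp hP'
  have hX : Nonempty X := by
    by_contra hX
    rw [not_nonempty_iff] at hX
    have := measure_univ (μ := μ)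
    rw [Set.eq_empty_of_isEmpty (univ : Set X)] at this
    simp at this
  obtain ⟨x₀⟩ := hX
  have hq' : 0 < q' := (P' x₀).pos
  have hk : 0 < k := (z 0).pos
  have hh0 : 0 ≤ h := (entropyWrt_nonneg T.measurable hP').trans hh
  have hb0 : 0 ≤ h - entropyWrt μ T P := by
    linarith [entropyWrt_comp_le (μ := μ) T.measurable hP hP' hπ]
  have hΛ0 : 0 ≤ Real.log (1 + q * Real.exp (-θ)) := by
    refine Real.log_nonneg ?_
    have : 0 ≤ (q : ℝ) * Real.exp (-θ) := by positivity
    linarith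
  obtain ⟨δ, κ, ρ, hδ, hκ, hρ, hρ1, hρ2, hρ3, hρα, hρκ, hΓ⟩ :=
    exists_slack hα0 hα2 hθ hc0 (Real.log_natCast_nonneg k) hτ hnum
  have hη : 0 < ENNReal.ofReal (τ / 12) := by
    rw [ENNReal.ofReal_pos]; positivity
  have ev1 := eventually_params hLlim hα0 hα1 hρ hρ1 hρ2 hα2 hτ hρ3 (by positivity)
    (Real.log_natCast_nonneg q') hθ hΛ0 (by positivity) hΓ r
  have ev2 := exists_codebook hs hLmono hLlim hgl hc0 hc hz w hα1.le hκ hρ hρα hρκ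
  obtain ⟨hl1, hl2⟩ := tendsto_block_lengths hLlim hα0 hα1
  have ev3 := eventually_typical hT hP' hπ hG hh hδ hε hη (fun n => ⌊α * n⌋₊ + L n) hl1 hl2
  obtain ⟨n, ⟨hn, hℓ, hM, hMn, hmn, hgeom, d1, d2, d3, d4⟩, hcode, S₁, S₂, s1, s2, s3⟩ :=
    (ev1.and (ev2.and ev3)).exists
  obtain ⟨𝔅, b1, b2, b3, b4⟩ := exists_blockCoding_of_typical hna hT hs hq' hπ hf hcons hD hθ
    (by positivity) hz w (g := L n) (m := n - ⌊α * n⌋₊ - 2 * L n) (by omega) hℓ (by omega) hM hMn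
    le_rfl hgeom d4 hcode s1 s2 s3
  refine ⟨_, _, _, _, n, 𝔅, hn, b1, b2.trans (le_of_eq ?_), b3, d1, d2, d3, b4⟩
  rw [← ENNReal.ofReal_ofNat, ← ENNReal.ofReal_mul (by norm_num)]
  congr 1; ring

end Construction

section Step

variable {X : Type*} [MeasurableSpace X] {μ : Measure X} [IsProbabilityMeasure μ]

lemma natCast_mul_le_ofReal {n : ℕ} (hn : 0 < n) {b : ℝ≥0∞} (hb : n * b ≤ 1) {K : ℕ} {t : ℝ}
    (ht : (K : ℝ) / n ≤ t) : K * b ≤ ENNReal.ofReal t := by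
  have h0 : (n : ℝ≥0∞) ≠ 0 := by exact_mod_cast hn.ne'
  have hb' : b ≤ (n : ℝ≥0∞)⁻¹ := by
    rw [← one_div, ENNReal.le_div_iff_mul_le (Or.inl h0) (Or.inl (ENNReal.natCast_ne_top n)),
      mul_comm]
    exact hb
  calc K * b ≤ K * (n : ℝ≥0∞)⁻¹ := by gcongr
    _ = ENNReal.ofReal ((K : ℝ) / n) := by
      rw [ENNReal.ofReal_div_of_pos (by exact_mod_cast hn), ENNReal.ofReal_natCast,
        ENNReal.ofReal_natCast, div_eq_mul_inv]
    _ ≤ _ := ENNReal.ofReal_le_ofReal ht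

lemma exists_step [StandardBorelSpace X] (hna : NoAtoms μ) {T : X ≃ᵐ X} (hT : Ergodic T μ)
    {k : ℕ} {Xs : Set (ℤ → Fin k)} (hs : ShiftInv Xs) {L : ℕ → ℕ} (hLmono : Monotone L)
    (hLlim : Tendsto (fun m : ℕ => (L m : ℝ) / m) atTop (nhds 0)) (hgl : Glues Xs L) {c : ℝ}
    (hc0 : 0 < c) (hc : ∀ n : ℕ, Real.exp (c * n) ≤ (lang Xs n).card) {q q' : ℕ} {P : X → Fin q}
    {P' : X → Fin q'} {π : Fin q' → Fin q} (hP' : Measurable P') (hπ : ∀ x, P x = π (P' x))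
    {f : X → Option (Fin k)} (hf : Measurable f) (hcons : Consistent μ T Xs f) {G : Set X}
    (hG : MeasurableSet G) {r : ℕ} {D : (ℤ → Fin k) → Fin q}
    (hD : ∀ x ∈ G, ∀ y, Extends T f r x y → D y = P x) {h ε θ α : ℝ} (hh : entropyWrt μ T P' ≤ h)
    (hε : μ.real Gᶜ ≤ ε) (hα0 : 0 < α) (hα1 : α < 1) (hα2 : α ≠ 1 / 2) (hθ : 0 ≤ θ)
    (hnum : α * h + (1 - α) * (h - entropyWrt μ T P) + θ * ε + Real.log (1 + q * Real.exp (-θ)) <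
      α * c) {z : ℤ → Fin k} (hz : z ∈ Xs) (w : ℕ) {τ : ℝ} (hτ : 0 < τ) :
    ∃ (f' : X → Option (Fin k)) (G' : Set X) (r' : ℕ) (D' : (ℤ → Fin k) → Fin q'),
      Measurable f' ∧ Consistent μ T Xs f' ∧ MeasurableSet G' ∧ r ≤ r' ∧
      (∀ x ∈ G', ∀ y, Extends T f' r' x y → D' y = P' x) ∧
      (∀ x ∈ G', ∀ y, Extends T f' r' x y → ∃ i : ℤ, ∀ t : ℤ, |t| ≤ w → y (i + t) = z t) ∧
      μ G'ᶜ ≤ ENNReal.ofReal τ ∧ μ {x | f' x = none} ≤ ENNReal.ofReal τ ∧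
      μ {x | ¬ ∀ i : ℤ, |i| ≤ r → ∀ a, f (itZ T i x) = some a → f' (itZ T i x) = some a} ≤
        ENNReal.ofReal (α + τ) := by
  classical
  obtain ⟨ℓ, g, m, M, n, 𝔅, hn, b1, b2, b3, d1, d2, d3, b4⟩ := exists_blockCoding hna hT hs hLmono
    hLlim hgl hc0 hc hP' hπ hf hcons hG hD hh hε hα0 hα1 hα2 hθ hnum hz w hτ
  have hTm := hT.toMeasurePreserving
  have hn' : (0 : ℝ) < n := by exact_mod_cast hn
  have hX : Nonempty X := by
    by_contra hX
    rw [not_nonempty_iff] at hX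
    have := measure_univ (μ := μ)
    rw [Set.eq_empty_of_isEmpty (univ : Set X)] at this
    simp at this
  obtain ⟨x₀⟩ := hX
  set G' := (toMeasurable μ 𝔅.Goodᶜ)ᶜ with hG'
  have hG'sub : G' ⊆ 𝔅.Good := by
    intro x hx
    by_contra h
    exact hx (subset_toMeasurable μ _ h)
  set r' := 2 * n + 1 + r with hr'
  refine ⟨𝔅.code, G', r', fun y => if h : ∃ x ∈ G', Extends T 𝔅.code r' x y then P' h.choose
    else P' x₀, 𝔅.measurable_code hP', 𝔅.consistent hTm hs hgl,
    (measurableSet_toMeasurable _ _).compl, by omega, ?_, ?_, ?_, ?_, ?_⟩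
  · intro x hx y hy
    have hex : ∃ x ∈ G', Extends T 𝔅.code r' x y := ⟨x, hx, hy⟩
    dsimp only
    rw [dif_pos hex]
    exact 𝔅.eq_of_ext (by omega) (hG'sub hex.choose_spec.1) (hG'sub hx) hex.choose_spec.2 hy
  · intro x hx y hy
    exact 𝔅.exists_target (by omega) (hG'sub hx) hy
  · rw [hG', compl_compl, measure_toMeasurable]
    refine (𝔅.measure_good_compl_le hTm).trans ?_
    have e1 : ((g + M + 1 : ℕ) : ℝ) / n ≤ τ / 2 - 1 / n := by
      rw [le_sub_iff_add_le, ← add_div]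
      refine le_trans (le_of_eq ?_) d1
      push_cast; ring
    have e0 : (0 : ℝ) ≤ 1 / n := by positivity
    have e2 : 0 ≤ τ / 2 - 1 / n := le_trans (by positivity) e1
    have e3 : (n : ℝ≥0∞)⁻¹ = ENNReal.ofReal (1 / n) := by
      rw [one_div, ENNReal.ofReal_inv_of_pos hn', ENNReal.ofReal_natCast]
    calc _ ≤ ENNReal.ofReal (τ / 2 - 1 / n) + ENNReal.ofReal (τ / 4) + ENNReal.ofReal (1 / n) :=
          add_le_add (add_le_add (natCast_mul_le_ofReal hn b1 e1) b2) (b3.trans_eq e3)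
      _ = ENNReal.ofReal (τ / 2 - 1 / n + τ / 4 + 1 / n) := by
          rw [ENNReal.ofReal_add (by positivity) e0, ENNReal.ofReal_add e2 (by positivity)]
      _ ≤ _ := ENNReal.ofReal_le_ofReal (by linarith)
  · refine (𝔅.measure_code_eq_none_le hTm).trans (natCast_mul_le_ofReal hn b1 ?_)
    push_cast; exact d2
  · refine (𝔅.measure_change_le hTm r b4).trans ?_
    calc _ ≤ ENNReal.ofReal (α + τ / 2) + ENNReal.ofReal (τ / 4) :=
          add_le_add (natCast_mul_le_ofReal hn b1 (by push_cast; exact d3)) b2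
      _ = ENNReal.ofReal (α + τ / 2 + τ / 4) :=
          (ENNReal.ofReal_add (by positivity) (by positivity)).symm
      _ ≤ _ := ENNReal.ofReal_le_ofReal (by linarith)

end Step

section Limit

lemma exists_eventual_value {X A : Type*} [MeasurableSpace X] [MeasurableSpace A] [Countable A]
    [MeasurableSingletonClass A] (a₀ : A) {f : ℕ → X → Option A}
    (hf : ∀ j a, MeasurableSet {x | f j x = some a}) :
    ∃ F : X → A, Measurable F ∧ ∀ x a, (∀ᶠ j in atTop, f j x = some a) → F x = a := by
  classical
  have huniq : ∀ x a b, (∀ᶠ j in atTop, f j x = some a) → (∀ᶠ j in atTop, f j x = some b) → a = b :=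
      by
    intro x a b ha hb
    obtain ⟨j, h1, h2⟩ := (ha.and hb).exists
    exact Option.some_injective _ (h1.symm.trans h2)
  have hmeas : ∀ a, MeasurableSet {x | ∀ᶠ j in atTop, f j x = some a} := by
    intro a
    simp only [eventually_atTop]
    have : {x | ∃ J, ∀ j ≥ J, f j x = some a} = ⋃ J, ⋂ j, ⋂ (_ : J ≤ j), {x | f j x = some a} := by
      ext x; simp
    rw [this]
    exact MeasurableSet.iUnion fun J => MeasurableSet.iInter fun j => MeasurableSet.iInter fun _ =>
      hf j a
  refine ⟨fun x => if h : ∃ a, ∀ᶠ j in atTop, f j x = some a then h.choose else a₀, ?_, ?_⟩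
  · refine measurable_to_countable' fun b => ?_
    have : (fun x => if h : ∃ a, ∀ᶠ j in atTop, f j x = some a then h.choose else a₀) ⁻¹' {b} =
        {x | ∀ᶠ j in atTop, f j x = some b} ∪
          ({x | ∃ a, ∀ᶠ j in atTop, f j x = some a}ᶜ ∩ {_x | b = a₀}) := by
      ext x
      simp only [Set.mem_preimage, Set.mem_singleton_iff, Set.mem_union, Set.mem_inter_iff,
        Set.mem_compl_iff, Set.mem_ofPred_eq]
      by_cases h : ∃ a, ∀ᶠ j in atTop, f j x = some a
      · rw [dif_pos h]
        constructor
        · intro e; left; rw [← e]; exact h.choose_spec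
        · rintro (e | e)
          · exact huniq x _ _ h.choose_spec e
          · exact absurd h e.1
      · rw [dif_neg h]
        constructor
        · intro e; exact Or.inr ⟨h, e.symm⟩
        · rintro (e | e)
          · exact absurd ⟨b, e⟩ h
          · exact e.2.symm
    rw [this]
    refine (hmeas b).union (MeasurableSet.inter ?_ (MeasurableSet.const _))
    have : {x | ∃ a, ∀ᶠ j in atTop, f j x = some a} = ⋃ a, {x | ∀ᶠ j in atTop, f j x = some a} := by
      ext x; simp
    rw [this]
    exact (MeasurableSet.iUnion hmeas).compl
  · intro x a ha
    have h : ∃ a, ∀ᶠ j in atTop, f j x = some a := ⟨a, ha⟩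
    dsimp only
    rw [dif_pos h]
    exact huniq x _ _ h.choose_spec ha

lemma mem_of_forall_window {k : ℕ} {Xs : Set (ℤ → Fin k)} (hcl : IsClosed Xs) {y : ℤ → Fin k}
    (h : ∀ N : ℕ, ∃ z ∈ Xs, ∀ i : ℤ, |i| ≤ N → z i = y i) : y ∈ Xs := by
  choose z hz hzy using h
  refine hcl.mem_of_tendsto (f := z) (b := atTop) ?_ (Eventually.of_forall hz)
  refine tendsto_pi_nhds.2 fun i => ?_
  refine tendsto_const_nhds.congr' ?_
  filter_upwards [eventually_ge_atTop i.natAbs] with N hN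
  refine (hzy N i ?_).symm
  rw [abs_le]
  constructor <;> omega

lemma exists_limit_code {X : Type*} [MeasurableSpace X] {μ : Measure X} {T : X ≃ᵐ X}
    (hT : MeasurePreserving T μ μ) {k : ℕ} {Xs : Set (ℤ → Fin k)} (hcl : IsClosed Xs) (a₀ : Fin k)
    {f : ℕ → X → Option (Fin k)} (hf : ∀ j, Measurable (f j)) (hcons : ∀ j, Consistent μ T Xs (f j))
    {r : ℕ → ℕ} (hr : Monotone r) (h1 : ∑' j, μ {x | f j x = none} ≠ ⊤)
    (h2 : ∑' j, μ {x | ¬ ∀ i : ℤ, |i| ≤ r j → ∀ a, f j (itZ T i x) = some a →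
      f (j + 1) (itZ T i x) = some a} ≠ ⊤) :
    ∃ F : X → Fin k, Measurable F ∧ ∀ᵐ x ∂μ, (fun i : ℤ => F (itZ T i x)) ∈ Xs ∧
      ∀ᶠ j in atTop, Extends T (f j) (r j) x fun i => F (itZ T i x) := by
  obtain ⟨F, hF, hF'⟩ := exists_eventual_value a₀ (f := f)
    (fun j a => hf j (measurableSet_singleton (some a)))
  refine ⟨F, hF, ?_⟩
  have a1 := ae_itZ hT (ae_eventually_notMem h1)
  have a2 := ae_itZ hT (ae_eventually_notMem h2)
  filter_upwards [a1, a2, ae_all_iff.2 hcons] with x b1 b2 b3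
  have hext : ∀ᶠ j in atTop, Extends T (f j) (r j) x fun i => F (itZ T i x) := by
    have := b2 0
    simp only [itZ_zero, not_not] at this
    obtain ⟨J, hJ⟩ := eventually_atTop.1 this
    filter_upwards [eventually_ge_atTop J] with j hj i hi a ha
    refine hF' _ _ ?_
    filter_upwards [eventually_ge_atTop j] with j' hj'
    induction j', hj' using Nat.le_induction with
    | base => exact ha
    | succ j' hj' ih => exact hJ j' (hj.trans hj') i (hi.trans (by exact_mod_cast hr hj')) a ih
  refine ⟨mem_of_forall_window hcl fun N => ?_, hext⟩
  have hval : ∀ i : ℤ, ∀ᶠ j in atTop, f j (itZ T i x) = some (F (itZ T i x)) := by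
    intro i
    have e1 := b1 i
    have e2 := b2 i
    simp only [not_not] at e1 e2
    obtain ⟨J, hJ⟩ := eventually_atTop.1 (e1.and e2)
    obtain ⟨a, ha⟩ := Option.ne_none_iff_exists'.1 (hJ J le_rfl).1
    have key : ∀ᶠ j in atTop, f j (itZ T i x) = some a := by
      filter_upwards [eventually_ge_atTop J] with j hj
      induction j, hj using Nat.le_induction with
      | base => exact ha
      | succ j hj ih =>
        have := (hJ j hj).2 0 (by simp) a
        rw [itZ_zero] at this
        exact this ih
    rwa [hF' _ _ key]
  have hfin : ∀ᶠ j in atTop, ∀ i ∈ Finset.Icc (-(N : ℤ)) N, f j (itZ T i x) =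
      some (F (itZ T i x)) := (Finset.eventually_all _).2 fun i _ => hval i
  obtain ⟨j, hj⟩ := hfin.exists
  obtain ⟨z, hz, hz'⟩ := b3 j N
  exact ⟨z, hz, fun i hi => hz' i hi _ (hj i (Finset.mem_Icc.2 (abs_le.1 hi)))⟩

end Limit

section Parameters

variable {X : Type*} [MeasurableSpace X] {μ : Measure X}

/-- A refining sequence of finite observables that separates points and has almost maximal
entropies. -/
lemma exists_refining_observables [IsProbabilityMeasure μ] [StandardBorelSpace X] {T : X → X}
    (hT : Measurable T) {h : ℝ}
    (hsup : ∀ δ > 0, ∃ (p : ℕ) (Q : X → Fin p), Measurable Q ∧ h - δ < entropyWrt μ T Q) {δ : ℕ → ℝ}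
    (hδ : ∀ j, 0 < δ j) :
    ∃ (q : ℕ → ℕ) (P : ∀ j, X → Fin (q j)) (π : ∀ j, Fin (q (j + 1)) → Fin (q j)), q 0 = 1 ∧
      (∀ j, Measurable (P j)) ∧ (∀ j x, P j x = π j (P (j + 1) x)) ∧
      (∀ j, h - δ j < entropyWrt μ T (P (j + 1))) ∧
      ∀ x x', (∀ᶠ j in atTop, P j x = P j x') → x = x' := by
  classical
  choose p Q hQ hQh using fun j => hsup (δ j) (hδ j)
  obtain ⟨S, hS, hsep⟩ := exists_seq_separating X MeasurableSet.empty (univ : Set X)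
  let A : ℕ → Type := fun i => Fin (p i) × Fin 2
  let e : ∀ j : ℕ, (∀ i : Fin j, A i) ≃ Fin (Fintype.card (∀ i : Fin j, A i)) := fun j =>
    Fintype.equivFin _
  let V : ∀ j : ℕ, X → ∀ i : Fin j, A i := fun j x i => (Q i x, if x ∈ S i then 1 else 0)
  have hV : ∀ j, Measurable (V j) := fun j => measurable_pi_iff.2 fun i =>
    (hQ i).prodMk (Measurable.ite (hS i) measurable_const measurable_const)
  have hP : ∀ j, Measurable fun x => e j (V j x) := fun j =>
      (measurable_of_finite (e j)).comp (hV j)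
  refine ⟨fun j => Fintype.card (∀ i : Fin j, A i), fun j x => e j (V j x),
    fun j u => e j fun i => (e (j + 1)).symm u i.castSucc, ?_, hP, ?_, ?_, ?_⟩
  · simp
  · intro j x
    simp only [Equiv.symm_apply_apply]
    rfl
  · intro j
    refine (hQh j).trans_le ?_
    refine entropyWrt_comp_le hT (hQ j) (hP (j + 1))
      (π := fun u => ((e (j + 1)).symm u (Fin.last j)).1) fun x => ?_
    simp only [Equiv.symm_apply_apply]
    rfl
  · intro x x' hxx
    refine hsep x (mem_univ _) x' (mem_univ _) fun i => ?_
    obtain ⟨j, h1, h2⟩ := (hxx.and (eventually_gt_atTop i)).exists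
    have h3 := congrArg Prod.snd (congrFun ((e j).injective h1) ⟨i, h2⟩)
    simp only [V] at h3
    by_cases a : x ∈ S i <;> by_cases b : x' ∈ S i <;> simp_all

lemma exists_log_one_add_le (q : ℕ) {s : ℝ} (hs : 0 < s) :
    ∃ θ : ℝ, 0 ≤ θ ∧ Real.log (1 + q * Real.exp (-θ)) ≤ s := by
  have h1 : Tendsto (fun θ : ℝ => (q : ℝ) * Real.exp (-θ)) atTop (nhds (q * 0)) :=
    (Real.tendsto_exp_neg_atTop_nhds_zero).const_mul _
  rw [mul_zero] at h1
  obtain ⟨θ, h2, h3⟩ := ((h1.eventually (gt_mem_nhds hs)).and (eventually_ge_atTop 0)).exists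
  refine ⟨θ, h3, ?_⟩
  have h4 : 0 ≤ (q : ℝ) * Real.exp (-θ) := by positivity
  have := Real.log_le_sub_one_of_pos (x := 1 + q * Real.exp (-θ)) (by linarith)
  linarith

lemma exists_construction_data [IsProbabilityMeasure μ] [StandardBorelSpace X] {T : X → X}
    (hT : Measurable T) {h c : ℝ} (hh0 : 0 ≤ h) (hhc : h < c)
    (hsup : ∀ δ > 0, ∃ (p : ℕ) (Q : X → Fin p), Measurable Q ∧ h - δ < entropyWrt μ T Q) :
    ∃ (q : ℕ → ℕ) (P : ∀ j, X → Fin (q j)) (π : ∀ j, Fin (q (j + 1)) → Fin (q j))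
      (α θ ε : ℕ → ℝ), q 0 = 1 ∧ (∀ j, Measurable (P j)) ∧ (∀ j x, P j x = π j (P (j + 1) x)) ∧
      (∀ x x', (∀ᶠ j in atTop, P j x = P j x') → x = x') ∧
      (∀ j, 0 < α j ∧ α j < 1 ∧ α j ≠ 1 / 2) ∧ (∀ j, 0 ≤ θ j) ∧ ε 0 = 0 ∧ (∀ j, 0 < ε (j + 1)) ∧
      Summable α ∧ Summable ε ∧
      ∀ j, α j * h + (1 - α j) * (h - entropyWrt μ T (P j)) + θ j * ε j +
        Real.log (1 + q j * Real.exp (-θ j)) < α j * c := by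
  have hc0 : 0 < c := by linarith
  obtain ⟨α₀, a1, a2, a3, a4⟩ : ∃ α₀ : ℝ, 0 < α₀ ∧ α₀ < 1 ∧ α₀ ≠ 1 / 2 ∧ h < α₀ * c := by
    have hlt : max (h / c) (1 / 2) < 1 := max_lt ((div_lt_one hc0).2 hhc) (by norm_num)
    obtain ⟨a, h1, h2⟩ := exists_between hlt
    have h3 := (le_max_left _ _).trans_lt h1
    have h4 := (le_max_right _ _).trans_lt h1
    rw [div_lt_iff₀ hc0] at h3
    exact ⟨a, by linarith, h2, h4.ne', h3⟩
  set β : ℕ → ℝ := fun j => 1 / 4 * (1 / 2) ^ j with hβ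
  have hβ0 : ∀ j, 0 < β j := fun j => by positivity
  have hβ1 : ∀ j, β j ≤ 1 / 4 := fun j => by
    have : ((1 : ℝ) / 2) ^ j ≤ 1 := pow_le_one₀ (by norm_num) (by norm_num)
    simp only [hβ]; linarith
  have hch : 0 < c - h := by linarith
  obtain ⟨q, P, π, hq, hP, hπ, hent, hsep⟩ := exists_refining_observables (μ := μ) hT hsup
    (δ := fun j => β j * (c - h) / 4) (fun j => by have := hβ0 j; positivity)
  have hpos : 0 < α₀ * c - h := by linarith
  obtain ⟨s, s0, s1⟩ : ∃ s : ℕ → ℝ, s 0 = (α₀ * c - h) / 2 ∧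
      ∀ j, s (j + 1) = β j * (c - h) / 4 :=
    ⟨fun j => Nat.casesOn j ((α₀ * c - h) / 2) fun j => β j * (c - h) / 4, rfl, fun _ => rfl⟩
  have hs0 : ∀ j, 0 < s j := by
    intro j
    cases j with
    | zero => rw [s0]; linarith
    | succ j => have := hβ0 j; rw [s1]; positivity
  choose θ hθ0 hθ using fun j => exists_log_one_add_le (q j) (hs0 j)
  obtain ⟨α, α0, α1⟩ : ∃ α : ℕ → ℝ, α 0 = α₀ ∧ ∀ j, α (j + 1) = β j :=
    ⟨fun j => Nat.casesOn j α₀ β, rfl, fun _ => rfl⟩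
  obtain ⟨ε, ε0, ε1⟩ : ∃ ε : ℕ → ℝ, ε 0 = 0 ∧
      ∀ j, ε (j + 1) = min (β j) (β j * (c - h) / 4 / (1 + θ (j + 1))) :=
    ⟨fun j => Nat.casesOn j 0 fun j => min (β j) (β j * (c - h) / 4 / (1 + θ (j + 1))), rfl,
        fun _ => rfl⟩
  have hε : ∀ j, 0 < ε (j + 1) := by
    intro j
    have := hβ0 j
    have := hθ0 (j + 1)
    rw [ε1]
    positivity
  refine ⟨q, P, π, α, θ, ε, hq, hP, hπ, hsep, ?_, hθ0, ε0, hε, ?_, ?_, ?_⟩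
  · intro j
    cases j with
    | zero => exact α0 ▸ ⟨a1, a2, a3⟩
    | succ j =>
      have := hβ0 j
      have := hβ1 j
      rw [α1]
      exact ⟨hβ0 j, by linarith, by linarith⟩
  · rw [← summable_nat_add_iff 1]
    simp only [α1]
    exact summable_geometric_two.mul_left _
  · rw [← summable_nat_add_iff 1]
    exact Summable.of_nonneg_of_le (f := β) (fun j => (hε j).le)
      (fun j => (ε1 j).trans_le (min_le_left _ _)) (summable_geometric_two.mul_left _)
  · intro j
    have h1 := hθ j
    cases j with
    | zero =>
      rw [s0] at h1
      rw [α0, ε0]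
      have h2 := entropyWrt_nonneg (μ := μ) hT (hP 0)
      have h3 : 0 ≤ (1 - α₀) * entropyWrt μ T (P 0) := mul_nonneg (by linarith) h2
      linarith
    | succ j =>
      rw [s1] at h1
      rw [α1, ε1]
      have b0 := hβ0 j
      have b1 := hβ1 j
      have t0 := hθ0 (j + 1)
      have h2 := hent j
      have h3 : (1 - β j) * (h - entropyWrt μ T (P (j + 1))) ≤ β j * (c - h) / 4 := by
        have h4 : 0 ≤ β j * (c - h) / 4 := by positivity
        nlinarith
      have h5 : θ (j + 1) * min (β j) (β j * (c - h) / 4 / (1 + θ (j + 1))) ≤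
          β j * (c - h) / 4 := by
        have h6 : min (β j) (β j * (c - h) / 4 / (1 + θ (j + 1))) ≤
            β j * (c - h) / 4 / (1 + θ (j + 1)) := min_le_right _ _
        rw [le_div_iff₀ (by linarith)] at h6
        have h7 : 0 ≤ min (β j) (β j * (c - h) / 4 / (1 + θ (j + 1))) := by positivity
        linarith
      have h8 : 0 < β j * (c - h) := by positivity
      linarith

end Parameters

section Universality

variable {X : Type} [MeasurableSpace X] {μ : Measure X}

/-- A stage of the construction: a consistent partial coding `code` that determines the
observable `P` on a set `good` of almost full measure. -/
structure CodingStage (μ : Measure X) (T : X ≃ᵐ X) {k : ℕ} (Xs : Set (ℤ → Fin k)) {q : ℕ}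
    (P : X → Fin q) (ε : ℝ) where
  /-- The partial coding. -/
  code : X → Option (Fin k)
  /-- The set on which the observable can be read off. -/
  good : Set X
  /-- The radius of the window used for decoding. -/
  radius : ℕ
  /-- The decoding map. -/
  decode : (ℤ → Fin k) → Fin q
  measurable_code : Measurable code
  consistent_code : Consistent μ T Xs code
  measurableSet_good : MeasurableSet good
  decode_eq : ∀ x ∈ good, ∀ y, Extends T code radius x y → decode y = P x
  measure_compl_good_le : μ goodᶜ ≤ ENNReal.ofReal ε

lemma tsum_ne_top_of_tsum_succ {a : ℕ → ℝ≥0∞} (h0 : a 0 ≠ ⊤) (h : ∑' j, a (j + 1) ≠ ⊤) :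
    ∑' j, a j ≠ ⊤ := by
  rw [tsum_eq_zero_add' ENNReal.summable]
  exact ENNReal.add_ne_top.2 ⟨h0, h⟩

lemma exists_code_sequence [IsProbabilityMeasure μ] [StandardBorelSpace X] (hna : NoAtoms μ)
    {T : X ≃ᵐ X} (hT : Ergodic T μ) {k : ℕ} {Xs : Set (ℤ → Fin k)} (hne : Xs.Nonempty)
    (hs : ShiftInv Xs) {L : ℕ → ℕ} (hLmono : Monotone L)
    (hLlim : Tendsto (fun m : ℕ => (L m : ℝ) / m) atTop (nhds 0)) (hgl : Glues Xs L) {h c : ℝ}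
    (hh0 : 0 ≤ h) (hhc : h < c) (hc : ∀ n : ℕ, Real.exp (c * n) ≤ (lang Xs n).card)
    (hle : ∀ (p : ℕ) (Q : X → Fin p), Measurable Q → entropyWrt μ T Q ≤ h)
    (hsup : ∀ δ > 0, ∃ (p : ℕ) (Q : X → Fin p), Measurable Q ∧ h - δ < entropyWrt μ T Q)
    {z : ℕ → ℤ → Fin k} (hz : ∀ j, z j ∈ Xs) :
    ∃ (f : ℕ → X → Option (Fin k)) (r : ℕ → ℕ) (q : ℕ → ℕ) (P : ∀ j, X → Fin (q j))
      (G : ℕ → Set X) (D : ∀ j, (ℤ → Fin k) → Fin (q j)), (∀ j, Measurable (f j)) ∧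
      (∀ j, Consistent μ T Xs (f j)) ∧ Monotone r ∧
      (∀ x x', (∀ᶠ j in atTop, P j x = P j x') → x = x') ∧
      (∀ j, ∀ x ∈ G j, ∀ y, Extends T (f j) (r j) x y → D j y = P j x) ∧
      (∀ j, ∀ x ∈ G (j + 1), ∀ y, Extends T (f (j + 1)) (r (j + 1)) x y →
        ∃ i : ℤ, ∀ t : ℤ, |t| ≤ j → y (i + t) = z j t) ∧
      ∑' j, μ (G j)ᶜ ≠ ⊤ ∧ ∑' j, μ {x | f j x = none} ≠ ⊤ ∧
      ∑' j, μ {x | ¬ ∀ i : ℤ, |i| ≤ r j → ∀ a, f j (itZ T i x) = some a →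
        f (j + 1) (itZ T i x) = some a} ≠ ⊤ := by
  obtain ⟨q, P, π, α, θ, ε, hq, hP, hπ, hsep, hα, hθ, hε0, hε, hαs, hεs, hnum⟩ :=
    exists_construction_data (μ := μ) T.measurable hh0 hhc hsup
  have hεnn : ∀ j, 0 ≤ ε j := fun j => by
    cases j with
    | zero => exact hε0.ge
    | succ j => exact (hε j).le
  have hstep : ∀ (j : ℕ) (s : CodingStage μ T Xs (P j) (ε j)),
      ∃ s' : CodingStage μ T Xs (P (j + 1)) (ε (j + 1)), s.radius ≤ s'.radius ∧
        (∀ x ∈ s'.good, ∀ y, Extends T s'.code s'.radius x y →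
          ∃ i : ℤ, ∀ t : ℤ, |t| ≤ j → y (i + t) = z j t) ∧
        μ {x | s'.code x = none} ≤ ENNReal.ofReal (ε (j + 1)) ∧
        μ {x | ¬ ∀ i : ℤ, |i| ≤ s.radius → ∀ a, s.code (itZ T i x) = some a →
          s'.code (itZ T i x) = some a} ≤ ENNReal.ofReal (α j + ε (j + 1)) := by
    intro j s
    obtain ⟨f', G', r', D', h1, h2, h3, h4, h5, h6, h7, h8, h9⟩ := exists_step hna hT hs hLmono
      hLlim hgl (hh0.trans_lt hhc) hc (hP (j + 1)) (hπ j) s.measurable_code s.consistent_code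
      s.measurableSet_good s.decode_eq (hle _ _ (hP (j + 1)))
      (ENNReal.toReal_le_of_le_ofReal (hεnn j) s.measure_compl_good_le) (hα j).1 (hα j).2.1
      (hα j).2.2 (hθ j) (hnum j) (hz j) j (hε j)
    exact ⟨⟨f', G', r', D', h1, h2, h3, h5, h7⟩, h4, h6, h8, h9⟩
  choose next hr htarget hnone hchange using hstep
  have hsub : Subsingleton (Fin (q 0)) := by rw [hq]; infer_instance
  obtain ⟨z₀, hz₀⟩ := hne
  let first : CodingStage μ T Xs (P 0) (ε 0) :=
    { code := fun _ => none
      good := univ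
      radius := 0
      decode := fun _ => ⟨0, by omega⟩
      measurable_code := measurable_const
      consistent_code := Eventually.of_forall fun x N => ⟨z₀, hz₀, fun i _ a h => by simp at h⟩
      measurableSet_good := MeasurableSet.univ
      decode_eq := fun x _ y _ => Subsingleton.elim _ _
      measure_compl_good_le := by simp }
  obtain ⟨S, hS⟩ : ∃ S : ∀ j, CodingStage μ T Xs (P j) (ε j), ∀ j, S (j + 1) = next j (S j) :=
    ⟨fun j => Nat.rec first next j, fun _ => rfl⟩
  have hsum : ∑' j, ENNReal.ofReal (ε j) ≠ ⊤ := hεs.tsum_ofReal_ne_top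
  have hεs' : Summable fun j => ε (j + 1) := (summable_nat_add_iff 1).2 hεs
  refine ⟨fun j => (S j).code, fun j => (S j).radius, q, P, fun j => (S j).good,
    fun j => (S j).decode, fun j => (S j).measurable_code, fun j => (S j).consistent_code,
    monotone_nat_of_le_succ fun j => ?_, hsep, fun j => (S j).decode_eq, fun j => ?_, ?_, ?_, ?_⟩
  · rw [hS]
    exact hr j (S j)
  · dsimp only
    rw [hS]
    exact htarget j (S j)
  · exact ne_top_of_le_ne_top hsum (ENNReal.tsum_le_tsum fun j => (S j).measure_compl_good_le)
  · refine tsum_ne_top_of_tsum_succ (measure_ne_top _ _)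
      (ne_top_of_le_ne_top hεs'.tsum_ofReal_ne_top (ENNReal.tsum_le_tsum fun j => ?_))
    dsimp only
    rw [hS]
    exact hnone j (S j)
  · refine ne_top_of_le_ne_top (hαs.add hεs').tsum_ofReal_ne_top
      (ENNReal.tsum_le_tsum fun j => ?_)
    dsimp only
    rw [hS]
    exact hchange j (S j)

lemma exists_lt_entropyWrt [IsProbabilityMeasure μ] {T : X → X} (hT : Measurable T)
    (hfin : ksEntropy μ T ≠ ⊤) {δ : ℝ} (hδ : 0 < δ) :
    ∃ (p : ℕ) (Q : X → Fin p), Measurable Q ∧ (ksEntropy μ T).toReal - δ < entropyWrt μ T Q := by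
  rcases lt_or_ge ((ksEntropy μ T).toReal - δ) 0 with h | h
  · exact ⟨1, fun _ => 0, measurable_const, h.trans_le (entropyWrt_nonneg hT measurable_const)⟩
  · have h1 : ENNReal.ofReal ((ksEntropy μ T).toReal - δ) < ksEntropy μ T :=
      (ENNReal.ofReal_lt_iff_lt_toReal h hfin).2 (by linarith)
    rw [ksEntropy] at h1
    simp only [lt_iSup_iff] at h1
    obtain ⟨p, Q, hQ, h2⟩ := h1
    exact ⟨p, Q, hQ, (ENNReal.ofReal_lt_ofReal_iff'.1 h2).1⟩

lemma entropyWrt_le_toReal_ksEntropy {T : X → X} (hfin : ksEntropy μ T ≠ ⊤) {p : ℕ}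
    {Q : X → Fin p} (hQ : Measurable Q) : entropyWrt μ T Q ≤ (ksEntropy μ T).toReal := by
  rw [← ENNReal.ofReal_le_iff_le_toReal hfin]
  exact le_iSup_of_le p (le_iSup_of_le Q (le_iSup_of_le hQ le_rfl))

lemma measurable_itinerary {T : X ≃ᵐ X} {k : ℕ} {F : X → Fin k} (hF : Measurable F) :
    Measurable fun x => fun i : ℤ => F (itZ T i x) := by
  have hd : DiscreteTopology (Fin k) := inferInstance
  have hb : OpensMeasurableSpace (Fin k) := ⟨fun s _ => (Set.toFinite s).measurableSet⟩
  have hpi : @Measurable X (ℤ → Fin k) _ MeasurableSpace.pi fun x i => F (itZ T i x) :=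
    measurable_pi_iff.2 fun i => hF.comp (measurable_itZ T i)
  refine measurable_of_isOpen fun U hU => ?_
  exact hpi ((@Pi.opensMeasurableSpace ℤ (fun _ => Fin k) _ _ _ _ _).borel_le U
    (MeasurableSpace.measurableSet_generateFrom hU))

lemma toTopologicalSpace_uniformSpace_subtype {k : ℕ} (Xs : Set (ℤ → Fin k)) :
    (instUniformSpaceSubtype : UniformSpace ↥Xs).toTopologicalSpace =
      instTopologicalSpaceSubtype := by
  have h1 : (PseudoMetricSpace.toUniformSpace : UniformSpace (Fin k)).toTopologicalSpace =
      instTopologicalSpaceFin := by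
    have h2 : @DiscreteTopology (Fin k) PseudoMetricSpace.toUniformSpace.toTopologicalSpace :=
      @Finite.instDiscreteTopology (Fin k) PseudoMetricSpace.toUniformSpace.toTopologicalSpace _ _
    exact h2.eq_bot
  change TopologicalSpace.induced Subtype.val (@Pi.topologicalSpace ℤ (fun _ => Fin k) fun _ =>
    (PseudoMetricSpace.toUniformSpace : UniformSpace (Fin k)).toTopologicalSpace) = _
  rw [h1]
  rfl

end Universality

/-- **Subshifts with almost weak specification are fully universal.**  Here `Xs` is a subshift
on the alphabet `Fin k` (a non-empty closed shift-invariant set), `σX` is the restriction of the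
shift map to `Xs`, and the hypothesis is that `σX` satisfies almost weak specification. -/
theorem subshift_almostWeakSpec_fullyUniversal (k : ℕ) (Xs : Set (ℤ → Fin k))
    (hne : Xs.Nonempty) (hcl : IsClosed Xs) (hinv : fullShift '' Xs = Xs)
    (σX : ↥Xs ≃ ↥Xs) (hσ : ∀ x : ↥Xs, (σX x : ℤ → Fin k) = fullShift (x : ℤ → Fin k))
    (hspec : AlmostWeakSpec σX) :
    FullyUniversal (⇑σX) := by
  classical
  intro X _ μ T hX hμ hna hT hlt
  have hs := shiftInv_of_equiv hσ
  have hTm := hT.toMeasurePreserving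
  have hfin : ksEntropy μ T ≠ ⊤ := by
    intro h
    rw [h] at hlt
    exact not_top_lt hlt
  obtain ⟨c, hhc, hc⟩ := EReal.lt_iff_exists_real_btwn.1 hlt
  have hhc' : (ksEntropy μ T).toReal < c := by
    rw [← EReal.coe_lt_coe_iff, EReal.coe_ennreal_toReal hfin]
    exact hhc
  obtain ⟨L, hLmono, hLlim, hgl⟩ := exists_glues hσ hspec
  have : Nonempty ↥Xs := hne.to_subtype
  set d := TopologicalSpace.denseSeq ↥Xs
  obtain ⟨f, r, q, P, G, D, hf, hcons, hr, hsep, hD, htarget, hsG, hsN, hsC⟩ :=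
    exists_code_sequence hna hT hne hs hLmono hLlim hgl ENNReal.toReal_nonneg hhc'
      (exp_le_lang_card hne hσ hc) (fun _ _ => entropyWrt_le_toReal_ksEntropy hfin)
      (fun _ => exists_lt_entropyWrt T.measurable hfin)
      (z := fun j => d (Nat.unpair j).1) (fun j => Subtype.property _)
  obtain ⟨F, hF, hFae⟩ := exists_limit_code hTm hcl (hne.some 0) hf hcons hr hsN hsC
  have hG : ∀ᵐ x ∂μ, ∀ᶠ j in atTop, x ∈ G j := by
    filter_upwards [ae_eventually_notMem hsG] with x hx
    filter_upwards [hx] with j hj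
    exact not_not.1 hj
  set Y : X → ℤ → Fin k := fun x i => F (itZ T i x) with hY
  have hYm : Measurable Y := measurable_itinerary hF
  have hgood := ae_itZ hTm (hFae.and hG)
  set B := toMeasurable μ {x | ¬ ∀ i : ℤ, ((Y (itZ T i x) ∈ Xs ∧ ∀ᶠ j in atTop,
    Extends T (f j) (r j) (itZ T i x) (Y (itZ T i x))) ∧ ∀ᶠ j in atTop, itZ T i x ∈ G j)} with hB
  have hB0 : μ B = 0 := by rw [hB, measure_toMeasurable]; exact hgood
  have hBc : ∀ x ∈ Bᶜ, ∀ i : ℤ, ((Y (itZ T i x) ∈ Xs ∧ ∀ᶠ j in atTop,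
      Extends T (f j) (r j) (itZ T i x) (Y (itZ T i x))) ∧ ∀ᶠ j in atTop, itZ T i x ∈ G j) := by
    intro x hx
    by_contra h
    exact hx (subset_toMeasurable _ _ h)
  have hBc0 : ∀ x ∈ Bᶜ, (Y x ∈ Xs ∧ ∀ᶠ j in atTop, Extends T (f j) (r j) x (Y x)) ∧
      ∀ᶠ j in atTop, x ∈ G j := fun x hx => by simpa only [itZ_zero] using hBc x hx 0
  have hmem : ∀ x, (if Y x ∈ Xs then Y x else hne.some) ∈ Xs := fun x => by
    split_ifs with h
    exacts [h, hne.some_mem]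
  set Ψ : X → ↥Xs := fun x => ⟨if Y x ∈ Xs then Y x else hne.some, hmem x⟩ with hΨ
  have hΨY : ∀ x, Y x ∈ Xs → (Ψ x : ℤ → Fin k) = Y x := fun x hx => if_pos hx
  have hYT : ∀ x i, Y (itZ T i x) = fun n => Y x (n + i) := fun x i => by
    ext1 n
    simp only [hY, itZ_add]
  have hΨm : Measurable Ψ :=
    (Measurable.ite (hYm hcl.measurableSet) hYm measurable_const).subtype_mk
  refine ⟨Ψ, ⟨hΨm, Bᶜ, (measurableSet_toMeasurable _ _).compl, by rwa [compl_compl], ?_, ?_⟩, ?_⟩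
  · intro x hx x' hx' hxx
    have hyy : Y x = Y x' := by
      rw [← hΨY x (hBc0 x hx).1.1, ← hΨY x' (hBc0 x' hx').1.1, hxx]
    refine hsep x x' ?_
    filter_upwards [(hBc0 x hx).1.2, (hBc0 x hx).2, (hBc0 x' hx').1.2, (hBc0 x' hx').2]
      with j h1 h2 h3 h4
    rw [← hD j x h2 _ h1, ← hD j x' h4 _ h3, hyy]
  · intro x hx
    have h1 := (hBc x hx 1).1.1
    rw [itZ_one] at h1
    refine Subtype.ext ?_
    rw [hσ, hΨY _ h1, hΨY _ (hBc0 x hx).1.1, ← itZ_one, hYT]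
    rfl
  · intro U hU hUne
    rw [toTopologicalSpace_uniformSpace_subtype] at hU
    rw [Measure.map_apply hΨm hU.measurableSet, pos_iff_ne_zero]
    intro h0
    obtain ⟨m, hm⟩ := (TopologicalSpace.denseRange_denseSeq ↥Xs).exists_mem_open hU hUne
    have hUm : U ∈ @nhds ↥Xs instUniformSpaceSubtype.toTopologicalSpace (d m) := by
      rw [toTopologicalSpace_uniformSpace_subtype]
      exact hU.mem_nhds hm
    obtain ⟨V, hV, hVU⟩ := UniformSpace.mem_nhds_iff.1 hUm
    obtain ⟨w, hw⟩ := exists_cylinder_subset hV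
    have hae : ∀ᵐ x ∂μ, ∀ i : ℤ, Ψ (itZ T i x) ∉ U := ae_itZ hTm (p := fun x => Ψ x ∉ U)
      (by rw [ae_iff]; simp only [not_not]; exact h0)
    have hBae : ∀ᵐ x ∂μ, x ∈ Bᶜ := by rw [ae_iff]; simpa using hB0
    obtain ⟨x, hxU, hx⟩ := (hae.and hBae).exists
    obtain ⟨J, hJ⟩ := eventually_atTop.1 ((hBc0 x hx).1.2.and (hBc0 x hx).2)
    set j := Nat.pair m (max J w) with hj
    have hj1 : max J w ≤ j := Nat.right_le_pair _ _
    obtain ⟨h1, h2⟩ := hJ (j + 1) (by omega)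
    obtain ⟨i, hi⟩ := htarget j x h2 _ h1
    refine hxU i (hVU (hw _ _ fun t ht1 ht2 => ?_))
    rw [hΨY _ (hBc x hx i).1.1, hYT]
    have := hi t (abs_le.2 ⟨by omega, by omega⟩)
    rw [hj, Nat.unpair_pair] at this
    dsimp only at this ⊢
    rw [add_comm t i, this]
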